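/- arXiv:2602.15347 — 3 statements merged into one kernel-verified Lean document; each statement's English description precedes it below -/
import Mathlib

section
/- Let d ≥ 2 and let C be the set of vertices of a d-dimensional convex polytope in E^d with |C| = n ≥ d+1. Then there exists r₀ > 0 such that for every r ≥ r₀ for which P_{C,r} is a basic r-ball polyhedron with center-polytope conv(C), the Euler–Poincaré formula holds: 1 + (−1)^{d+1} = Σ_{i=0}^{d−1} (−1)^i f_i(P_{C,r}). -/
open Metric Set
open scoped RealInnerProductSpace

/-- The dimension of a set: the dimension of its affine span. -/
noncomputable def setDim {d : ℕ} (A : Set (EuclideanSpace ℝ (Fin d))) : ℕ :=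
  Module.finrank ℝ (affineSpan ℝ A).direction

/-- The farthest-point Voronoi face `V_S`: the set of points whose set of farthest points
of `C` is exactly `S`. -/
def vorF {d : ℕ} (C S : Set (EuclideanSpace ℝ (Fin d))) : Set (EuclideanSpace ℝ (Fin d)) :=
  {x | S = {c | c ∈ C ∧ ∀ c' ∈ C, dist x c' ≤ dist x c}}

/-- `P_{C,r}`: the intersection of the closed balls of radius `r` centered at points of `C`. -/
def ballPoly {d : ℕ} (C : Set (EuclideanSpace ℝ (Fin d))) (r : ℝ) :
    Set (EuclideanSpace ℝ (Fin d)) :=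
  ⋂ c ∈ C, closedBall c r

/-- The `r`-convex hull of `X`. -/
def rConvexHull {d : ℕ} (r : ℝ) (X : Set (EuclideanSpace ℝ (Fin d))) :
    Set (EuclideanSpace ℝ (Fin d)) :=
  ⋂ x ∈ {x | X ⊆ closedBall x r}, closedBall x r

/-- `C` lies in `r`-convex position. -/
def RConvexPosition {d : ℕ} (r : ℝ) (C : Set (EuclideanSpace ℝ (Fin d))) : Prop :=
  (∃ p, C ⊆ ball p r) ∧ ∀ c ∈ C, c ∉ rConvexHull r (C \ {c})

/-- `P_{C,r}` is a basic `r`-ball polyhedron with center-polytope `conv C`. -/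
def IsBasicBallPolyhedron {d : ℕ} (C : Set (EuclideanSpace ℝ (Fin d))) (r : ℝ) : Prop :=
  0 < r ∧ C.Finite ∧ d + 1 ≤ C.ncard ∧ 2 ≤ d ∧
  setDim (convexHull ℝ C) = d ∧
  C = Set.extremePoints ℝ (convexHull ℝ C) ∧
  RConvexPosition r C ∧
  ∀ S ⊆ C, ∀ v, vorF C S = {v} → v ∈ interior (ballPoly C r)

/-- `fFace C r k` is the number of `(k-1)`-dimensional faces of `P_{C,r}`, i.e. the number of
`S ⊆ C` with `V_S ∩ bd(P_{C,r}) ≠ ∅` and `dim V_S = k`. -/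
noncomputable def fFace {d : ℕ} (C : Set (EuclideanSpace ℝ (Fin d))) (r : ℝ) (k : ℕ) : ℕ :=
  {S : Set (EuclideanSpace ℝ (Fin d)) | S ⊆ C ∧
    (vorF C S ∩ frontier (ballPoly C r)).Nonempty ∧ setDim (vorF C S) = k}.ncard

section EulerIntegral
open Filter Topology

/-- `EulerIntegral α β h v`: the function `h` on the line has combinatorial Euler integral `v`,
where `α` and `β` are the weights given to the values of `h` near `+∞` and `-∞`. -/
def EulerIntegral (α β : ℤ) (h : ℝ → ℤ) (v : ℤ) : Prop :=
  ∃ T₀ : Finset ℝ, ∀ T, T₀ ⊆ T → ∀ᶠ ε in 𝓝[>] (0 : ℝ), ∀ᶠ M in atTop,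
    ∑ t ∈ T, (h t - h (t + ε)) + α * h M + β * h (-M) = v

namespace EulerIntegral
variable {α β : ℤ} {h g : ℝ → ℤ} {v w : ℤ}

theorem unique (hv : EulerIntegral α β h v) (hw : EulerIntegral α β h w) : v = w := by
  obtain ⟨T, hT⟩ := hv
  obtain ⟨T', hT'⟩ := hw
  obtain ⟨ε, h1, h2⟩ := ((hT (T ∪ T') Finset.subset_union_left).and
    (hT' (T ∪ T') Finset.subset_union_right)).exists
  obtain ⟨M, h3, h4⟩ := (h1.and h2).exists
  exact h3.symm.trans h4

theorem add (hh : EulerIntegral α β h v) (hg : EulerIntegral α β g w) :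
    EulerIntegral α β (fun t => h t + g t) (v + w) := by
  obtain ⟨T, hT⟩ := hh
  obtain ⟨T', hT'⟩ := hg
  refine ⟨T ∪ T', fun S hS => ?_⟩
  filter_upwards [hT S (Finset.union_subset_left hS), hT' S (Finset.union_subset_right hS)]
    with ε h1 h2
  filter_upwards [h1, h2] with M h3 h4
  rw [← h3, ← h4]
  simp only [Finset.sum_sub_distrib, Finset.sum_add_distrib]
  ring

theorem const_mul (s : ℤ) (hh : EulerIntegral α β h v) :
    EulerIntegral α β (fun t => s * h t) (s * v) := by
  obtain ⟨T, hT⟩ := hh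
  refine ⟨T, fun S hS => ?_⟩
  filter_upwards [hT S hS] with ε h1
  filter_upwards [h1] with M h3
  rw [← h3]
  simp only [← mul_sub, ← Finset.mul_sum]
  ring

theorem const (c : ℤ) : EulerIntegral α β (fun _ => c) ((α + β) * c) :=
  ⟨∅, fun S _ => by simp [add_mul]⟩

theorem sum {ι : Type*} (s : Finset ι) {f : ι → ℝ → ℤ} {v : ι → ℤ}
    (hf : ∀ i ∈ s, EulerIntegral α β (f i) (v i)) :
    EulerIntegral α β (fun t => ∑ i ∈ s, f i t) (∑ i ∈ s, v i) := by
  classical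
  induction s using Finset.induction_on with
  | empty => simpa using const (α := α) (β := β) 0
  | insert a s ha ih =>
    simp only [Finset.sum_insert ha]
    exact (hf a (Finset.mem_insert_self a s)).add
      (ih fun i hi => hf i (Finset.mem_insert_of_mem hi))

theorem indicator_Iic (a : ℝ) : EulerIntegral α β ((Iic a).indicator 1) (1 + β) := by
  refine ⟨{a}, fun S hS => ?_⟩
  have hloc : ∀ t ∈ S, ∀ᶠ ε in 𝓝[>] (0 : ℝ),
      ((Iic a).indicator 1 t - (Iic a).indicator 1 (t + ε) : ℤ) = if t = a then 1 else 0 := by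
    intro t _
    rcases lt_trichotomy t a with hta | rfl | hta
    · filter_upwards [Ioo_mem_nhdsGT (sub_pos.2 hta)] with ε hε
      have : t + ε ≤ a := by linarith [hε.2]
      simp [hta.ne, hta.le, this]
    · filter_upwards [self_mem_nhdsWithin] with ε hε
      have : 0 < ε := hε
      simp [this]
    · filter_upwards [self_mem_nhdsWithin] with ε hε
      have : a < t + ε := by linarith [mem_Ioi.1 hε]
      simp [hta.ne', hta.not_ge, this.not_ge]
  filter_upwards [(Finset.eventually_all S).2 hloc] with ε hε
  filter_upwards [eventually_gt_atTop a, eventually_ge_atTop (-a)] with M h1 h2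
  have : -M ≤ a := by linarith
  rw [Finset.sum_congr rfl hε]
  simp [Finset.singleton_subset_iff.1 hS, h1, this]

theorem indicator_Ici (b : ℝ) : EulerIntegral α β ((Ici b).indicator 1) α := by
  refine ⟨∅, fun S _ => ?_⟩
  have hloc : ∀ t ∈ S, ∀ᶠ ε in 𝓝[>] (0 : ℝ),
      ((Ici b).indicator 1 t - (Ici b).indicator 1 (t + ε) : ℤ) = 0 := by
    intro t _
    rcases lt_or_ge t b with htb | htb
    · filter_upwards [Ioo_mem_nhdsGT (sub_pos.2 htb)] with ε hε
      have : t + ε < b := by linarith [hε.2]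
      simp [htb, this]
    · filter_upwards [self_mem_nhdsWithin] with ε hε
      have : b ≤ t + ε := by linarith [mem_Ioi.1 hε]
      simp [htb, this]
  filter_upwards [(Finset.eventually_all S).2 hloc] with ε hε
  filter_upwards [eventually_ge_atTop b, eventually_gt_atTop (-b)] with M h1 h2
  have : -M < b := by linarith
  rw [Finset.sum_congr rfl hε]
  simp [h1, this]

theorem congr (hh : EulerIntegral α β h v) (hg : ∀ t, g t = h t) (hw : w = v) :
    EulerIntegral α β g w := by
  rwa [hw, funext hg]

theorem indicator_singleton (a : ℝ) : EulerIntegral α β (({a} : Set ℝ).indicator 1) 1 := by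
  refine (((indicator_Iic a).add (indicator_Ici a)).add (const (-1))).congr (fun t => ?_) (by ring)
  rcases lt_trichotomy t a with hta | rfl | hta
  · simp [hta.ne, hta.le, hta]
  · simp
  · simp [hta.ne', hta.le, hta]

open Classical in
theorem indicator_isOpen {I : Set ℝ} (hI : IsOpen I) (hc : I.OrdConnected) (hne : I.Nonempty) :
    EulerIntegral α β (I.indicator 1)
      ((if BddAbove I then 0 else α) + if BddBelow I then -1 else β) := by
  have hbelow : ∀ x ∈ I, ∃ y ∈ I, y < x := fun x hx => by
    obtain ⟨y, hy, hyI⟩ := (Filter.nonempty_of_mem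
      (inter_mem self_mem_nhdsWithin (mem_nhdsWithin_of_mem_nhds (hI.mem_nhds hx)) :
        Iio x ∩ I ∈ 𝓝[<] x))
    exact ⟨y, hyI, hy⟩
  have habove : ∀ x ∈ I, ∃ y ∈ I, x < y := fun x hx => by
    obtain ⟨y, hy, hyI⟩ := (Filter.nonempty_of_mem
      (inter_mem self_mem_nhdsWithin (mem_nhdsWithin_of_mem_nhds (hI.mem_nhds hx)) :
        Ioi x ∩ I ∈ 𝓝[>] x))
    exact ⟨y, hyI, hy⟩
  let lo : Set ℝ := {t | ∀ x ∈ I, t < x}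
  let hi : Set ℝ := {t | ∀ x ∈ I, x < t}
  have hlo : EulerIntegral α β (lo.indicator 1) (if BddBelow I then 1 + β else 0) := by
    split_ifs with hb
    · have : lo = Iic (sInf I) := by
        ext t
        refine ⟨fun ht => le_csInf hne fun x hx => (ht x hx).le, fun ht x hx => ?_⟩
        obtain ⟨y, hy, hyx⟩ := hbelow x hx
        exact (mem_Iic.1 ht).trans_lt ((csInf_le hb hy).trans_lt hyx)
      rw [this]
      exact indicator_Iic _
    · have : lo = ∅ := eq_empty_of_forall_notMem fun t ht => hb ⟨t, fun x hx => (ht x hx).le⟩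
      rw [this]
      exact (const 0).congr (by simp) (by simp)
  have hhi : EulerIntegral α β (hi.indicator 1) (if BddAbove I then α else 0) := by
    split_ifs with hb
    · have : hi = Ici (sSup I) := by
        ext t
        refine ⟨fun ht => csSup_le hne fun x hx => (ht x hx).le, fun ht x hx => ?_⟩
        obtain ⟨y, hy, hyx⟩ := habove x hx
        exact hyx.trans_le ((le_csSup hb hy).trans (mem_Ici.1 ht))
      rw [this]
      exact indicator_Ici _
    · have : hi = ∅ := eq_empty_of_forall_notMem fun t ht => hb ⟨t, fun x hx => (ht x hx).le⟩
      rw [this]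
      exact (const 0).congr (by simp) (by simp)
  refine (((const 1).add (hlo.const_mul (-1))).add (hhi.const_mul (-1))).congr (fun t => ?_)
    (by split_ifs <;> ring)
  obtain ⟨z, hz⟩ := hne
  by_cases ht : t ∈ I
  · have h1 : t ∉ lo := fun h => (h t ht).false
    have h2 : t ∉ hi := fun h => (h t ht).false
    simp [ht, h1, h2]
  · by_cases h1 : t ∈ lo
    · have h2 : t ∉ hi := fun h => ((h z hz).trans (h1 z hz)).false
      simp [ht, h1, h2]
    · have h2 : t ∈ hi := by
        intro x hx
        by_contra hxt
        simp only [lo, mem_ofPred_eq, not_forall, not_lt] at h1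
        obtain ⟨y, hy, hyt⟩ := h1
        exact ht (hc.out hy hx ⟨hyt, not_lt.1 hxt⟩)
      simp [ht, h1, h2]

end EulerIntegral
end EulerIntegral

section OpenPolyhedron
variable {E : Type*} [NormedAddCommGroup E] [InnerProductSpace ℝ E]

/-- The affine hyperplane `{x | ⟪w, x⟫ = t}` (all of `E` or `∅` when `w = 0`). -/
def affineHyperplane (w : E) (t : ℝ) : AffineSubspace ℝ E where
  carrier := {x | ⟪w, x⟫ = t}
  smul_vsub_vadd_mem' := by
    intro c p₁ p₂ p₃ (h₁ : ⟪w, p₁⟫ = t) (h₂ : ⟪w, p₂⟫ = t) (h₃ : ⟪w, p₃⟫ = t)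
    change ⟪w, c • (p₁ - p₂) + p₃⟫ = t
    simp [inner_add_right, inner_smul_right, inner_sub_right, h₁, h₂, h₃]

theorem mem_affineHyperplane {w x : E} {t : ℝ} : x ∈ affineHyperplane w t ↔ ⟪w, x⟫ = t := Iff.rfl

theorem mem_direction_affineHyperplane {w p v : E} {t : ℝ} (hp : p ∈ affineHyperplane w t) :
    v ∈ (affineHyperplane w t).direction ↔ ⟪w, v⟫ = 0 := by
  rw [← AffineSubspace.vadd_mem_iff_mem_direction v hp, mem_affineHyperplane, vadd_eq_add,
    inner_add_right, mem_affineHyperplane.1 hp, add_eq_right]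

theorem mem_direction_inf_affineHyperplane {L : AffineSubspace ℝ E} {w p v : E} {t : ℝ}
    (hp : p ∈ L ⊓ affineHyperplane w t) :
    v ∈ (L ⊓ affineHyperplane w t).direction ↔ v ∈ L.direction ∧ ⟪w, v⟫ = 0 := by
  rw [AffineSubspace.direction_inf_of_mem hp.1 hp.2, Submodule.mem_inf,
    mem_direction_affineHyperplane hp.2]

theorem finrank_direction_inf_affineHyperplane [FiniteDimensional ℝ E] {L : AffineSubspace ℝ E}
    {w p v : E} {t : ℝ} (hp : p ∈ L ⊓ affineHyperplane w t) (hv : v ∈ L.direction)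
    (hwv : ⟪w, v⟫ ≠ 0) :
    Module.finrank ℝ (L ⊓ affineHyperplane w t).direction + 1 = Module.finrank ℝ L.direction := by
  let f : Module.Dual ℝ L.direction := (innerₛₗ ℝ w).comp L.direction.subtype
  have hf : f ≠ 0 := fun h => hwv (by simpa [f] using LinearMap.congr_fun h ⟨v, hv⟩)
  rw [← Module.Dual.finrank_ker_add_one_of_ne_zero hf,
    ← Submodule.finrank_map_subtype_eq L.direction (LinearMap.ker f)]
  have : (L ⊓ affineHyperplane w t).direction =
      (LinearMap.ker f).map L.direction.subtype := by
    ext u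
    rw [mem_direction_inf_affineHyperplane hp]
    simp [f, and_comm]
  rw [this]

/-- The relatively open polyhedron cut out of `L` by the strict inequalities
`j.2 < ⟪j.1, x⟫`, `j ∈ J`. -/
def openPolyhedron (L : AffineSubspace ℝ E) (J : Finset (E × ℝ)) : Set E :=
  {x | x ∈ L ∧ ∀ j ∈ J, j.2 < ⟪j.1, x⟫}

/-- The recession cone of `openPolyhedron L J` (when that is nonempty). -/
def recessionCone (L : AffineSubspace ℝ E) (J : Finset (E × ℝ)) : Set E :=
  {u | u ∈ L.direction ∧ ∀ j ∈ J, 0 ≤ ⟪j.1, u⟫}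

variable {L : AffineSubspace ℝ E} {J : Finset (E × ℝ)}

theorem convex_openPolyhedron : Convex ℝ (openPolyhedron L J) := by
  have : openPolyhedron L J = (L : Set E) ∩ ⋂ j ∈ J, {x | j.2 < ⟪j.1, x⟫} := by
    ext x
    simp [openPolyhedron]
  rw [this]
  exact L.convex.inter (convex_iInter₂ fun j _ =>
    convex_halfSpace_gt (f := fun x => ⟪j.1, x⟫) (innerₛₗ ℝ j.1).isLinear j.2)

theorem eventually_add_smul_mem_openPolyhedron {x v : E} (hx : x ∈ openPolyhedron L J)
    (hv : v ∈ L.direction) : ∀ᶠ s : ℝ in nhds 0, x + s • v ∈ openPolyhedron L J := by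
  have h : ∀ j ∈ J, ∀ᶠ s : ℝ in nhds 0, j.2 < ⟪j.1, x + s • v⟫ := fun j hj =>
    (by fun_prop : Continuous fun s : ℝ => ⟪j.1, x + s • v⟫).continuousAt.eventually_const_lt
      (by simpa using hx.2 j hj)
  filter_upwards [(Finset.eventually_all J).2 h] with s hs
  refine ⟨?_, hs⟩
  rw [add_comm]
  exact AffineSubspace.vadd_mem_of_mem_direction (L.direction.smul_mem s hv) hx.1

theorem add_smul_mem_openPolyhedron_of_mem_recessionCone {x u : E} (hx : x ∈ openPolyhedron L J)
    (hu : u ∈ recessionCone L J) {s : ℝ} (hs : 0 ≤ s) : x + s • u ∈ openPolyhedron L J := by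
  refine ⟨?_, fun j hj => ?_⟩
  · rw [add_comm]
    exact AffineSubspace.vadd_mem_of_mem_direction (L.direction.smul_mem s hu.1) hx.1
  · rw [inner_add_right, inner_smul_right]
    linarith [hx.2 j hj, mul_nonneg hs (hu.2 j hj)]

theorem direction_affineSpan_openPolyhedron (hne : (openPolyhedron L J).Nonempty) :
    (affineSpan ℝ (openPolyhedron L J)).direction = L.direction := by
  refine le_antisymm (AffineSubspace.direction_le (affineSpan_le.2 fun x hx => hx.1))
    fun v hv => ?_
  obtain ⟨x, hx⟩ := hne
  obtain ⟨s, hs, hs0⟩ := (((eventually_add_smul_mem_openPolyhedron hx hv).filter_mono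
    nhdsWithin_le_nhds).and self_mem_nhdsWithin : ∀ᶠ s in nhdsWithin (0 : ℝ) (Ioi 0), _).exists
  have h := AffineSubspace.vsub_mem_direction (subset_affineSpan ℝ _ hs)
    (subset_affineSpan ℝ _ hx)
  rw [vsub_eq_sub, add_sub_cancel_left] at h
  exact (Submodule.smul_mem_iff _ (ne_of_gt hs0)).1 h

/-- A closed polyhedron with trivial recession cone is bounded. -/
theorem isBounded_of_recessionCone_subset [FiniteDimensional ℝ E]
    (h : recessionCone L J ⊆ {0}) :
    Bornology.IsBounded {x | x ∈ L ∧ ∀ j ∈ J, j.2 ≤ ⟪j.1, x⟫} := by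
  rcases (L : Set E).eq_empty_or_nonempty with hL | ⟨p, hp⟩
  · refine Bornology.isBounded_empty.subset fun x hx => ?_
    rw [← hL]
    exact hx.1
  let F : E → ℝ := fun u => ∑ j ∈ J, max 0 (-⟪j.1, u⟫)
  have hF : Continuous F := by fun_prop
  have hFpos : ∀ u ∈ (L.direction : Set E) ∩ sphere 0 1, 0 < F u := by
    rintro u ⟨huL, hu1⟩
    have hu0 : u ≠ 0 := fun h0 => by simp [h0] at hu1
    have : ∃ j ∈ J, ⟪j.1, u⟫ < 0 := by
      by_contra! hj
      exact hu0 (h ⟨huL, hj⟩)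
    obtain ⟨j, hj, hju⟩ := this
    exact Finset.sum_pos' (fun i _ => le_max_left _ _)
      ⟨j, hj, lt_max_of_lt_right (neg_pos.2 hju)⟩
  have hcpt : IsCompact ((L.direction : Set E) ∩ sphere 0 1) :=
    (isCompact_sphere 0 1).inter_left L.direction.closed_of_finiteDimensional
  obtain ⟨δ, hδ, hδF⟩ : ∃ δ > 0, ∀ u ∈ (L.direction : Set E) ∩ sphere 0 1, δ ≤ F u := by
    rcases ((L.direction : Set E) ∩ sphere 0 1).eq_empty_or_nonempty with he | hne
    · exact ⟨1, one_pos, by simp [he]⟩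
    · obtain ⟨u, hu, hmin⟩ := hcpt.exists_isMinOn hne hF.continuousOn
      exact ⟨F u, hFpos u hu, fun v hv => hmin hv⟩
  have hhom : ∀ v ∈ L.direction, δ * ‖v‖ ≤ F v := by
    intro v hv
    rcases eq_or_ne v 0 with rfl | hv0
    · simp [F]
    have hn : 0 < ‖v‖ := norm_pos_iff.2 hv0
    have hs : F v = ‖v‖ * F (‖v‖⁻¹ • v) := by
      simp only [F, Finset.mul_sum]
      refine Finset.sum_congr rfl fun j _ => ?_
      rw [mul_max_of_nonneg _ _ hn.le, inner_smul_right]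
      field_simp
      simp
    rw [hs, mul_comm]
    refine mul_le_mul_of_nonneg_left (hδF _ ⟨L.direction.smul_mem _ hv, ?_⟩) hn.le
    simp [norm_smul, hn.ne']
  refine isBounded_iff_subset_closedBall p |>.2
    ⟨(∑ j ∈ J, max 0 (⟪j.1, p⟫ - j.2)) / δ, fun x hx => ?_⟩
  rw [mem_closedBall, dist_eq_norm, le_div_iff₀ hδ, mul_comm]
  refine (hhom _ (AffineSubspace.vsub_mem_direction hx.1 hp)).trans
    (Finset.sum_le_sum fun j hj => max_le_max le_rfl ?_)
  rw [vsub_eq_sub, inner_sub_right]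
  linarith [hx.2 j hj]

theorem isBounded_openPolyhedron [FiniteDimensional ℝ E] (h : recessionCone L J ⊆ {0}) :
    Bornology.IsBounded (openPolyhedron L J) :=
  (isBounded_of_recessionCone_subset h).subset fun _ hx => ⟨hx.1, fun j hj => (hx.2 j hj).le⟩

/-- A linear functional positive on the nonzero part of the recession cone is bounded below. -/
theorem bddBelow_inner_image_openPolyhedron [FiniteDimensional ℝ E] {w : E}
    (h : ∀ u ∈ recessionCone L J, ⟪w, u⟫ ≤ 0 → u = 0) :
    BddBelow ((fun x => ⟪w, x⟫) '' openPolyhedron L J) := by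
  classical
  have hb : Bornology.IsBounded
      {x | x ∈ L ∧ ∀ j ∈ insert ((-w, 0) : E × ℝ) J, j.2 ≤ ⟪j.1, x⟫} :=
    isBounded_of_recessionCone_subset fun u hu => by
      have := hu.2
      rw [Finset.forall_mem_insert] at this
      exact h u ⟨hu.1, this.2⟩ (by simpa using this.1)
  obtain ⟨R, hR⟩ := isBounded_iff_forall_norm_le.1 hb
  refine ⟨min 0 (-(‖w‖ * R)), ?_⟩
  rintro _ ⟨x, hx, rfl⟩
  rcases le_total ⟪w, x⟫ 0 with hwx | hwx
  · refine (min_le_right _ _).trans (neg_le_of_abs_le ((abs_real_inner_le_norm w x).trans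
      (mul_le_mul_of_nonneg_left (hR x ⟨hx.1, ?_⟩) (norm_nonneg w))))
    rw [Finset.forall_mem_insert]
    exact ⟨by simpa using hwx, fun j hj => (hx.2 j hj).le⟩
  · exact (min_le_left _ _).trans hwx

theorem ordConnected_inner_image_openPolyhedron (w : E) :
    ((fun x => ⟪w, x⟫) '' openPolyhedron L J).OrdConnected :=
  (convex_openPolyhedron.is_linear_image (innerₛₗ ℝ w).isLinear).ordConnected

theorem isOpen_inner_image_openPolyhedron {w v : E} (hv : v ∈ L.direction) (hwv : ⟪w, v⟫ ≠ 0) :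
    IsOpen ((fun x => ⟪w, x⟫) '' openPolyhedron L J) := by
  rw [isOpen_iff_mem_nhds]
  rintro _ ⟨x, hx, rfl⟩
  have hc : Filter.Tendsto (fun t : ℝ => (t - ⟪w, x⟫) / ⟪w, v⟫) (nhds ⟪w, x⟫) (nhds 0) := by
    have : Continuous fun t : ℝ => (t - ⟪w, x⟫) / ⟪w, v⟫ := by fun_prop
    simpa using this.tendsto ⟪w, x⟫
  filter_upwards [hc.eventually (eventually_add_smul_mem_openPolyhedron hx hv)] with t ht
  refine ⟨_, ht, ?_⟩
  simp only [inner_add_right, inner_smul_right]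
  field_simp
  ring

theorem mem_inner_image_openPolyhedron {w : E} {t : ℝ} :
    t ∈ (fun x => ⟪w, x⟫) '' openPolyhedron L J ↔
      (openPolyhedron (L ⊓ affineHyperplane w t) J).Nonempty :=
  ⟨fun ⟨x, hx, hxt⟩ => ⟨x, ⟨hx.1, hxt⟩, hx.2⟩, fun ⟨x, hx⟩ => ⟨x, ⟨hx.1.1, hx.2⟩, hx.1.2⟩⟩

variable {w : E}

theorem not_bddAbove_inner_image_openPolyhedron {u : E} (hne : (openPolyhedron L J).Nonempty)
    (hu : u ∈ recessionCone L J) (hwu : 0 < ⟪w, u⟫) :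
    ¬ BddAbove ((fun x => ⟪w, x⟫) '' openPolyhedron L J) := by
  rintro ⟨b, hb⟩
  obtain ⟨x, hx⟩ := hne
  have hxb : ⟪w, x⟫ ≤ b := hb ⟨x, hx, rfl⟩
  have := hb ⟨_, add_smul_mem_openPolyhedron_of_mem_recessionCone hx hu
    (s := (b - ⟪w, x⟫ + 1) / ⟪w, u⟫) (div_nonneg (by linarith) hwu.le), rfl⟩
  simp only [inner_add_right, inner_smul_right, div_mul_cancel₀ _ hwu.ne'] at this
  linarith

theorem not_bddBelow_inner_image_openPolyhedron {u : E} (hne : (openPolyhedron L J).Nonempty)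
    (hu : u ∈ recessionCone L J) (hwu : ⟪w, u⟫ < 0) :
    ¬ BddBelow ((fun x => ⟪w, x⟫) '' openPolyhedron L J) := by
  rintro ⟨b, hb⟩
  refine not_bddAbove_inner_image_openPolyhedron (w := -w) hne hu (by simpa using hwu) ⟨-b, ?_⟩
  rintro _ ⟨x, hx, rfl⟩
  have : b ≤ ⟪w, x⟫ := hb ⟨x, hx, rfl⟩
  simp only [inner_neg_left]
  linarith

/-- If a pointed cone meets the hyperplane `w^⊥` only at the origin, it lies on one side of it. -/
theorem eq_zero_of_mem_recessionCone
    (hpt : ∀ u ∈ L.direction, (∀ j ∈ J, ⟪j.1, u⟫ = 0) → u = 0)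
    (hker : ∀ u ∈ recessionCone L J, ⟪w, u⟫ = 0 → u = 0) {u u' : E}
    (hu : u ∈ recessionCone L J) (hwu : 0 < ⟪w, u⟫) (hu' : u' ∈ recessionCone L J)
    (hwu' : ⟪w, u'⟫ ≤ 0) : u' = 0 := by
  have hy := hker (⟪w, u⟫ • u' + (-⟪w, u'⟫) • u)
    ⟨L.direction.add_mem (L.direction.smul_mem _ hu'.1) (L.direction.smul_mem _ hu.1),
      fun j hj => by
        rw [inner_add_right, inner_smul_right, inner_smul_right]
        exact add_nonneg (mul_nonneg hwu.le (hu'.2 j hj))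
          (mul_nonneg (neg_nonneg.2 hwu') (hu.2 j hj))⟩
    (by rw [inner_add_right, inner_smul_right, inner_smul_right]; ring)
  refine hpt u' hu'.1 fun j hj => ?_
  have h1 : ⟪j.1, ⟪w, u⟫ • u' + (-⟪w, u'⟫) • u⟫ = 0 := by rw [hy, inner_zero_right]
  rw [inner_add_right, inner_smul_right, inner_smul_right] at h1
  have h2 := mul_nonneg hwu.le (hu'.2 j hj)
  have h3 := mul_nonneg (neg_nonneg.2 hwu') (hu.2 j hj)
  exact (mul_eq_zero.1 (by linarith : ⟪w, u⟫ * ⟪j.1, u'⟫ = 0)).resolve_left hwu.ne'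

open Classical in
/-- `g L` if the open polyhedron is nonempty, and `0` otherwise. -/
noncomputable def polyhedronWeight (g : AffineSubspace ℝ E → ℤ) (J : Finset (E × ℝ))
    (L : AffineSubspace ℝ E) : ℤ :=
  if (openPolyhedron L J).Nonempty then g L else 0

open Classical in
theorem eulerIntegral_polyhedronWeight {α β s : ℤ} {g : AffineSubspace ℝ E → ℤ}
    (hconst : ∀ x ∈ openPolyhedron L J, (∃ v ∈ L.direction, ⟪w, v⟫ ≠ 0) →
      (∀ t, ∀ p ∈ L ⊓ affineHyperplane w t, g (L ⊓ affineHyperplane w t) = s) ∧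
      g L = s * ((if BddAbove ((fun x => ⟪w, x⟫) '' openPolyhedron L J) then 0 else α) +
        if BddBelow ((fun x => ⟪w, x⟫) '' openPolyhedron L J) then -1 else β)) :
    EulerIntegral α β (fun t => polyhedronWeight g J (L ⊓ affineHyperplane w t))
      (polyhedronWeight g J L) := by
  simp only [polyhedronWeight, ← mem_inner_image_openPolyhedron]
  by_cases hne : (openPolyhedron L J).Nonempty
  · obtain ⟨x, hx⟩ := hne
    by_cases hw : ∃ v ∈ L.direction, ⟪w, v⟫ ≠ 0
    · obtain ⟨v, hv, hwv⟩ := hw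
      obtain ⟨hs, hL⟩ := hconst x hx ⟨v, hv, hwv⟩
      refine ((EulerIntegral.indicator_isOpen (isOpen_inner_image_openPolyhedron hv hwv)
        (ordConnected_inner_image_openPolyhedron w) (Set.Nonempty.image _ ⟨x, hx⟩)).const_mul
          s).congr (fun t => ?_) ?_
      · by_cases ht : t ∈ (fun x => ⟪w, x⟫) '' openPolyhedron L J
        · obtain ⟨y, hy⟩ := mem_inner_image_openPolyhedron.1 ht
          rw [if_pos ht, indicator_of_mem ht, hs t y hy.1, Pi.one_apply, mul_one]
        · rw [if_neg ht, indicator_of_notMem ht, mul_zero]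
      · rw [if_pos ⟨x, hx⟩, hL]
    · push Not at hw
      have hLx : ∀ y ∈ L, ⟪w, y⟫ = ⟪w, x⟫ := fun y hy => by
        have := hw _ (AffineSubspace.vsub_mem_direction hy hx.1)
        rwa [vsub_eq_sub, inner_sub_right, sub_eq_zero] at this
      refine ((EulerIntegral.indicator_singleton ⟪w, x⟫).const_mul (g L)).congr
        (fun t => ?_) (by rw [if_pos ⟨x, hx⟩, mul_one])
      by_cases ht : t = ⟪w, x⟫
      · have hle : L ≤ affineHyperplane w t := fun y hy => (hLx y hy).trans ht.symm
        rw [if_pos ⟨x, hx, ht.symm⟩, inf_eq_left.2 hle]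
        simp [ht]
      · rw [if_neg, indicator_of_notMem (by simpa using ht), mul_zero]
        rintro ⟨y, hy, hyt⟩
        exact ht (hyt.symm.trans (hLx y hy.1))
  · rw [not_nonempty_iff_eq_empty] at hne
    simpa [hne] using EulerIntegral.const (α := α) (β := β) 0

end OpenPolyhedron

section EulerRelation
variable {E : Type*} [NormedAddCommGroup E] [InnerProductSpace ℝ E] [FiniteDimensional ℝ E]

theorem sum_eq_pow_of_eulerIntegral {ι : Type*} {α β : ℤ} (s : Finset ι)
    (e : ι → AffineSubspace ℝ E → ℤ) (hpt : ∀ p, ∑ i ∈ s, e i (AffineSubspace.mk' p ⊥) = 1)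
    (hslice : ∀ i ∈ s, ∀ L w,
      EulerIntegral α β (fun t => e i (L ⊓ affineHyperplane w t)) (e i L))
    {n : ℕ} {L : AffineSubspace ℝ E} (hL : (L : Set E).Nonempty)
    (hn : Module.finrank ℝ L.direction = n) : ∑ i ∈ s, e i L = (α + β) ^ n := by
  induction n generalizing L with
  | zero =>
    obtain ⟨p, hp⟩ := hL
    rw [← AffineSubspace.mk'_eq hp, Submodule.finrank_eq_zero.1 hn, hpt, pow_zero]
  | succ n ih =>
    obtain ⟨p, hp⟩ := hL
    obtain ⟨v, hv, hv0⟩ : ∃ v ∈ L.direction, v ≠ 0 := by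
      refine Submodule.exists_mem_ne_zero_of_ne_bot fun h => ?_
      rw [h, finrank_bot] at hn
      exact n.succ_ne_zero hn.symm
    have hvv : ⟪v, v⟫ ≠ 0 := inner_self_ne_zero.2 hv0
    have hconst : ∀ t : ℝ, ∑ i ∈ s, e i (L ⊓ affineHyperplane v t) = (α + β) ^ n := by
      intro t
      have hq : ((t - ⟪v, p⟫) / ⟪v, v⟫) • v + p ∈ L ⊓ affineHyperplane v t := by
        refine ⟨AffineSubspace.vadd_mem_of_mem_direction (L.direction.smul_mem _ hv) hp, ?_⟩
        change ⟪v, _⟫ = t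
        rw [inner_add_right, inner_smul_right, div_mul_cancel₀ _ hvv, sub_add_cancel]
      refine ih ⟨_, hq⟩ ?_
      have := finrank_direction_inf_affineHyperplane hq hv hvv
      omega
    have hsum := EulerIntegral.sum s fun i hi => hslice i hi L v
    simp only [hconst] at hsum
    rw [hsum.unique (EulerIntegral.const _), pow_succ, mul_comm]

variable {L : AffineSubspace ℝ E} {J : Finset (E × ℝ)} {w : E}

theorem eulerIntegral_neg_one_pow_finrank :
    EulerIntegral 0 (-1) (fun t => polyhedronWeight
      (fun L => (-1) ^ Module.finrank ℝ L.direction) J (L ⊓ affineHyperplane w t))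
      (polyhedronWeight (fun L => (-1) ^ Module.finrank ℝ L.direction) J L) := by
  refine eulerIntegral_polyhedronWeight (s := -(-1) ^ Module.finrank ℝ L.direction) ?_
  rintro x hx ⟨v, hv, hwv⟩
  refine ⟨fun t p hp => ?_, by simp⟩
  rw [← finrank_direction_inf_affineHyperplane hp hv hwv, pow_succ]
  ring

theorem bddAbove_inner_image_openPolyhedron (h : ∀ u ∈ recessionCone L J, 0 ≤ ⟪w, u⟫ → u = 0) :
    BddAbove ((fun x => ⟪w, x⟫) '' openPolyhedron L J) := by
  obtain ⟨b, hb⟩ := bddBelow_inner_image_openPolyhedron (w := -w) (L := L) (J := J)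
    fun u hu hwu => h u hu (by simpa using hwu)
  refine ⟨-b, ?_⟩
  rintro _ ⟨x, hx, rfl⟩
  have := hb ⟨x, hx, rfl⟩
  simp only [inner_neg_left] at this ⊢
  linarith

open Classical in
theorem eulerIntegral_bounded_neg_one_pow_finrank
    (hpt : ∀ u ∈ L.direction, (∀ j ∈ J, ⟪j.1, u⟫ = 0) → u = 0) :
    EulerIntegral 1 0 (fun t => polyhedronWeight
      (fun L => if recessionCone L J ⊆ {0} then (-1) ^ Module.finrank ℝ L.direction else 0) J
        (L ⊓ affineHyperplane w t))
      (polyhedronWeight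
        (fun L => if recessionCone L J ⊆ {0} then (-1) ^ Module.finrank ℝ L.direction else 0)
        J L) := by
  refine eulerIntegral_polyhedronWeight
    (s := if ∀ u ∈ recessionCone L J, ⟪w, u⟫ = 0 → u = 0 then
      -(-1) ^ Module.finrank ℝ L.direction else 0) ?_
  rintro x hx ⟨v, hv, hwv⟩
  refine ⟨fun t p hp => ?_, ?_⟩
  · have : recessionCone (L ⊓ affineHyperplane w t) J ⊆ {0} ↔
        ∀ u ∈ recessionCone L J, ⟪w, u⟫ = 0 → u = 0 :=
      ⟨fun h u hu hwu => h ⟨(mem_direction_inf_affineHyperplane hp).2 ⟨hu.1, hwu⟩, hu.2⟩,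
        fun h u hu => h u ⟨((mem_direction_inf_affineHyperplane hp).1 hu.1).1, hu.2⟩
          ((mem_direction_inf_affineHyperplane hp).1 hu.1).2⟩
    simp only [this, ← finrank_direction_inf_affineHyperplane hp hv hwv, pow_succ]
    simp
  by_cases hker : ∀ u ∈ recessionCone L J, ⟪w, u⟫ = 0 → u = 0
  · rw [if_pos hker]
    by_cases hrec : recessionCone L J ⊆ {0}
    · rw [if_pos hrec, if_pos (bddAbove_inner_image_openPolyhedron fun u hu _ => hrec hu),
        if_pos (bddBelow_inner_image_openPolyhedron fun u hu _ => hrec hu)]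
      ring
    · rw [if_neg hrec]
      obtain ⟨u, hu, hu0⟩ := not_subset.1 hrec
      rcases lt_trichotomy ⟪w, u⟫ 0 with hwu | hwu | hwu
      · rw [if_pos, if_neg (not_bddBelow_inner_image_openPolyhedron ⟨x, hx⟩ hu hwu)]
        · simp
        · refine bddAbove_inner_image_openPolyhedron fun u' hu' hwu' => ?_
          exact eq_zero_of_mem_recessionCone (w := -w) hpt
            (fun u hu h => hker u hu (by simpa using h)) hu (by simpa using hwu) hu'
            (by simpa using hwu')
      · exact absurd (hker u hu hwu) hu0
      · rw [if_neg (not_bddAbove_inner_image_openPolyhedron ⟨x, hx⟩ hu hwu), if_pos]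
        · simp
        · exact bddBelow_inner_image_openPolyhedron fun u' hu' hwu' =>
            eq_zero_of_mem_recessionCone hpt hker hu hwu hu' hwu'
  · rw [if_neg hker, if_neg, zero_mul]
    exact fun h => hker fun u hu _ => h hu

theorem sum_polyhedronWeight_eq_pow {ι : Type*} {α β : ℤ} (s : Finset ι)
    (P : ι → AffineSubspace ℝ E) (K : ι → Finset (E × ℝ))
    (hpart : ∀ x, ∃! i, i ∈ s ∧ x ∈ openPolyhedron (P i) (K i))
    (g : ι → AffineSubspace ℝ E → ℤ) (hg : ∀ i ∈ s, ∀ L, L.direction = ⊥ → g i L = 1)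
    (hslice : ∀ i ∈ s, ∀ L w, L ≤ P i → EulerIntegral α β
      (fun t => polyhedronWeight (g i) (K i) (L ⊓ affineHyperplane w t))
      (polyhedronWeight (g i) (K i) L)) :
    ∑ i ∈ s, polyhedronWeight (g i) (K i) (P i) = (α + β) ^ Module.finrank ℝ E := by
  have h := sum_eq_pow_of_eulerIntegral s (fun i L => polyhedronWeight (g i) (K i) (P i ⊓ L))
    (α := α) (β := β) (fun p => ?_)
    (fun i hi L w => by
      simpa only [inf_assoc] using hslice i hi (P i ⊓ L) w inf_le_left)
    (L := ⊤) ⟨0, AffineSubspace.mem_top ℝ E 0⟩ (n := Module.finrank ℝ E)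
    (by rw [AffineSubspace.direction_top, finrank_top])
  · simpa using h
  obtain ⟨i, ⟨hi, hpi⟩, huniq⟩ := hpart p
  have hmem : p ∈ AffineSubspace.mk' p (⊥ : Submodule ℝ E) := AffineSubspace.self_mem_mk' p ⊥
  have hmem' : ∀ q ∈ AffineSubspace.mk' p (⊥ : Submodule ℝ E), q = p := fun q hq => by
    simpa [AffineSubspace.mem_mk', sub_eq_zero] using hq
  rw [Finset.sum_eq_single_of_mem i hi]
  · rw [polyhedronWeight, if_pos ⟨p, ⟨hpi.1, hmem⟩, hpi.2⟩, hg i hi]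
    rw [AffineSubspace.direction_inf_of_mem hpi.1 hmem, AffineSubspace.direction_mk', inf_bot_eq]
  · intro k hk hki
    refine if_neg ?_
    rintro ⟨q, hq⟩
    obtain rfl := hmem' q hq.1.2
    exact hki (huniq k ⟨hk, hq.1.1, hq.2⟩)

open Classical in
/-- Euler's relation for the unbounded cells of a partition of `E` into line-free relatively open
polyhedra. -/
theorem sum_unbounded_neg_one_pow_finrank {ι : Type*} (s : Finset ι)
    (P : ι → AffineSubspace ℝ E) (K : ι → Finset (E × ℝ))
    (hpart : ∀ x, ∃! i, i ∈ s ∧ x ∈ openPolyhedron (P i) (K i))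
    (hpt : ∀ i ∈ s, ∀ u ∈ (P i).direction, (∀ j ∈ K i, ⟪j.1, u⟫ = 0) → u = 0) :
    ∑ i ∈ s with (openPolyhedron (P i) (K i)).Nonempty ∧ ¬ recessionCone (P i) (K i) ⊆ {0},
      (-1 : ℤ) ^ Module.finrank ℝ (P i).direction = (-1) ^ Module.finrank ℝ E - 1 := by
  have h1 := sum_polyhedronWeight_eq_pow s P K hpart
    (fun _ L => (-1) ^ Module.finrank ℝ L.direction) (fun i _ L hL => by rw [hL, finrank_bot, pow_zero])
    (fun i _ L w _ => eulerIntegral_neg_one_pow_finrank)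
  have h2 := sum_polyhedronWeight_eq_pow s P K hpart
    (fun i L => if recessionCone L (K i) ⊆ {0} then (-1) ^ Module.finrank ℝ L.direction else 0)
    (fun i _ L hL => by
      have : recessionCone L (K i) ⊆ {0} := fun u hu => by simpa [hL] using hu.1
      rw [if_pos this, hL, finrank_bot, pow_zero])
    (fun i hi L w hL => eulerIntegral_bounded_neg_one_pow_finrank fun u hu =>
      hpt i hi u (AffineSubspace.direction_le hL hu))
  rw [zero_add] at h1
  rw [add_zero, one_pow] at h2
  refine Eq.trans ?_ (congrArg₂ (· - ·) h1 h2)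
  rw [← Finset.sum_sub_distrib, Finset.sum_filter]
  refine Finset.sum_congr rfl fun i _ => ?_
  simp only [polyhedronWeight]
  clear h1 h2
  split_ifs <;> simp_all

end EulerRelation

section FarthestVoronoi
variable {E : Type*} [NormedAddCommGroup E] [InnerProductSpace ℝ E]

theorem dist_sq_sub_dist_sq (x c c' : E) :
    dist x c ^ 2 - dist x c' ^ 2 = 2 * (⟪c' - c, x⟫ - (‖c'‖ ^ 2 - ‖c‖ ^ 2) / 2) := by
  rw [dist_eq_norm, dist_eq_norm, norm_sub_sq_real, norm_sub_sq_real, inner_sub_left,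
    real_inner_comm x c, real_inner_comm x c']
  ring

theorem dist_lt_dist_iff_lt_inner {x c c' : E} :
    dist x c' < dist x c ↔ (‖c'‖ ^ 2 - ‖c‖ ^ 2) / 2 < ⟪c' - c, x⟫ := by
  rw [← sq_lt_sq₀ dist_nonneg dist_nonneg, ← sub_pos, dist_sq_sub_dist_sq]
  simp

theorem dist_eq_dist_iff_inner_eq {x c c' : E} :
    dist x c' = dist x c ↔ ⟪c' - c, x⟫ = (‖c'‖ ^ 2 - ‖c‖ ^ 2) / 2 := by
  rw [← sq_eq_sq₀ dist_nonneg dist_nonneg, eq_comm, ← sub_eq_zero, dist_sq_sub_dist_sq]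
  simp [sub_eq_zero]

/-- The affine subspace of points equidistant from all points of `S`. -/
noncomputable def equidistantSubspace (S : Set E) : AffineSubspace ℝ E :=
  ⨅ c ∈ S, ⨅ c' ∈ S, affineHyperplane (c' - c) ((‖c'‖ ^ 2 - ‖c‖ ^ 2) / 2)

theorem mem_equidistantSubspace {S : Set E} {x : E} :
    x ∈ equidistantSubspace S ↔ ∀ c ∈ S, ∀ c' ∈ S, dist x c' = dist x c := by
  simp only [equidistantSubspace, AffineSubspace.mem_iInf_iff, mem_affineHyperplane,
    dist_eq_dist_iff_inner_eq]

open Classical in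
/-- The strict inequalities expressing that every point of `S` is farther than every point of
`T \ S`. -/
noncomputable def farthestConstraints (T : Finset E) (S : Set E) : Finset (E × ℝ) :=
  ((T ×ˢ T).filter fun p => p.1 ∈ S ∧ p.2 ∉ S).image
    fun p => (p.2 - p.1, (‖p.2‖ ^ 2 - ‖p.1‖ ^ 2) / 2)

theorem forall_mem_farthestConstraints {F : Type*} [NormedAddCommGroup F] {T : Finset F}
    {S : Set F} (hS : S ⊆ T) {q : F × ℝ → Prop} :
    (∀ j ∈ farthestConstraints T S, q j) ↔
      ∀ c ∈ S, ∀ c' ∈ T, c' ∉ S → q (c' - c, (‖c'‖ ^ 2 - ‖c‖ ^ 2) / 2) := by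
  simp only [farthestConstraints, Finset.forall_mem_image, Finset.mem_filter, Finset.mem_product]
  exact ⟨fun h c hc c' hc' hS' => h (x := (c, c')) ⟨⟨hS hc, hc'⟩, hc, hS'⟩,
    fun h p hp => h p.1 hp.2.1 p.2 hp.1.2 hp.2.2⟩

variable {d : ℕ} {T : Finset (EuclideanSpace ℝ (Fin d))} {S : Set (EuclideanSpace ℝ (Fin d))}

theorem vorF_eq_openPolyhedron (hS : S ⊆ T) (hne : S.Nonempty) :
    vorF T S = openPolyhedron (equidistantSubspace S) (farthestConstraints T S) := by
  ext x
  simp only [vorF, openPolyhedron, mem_ofPred_eq, forall_mem_farthestConstraints hS,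
    mem_equidistantSubspace, ← dist_lt_dist_iff_lt_inner]
  constructor
  · intro h
    have hmem : ∀ c, c ∈ S ↔ c ∈ (T : Set _) ∧ ∀ c' ∈ (T : Set _), dist x c' ≤ dist x c :=
      fun c => ⟨fun hc => by rw [h] at hc; exact hc, fun hc => by rw [h]; exact hc⟩
    refine ⟨fun c hc c' hc' => le_antisymm (((hmem c).1 hc).2 c' (hS hc'))
      (((hmem c').1 hc').2 c (hS hc)), fun c hc c' hc' hcS => ?_⟩
    refine lt_of_not_ge fun hle => hcS ((hmem c').2 ⟨hc', fun y hy => ?_⟩)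
    exact (((hmem c).1 hc).2 y hy).trans hle
  · rintro ⟨heq, hlt⟩
    ext c
    refine ⟨fun hc => ⟨hS hc, fun c' hc' => ?_⟩, fun ⟨hc, hmax⟩ => ?_⟩
    · by_cases hcS : c' ∈ S
      · exact (heq c hc c' hcS).le
      · exact (hlt c hc c' hc' hcS).le
    · by_contra hcS
      obtain ⟨c₀, hc₀⟩ := hne
      exact (hlt c₀ hc₀ c hc hcS).not_ge (hmax c₀ (hS hc₀))

theorem nonempty_of_vorF_nonempty (hT : T.Nonempty) (h : (vorF (d := d) T S).Nonempty) :
    S.Nonempty := by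
  obtain ⟨x, hx⟩ := h
  obtain ⟨c, hc, hmax⟩ := T.exists_max_image (dist x) hT
  exact ⟨c, by rw [show S = _ from hx]; exact ⟨hc, hmax⟩⟩

theorem mem_frontier_ballPoly_iff {r : ℝ} (hr : 0 < r) {x : EuclideanSpace ℝ (Fin d)} :
    x ∈ frontier (ballPoly (d := d) T r) ↔
      (∀ c ∈ T, dist x c ≤ r) ∧ ∃ c ∈ T, dist x c = r := by
  have hcl : IsClosed (ballPoly (d := d) T r) := isClosed_biInter fun c _ => isClosed_closedBall
  have hint : interior (ballPoly (d := d) T r) = ⋂ c ∈ T, ball c r := by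
    rw [ballPoly, T.finite_toSet.interior_biInter]
    simp only [interior_closedBall _ hr.ne', Finset.mem_coe]
  rw [hcl.frontier_eq, hint]
  simp only [ballPoly, mem_sdiff, mem_iInter, mem_closedBall, mem_ball, Finset.mem_coe, not_forall,
    not_lt, exists_prop]
  exact ⟨fun ⟨h, c, hc, hcr⟩ => ⟨h, c, hc, (h c hc).antisymm hcr⟩,
    fun ⟨h, c, hc, hcr⟩ => ⟨h, c, hc, hcr.ge⟩⟩

/-- For large `r`, a face of the farthest-point Voronoi diagram meets the boundary of the ball
polyhedron exactly when it is unbounded. -/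
theorem eventually_vorF_inter_frontier_nonempty_iff (hS : S ⊆ T) (hne : S.Nonempty)
    (hV : (vorF (d := d) T S).Nonempty) :
    ∀ᶠ r in Filter.atTop, (vorF (d := d) T S ∩ frontier (ballPoly (d := d) T r)).Nonempty ↔
      ¬ recessionCone (equidistantSubspace S) (farthestConstraints T S) ⊆ {0} := by
  have hVP := vorF_eq_openPolyhedron hS hne
  by_cases hrec : recessionCone (equidistantSubspace S) (farthestConstraints T S) ⊆ {0}
  · obtain ⟨R, hR⟩ := isBounded_iff_forall_norm_le.1 (hVP ▸ isBounded_openPolyhedron hrec)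
    obtain ⟨R', hR'⟩ := isBounded_iff_forall_norm_le.1 T.finite_toSet.isBounded
    filter_upwards [Filter.eventually_gt_atTop (R + R'), Filter.eventually_gt_atTop 0] with r hr h0
    refine iff_of_false ?_ (not_not.2 hrec)
    rintro ⟨x, hx, hxr⟩
    obtain ⟨-, c, hc, hcr⟩ := (mem_frontier_ballPoly_iff h0).1 hxr
    linarith [dist_le_norm_add_norm x c, hR x hx, hR' c hc]
  · obtain ⟨u, hu, hu0⟩ := not_subset.1 hrec
    obtain ⟨x, hx⟩ := hV
    obtain ⟨c, hc⟩ := hne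
    filter_upwards [Filter.eventually_ge_atTop (dist x c), Filter.eventually_gt_atTop 0]
      with r hr h0
    refine iff_of_true ?_ hrec
    have hun : 0 < ‖u‖ := norm_pos_iff.2 hu0
    have hcont : ContinuousOn (fun s : ℝ => dist (x + s • u) c)
        (Icc 0 ((r + dist x c) / ‖u‖)) := by fun_prop
    have hs₁ : 0 ≤ (r + dist x c) / ‖u‖ := by positivity
    obtain ⟨s, hs, hsr⟩ := intermediate_value_Icc hs₁ hcont (show r ∈ _ by
      refine ⟨by simpa using hr, ?_⟩
      have h1 : dist (x + ((r + dist x c) / ‖u‖) • u) x = r + dist x c := by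
        rw [dist_eq_norm, add_sub_cancel_left, norm_smul, Real.norm_of_nonneg hs₁,
          div_mul_cancel₀ _ hun.ne']
      have h2 := dist_triangle_right (x + ((r + dist x c) / ‖u‖) • u) x c
      linarith)
    have hy : x + s • u ∈ vorF (d := d) T S := by
      rw [hVP] at hx ⊢
      exact add_smul_mem_openPolyhedron_of_mem_recessionCone hx hu hs.1
    refine ⟨_, hy, (mem_frontier_ballPoly_iff h0).2 ⟨fun c' hc' => ?_, c, hS hc, hsr⟩⟩
    rw [show S = _ from hy] at hc
    exact (hc.2 c' hc').trans hsr.le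

/-- If `T` affinely spans the space, no face of its farthest-point Voronoi diagram contains a
line. -/
theorem eq_zero_of_mem_direction_equidistantSubspace
    (hspan : setDim (convexHull ℝ (T : Set (EuclideanSpace ℝ (Fin d)))) = d) (hS : S ⊆ T)
    (hne : S.Nonempty) (hV : (vorF (d := d) T S).Nonempty) {u : EuclideanSpace ℝ (Fin d)}
    (hu : u ∈ (equidistantSubspace S).direction)
    (huJ : ∀ j ∈ farthestConstraints T S, ⟪j.1, u⟫ = 0) : u = 0 := by
  obtain ⟨c, hc⟩ := hne
  obtain ⟨x, hx⟩ := hV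
  rw [vorF_eq_openPolyhedron hS ⟨c, hc⟩] at hx
  rw [forall_mem_farthestConstraints hS] at huJ
  have horth : ∀ c' ∈ T, ⟪c' - c, u⟫ = 0 := fun c' hc' => by
    by_cases hcS : c' ∈ S
    · have hle : equidistantSubspace S ≤
          affineHyperplane (c' - c) ((‖c'‖ ^ 2 - ‖c‖ ^ 2) / 2) :=
        iInf₂_le_of_le c hc (iInf₂_le c' hcS)
      exact (mem_direction_affineHyperplane (hle hx.1)).1 (AffineSubspace.direction_le hle hu)
    · exact huJ c hc c' hc' hcS
  have htop : vectorSpan ℝ (T : Set (EuclideanSpace ℝ (Fin d))) = ⊤ := by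
    apply Submodule.eq_top_of_finrank_eq
    rw [← direction_affineSpan, ← affineSpan_convexHull]
    simpa [setDim] using hspan
  have hle : vectorSpan ℝ (T : Set (EuclideanSpace ℝ (Fin d))) ≤ LinearMap.ker (innerₛₗ ℝ u) := by
    rw [vectorSpan_eq_span_vsub_set_right ℝ (hS hc), Submodule.span_le]
    rintro _ ⟨c', hc', rfl⟩
    simpa [real_inner_comm] using horth c' hc'
  rw [htop] at hle
  exact inner_self_eq_zero.1 (hle (Submodule.mem_top (x := u)))

open Classical in
theorem sum_unbounded_vorF
    (hspan : setDim (convexHull ℝ (T : Set (EuclideanSpace ℝ (Fin d)))) = d) (hT : T.Nonempty)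
    {s : Finset (Set (EuclideanSpace ℝ (Fin d)))}
    (hs : ∀ S, S ∈ s ↔ S ⊆ T ∧ (vorF (d := d) T S).Nonempty) :
    ∑ S ∈ s with ¬ recessionCone (equidistantSubspace S) (farthestConstraints T S) ⊆ {0},
      (-1 : ℤ) ^ setDim (vorF (d := d) T S) = (-1) ^ d - 1 := by
  have hne : ∀ S ∈ s, S.Nonempty := fun S hS => nonempty_of_vorF_nonempty hT ((hs S).1 hS).2
  have hVP : ∀ S ∈ s, vorF (d := d) T S =
      openPolyhedron (equidistantSubspace S) (farthestConstraints T S) := fun S hS =>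
    vorF_eq_openPolyhedron ((hs S).1 hS).1 (hne S hS)
  have h := sum_unbounded_neg_one_pow_finrank s equidistantSubspace (farthestConstraints T)
    (fun x => ?_) (fun S hS u hu huJ => eq_zero_of_mem_direction_equidistantSubspace hspan
      ((hs S).1 hS).1 (hne S hS) ((hs S).1 hS).2 hu huJ)
  · rw [finrank_euclideanSpace_fin] at h
    rw [← h]
    refine Finset.sum_congr (Finset.filter_congr fun S hS => ?_) fun S hS => ?_
    · rw [← hVP S hS, and_iff_right ((hs S).1 hS).2]
    · have hS := (Finset.mem_filter.1 hS).1
      have hV := ((hs S).1 hS).2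
      rw [hVP S hS] at hV ⊢
      rw [setDim, direction_affineSpan_openPolyhedron hV]
  · let S₀ : Set (EuclideanSpace ℝ (Fin d)) :=
      {c | c ∈ (T : Set _) ∧ ∀ c' ∈ (T : Set _), dist x c' ≤ dist x c}
    have hx : x ∈ vorF (d := d) T S₀ := rfl
    have hS₀ : S₀ ∈ s := (hs S₀).2 ⟨fun c hc => hc.1, x, hx⟩
    refine ⟨S₀, ⟨hS₀, hVP S₀ hS₀ ▸ hx⟩, fun S hS => ?_⟩
    have hxS : x ∈ vorF (d := d) T S := by
      rw [hVP S hS.1]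
      exact hS.2
    exact hxS

end FarthestVoronoi

/-- the Euler–Poincaré formula for basic `r`-ball polyhedra with sufficiently
large generating radius. -/
theorem stmt9 {d n : ℕ} (hd : 2 ≤ d) (hn : d + 1 ≤ n)
    (C : Set (EuclideanSpace ℝ (Fin d))) (hfin : C.Finite) (hcard : C.ncard = n)
    (hdim : setDim (convexHull ℝ C) = d)
    (hvert : C = Set.extremePoints ℝ (convexHull ℝ C)) :
    ∃ r₀ > (0 : ℝ), ∀ r ≥ r₀, IsBasicBallPolyhedron C r →
      (1 + (-1 : ℤ) ^ (d + 1)) = ∑ i ∈ Finset.range d, (-1 : ℤ) ^ i * (fFace C r (i + 1) : ℤ) := by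
  classical
  lift C to Finset (EuclideanSpace ℝ (Fin d)) using hfin
  have hC : C.Nonempty := by
    rw [← Finset.card_pos, ← Set.ncard_coe_finset]
    omega
  have hsfin : {S : Set (EuclideanSpace ℝ (Fin d)) | S ⊆ C ∧ (vorF (d := d) C S).Nonempty}.Finite :=
    C.finite_toSet.finite_subsets.subset fun S hS => hS.1
  obtain ⟨s, hs⟩ : ∃ s : Finset (Set (EuclideanSpace ℝ (Fin d))),
      ∀ S, S ∈ s ↔ S ⊆ C ∧ (vorF (d := d) C S).Nonempty :=
    ⟨hsfin.toFinset, fun S => by simp⟩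
  have hne : ∀ S ∈ s, S.Nonempty := fun S hS => nonempty_of_vorF_nonempty hC ((hs S).1 hS).2
  have hev : ∀ᶠ r in Filter.atTop, ∀ S ∈ s,
      (vorF (d := d) C S ∩ frontier (ballPoly (d := d) C r)).Nonempty ↔
        ¬ recessionCone (equidistantSubspace S) (farthestConstraints C S) ⊆ {0} :=
    (Finset.eventually_all s).2 fun S hS =>
      eventually_vorF_inter_frontier_nonempty_iff ((hs S).1 hS).1 (hne S hS) ((hs S).1 hS).2
  obtain ⟨r₀, hr₀⟩ := Filter.eventually_atTop.1 hev
  refine ⟨max r₀ 1, lt_max_of_lt_right one_pos, fun r hr _ => ?_⟩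
  have hiff := hr₀ r ((le_max_left _ _).trans hr)
  set U := s.filter fun S =>
    ¬ recessionCone (equidistantSubspace S) (farthestConstraints C S) ⊆ {0} with hU
  have hface : ∀ k, fFace (d := d) C r k = (U.filter fun S => setDim (vorF (d := d) C S) = k).card := by
    intro k
    rw [fFace, ← Set.ncard_coe_finset]
    congr 1
    ext S
    simp only [mem_ofPred_eq, Finset.coe_filter, hU, Finset.mem_filter]
    constructor
    · rintro ⟨hS, hx, hk⟩
      have hSs := (hs S).2 ⟨hS, hx.mono inter_subset_left⟩
      exact ⟨⟨hSs, (hiff S hSs).1 hx⟩, hk⟩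
    · rintro ⟨⟨hSs, hrec⟩, hk⟩
      exact ⟨((hs S).1 hSs).1, (hiff S hSs).2 hrec, hk⟩
  have hpos : ∀ S ∈ U, setDim (vorF (d := d) C S) ≠ 0 := by
    intro S hS h0
    obtain ⟨hSs, hrec⟩ := Finset.mem_filter.1 hS
    have hV := ((hs S).1 hSs).2
    rw [vorF_eq_openPolyhedron ((hs S).1 hSs).1 (hne S hSs)] at h0 hV
    rw [setDim, direction_affineSpan_openPolyhedron hV, Submodule.finrank_eq_zero] at h0
    exact hrec fun u hu => by simpa [h0] using hu.1
  have hle : ∀ S ∈ U, setDim (vorF (d := d) C S) ∈ Finset.range (d + 1) := fun S _ =>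
    Finset.mem_range_succ_iff.2
      ((Submodule.finrank_le _).trans_eq finrank_euclideanSpace_fin)
  have hsum := sum_unbounded_vorF hdim hC hs
  rw [← Finset.sum_fiberwise_of_maps_to hle, Finset.sum_range_succ',
    Finset.sum_eq_zero (s := U.filter fun S => setDim (vorF (d := d) C S) = 0)
      fun S hS => absurd (Finset.mem_filter.1 hS).2 (hpos S (Finset.mem_filter.1 hS).1),
    add_zero] at hsum
  have hfib : ∀ i ∈ Finset.range d,
      ∑ S ∈ U with setDim (vorF (d := d) C S) = i + 1, (-1 : ℤ) ^ setDim (vorF (d := d) C S) =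
        -((-1) ^ i * (fFace (d := d) C r (i + 1) : ℤ)) := fun i _ => by
    rw [Finset.sum_congr rfl fun S hS => by rw [(Finset.mem_filter.1 hS).2], Finset.sum_const,
      hface, pow_succ, nsmul_eq_mul]
    ring
  rw [Finset.sum_congr rfl hfib, Finset.sum_neg_distrib] at hsum
  rw [pow_succ]
  linarith
end

section
/- Let d ≥ 2 and let Q, Q' ⊆ E^d be d-dimensional convex polytopes (convex hulls of finite sets, with nonempty interior). Let F(Q) denote the set of nonempty exposed faces of Q (including Q itself), partially ordered by inclusion, and likewise F(Q'). Suppose φ : F(Q) → F(Q') is an order isomorphism satisfying dim φ(F) = dim F for all F ∈ F(Q), such that diam(φ(E)) = diam(E) for every 1-dimensional face (edge) E of Q, and such that for every face F of Q and every face F' of Q' with dimension k satisfying 2 ≤ k ≤ d, the extreme points of that face lie on a common sphere (there exist a center z and a radius ρ ≥ 0 with every extreme point of the face at distance ρ from z). Then there exists an isometry g of E^d with g(Q) = Q'. -/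
open Metric Set
open scoped RealInnerProductSpace

/-- The collection of nonempty exposed faces of `Q` (`Q` itself is among them). -/
def exposedFaces {d : ℕ} (Q : Set (EuclideanSpace ℝ (Fin d))) :
    Set (Set (EuclideanSpace ℝ (Fin d))) :=
  {F | F.Nonempty ∧ IsExposed ℝ Q F}

/-- The convex cone spanned by the vectors `a i` with `i ∈ S`. -/
def finCone {ι A : Type*} [Fintype ι] [AddCommGroup A] [Module ℝ A] (a : ι → A) (S : Set ι) :
    Set A :=
  {x | ∃ l : ι → ℝ, (∀ i, 0 ≤ l i) ∧ (∀ i ∉ S, l i = 0) ∧ ∑ i, l i • a i = x}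

section Cones

variable {ι A B : Type*} [Fintype ι] [NormedAddCommGroup A] [InnerProductSpace ℝ A]
  [NormedAddCommGroup B] [InnerProductSpace ℝ B]

theorem eq_zero_of_sum_mul_nonpos {l g : ι → ℝ} (hl : ∀ i, 0 ≤ l i) (hg : ∀ i, 0 ≤ g i)
    (h : ∑ i, l i * g i ≤ 0) {i : ι} (hi : g i ≠ 0) : l i = 0 := by
  have h0 : ∑ i, l i * g i = 0 :=
    le_antisymm h (Finset.sum_nonneg fun i _ => mul_nonneg (hl i) (hg i))
  have := (Finset.sum_eq_zero_iff_of_nonneg fun i _ => mul_nonneg (hl i) (hg i)).1 h0 i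
    (Finset.mem_univ i)
  exact (mul_eq_zero.1 this).resolve_right hi

theorem inner_sum_smul_right (n : A) (l : ι → ℝ) (a : ι → A) :
    ⟪n, ∑ i, l i • a i⟫ = ∑ i, l i * ⟪n, a i⟫ := by
  simp [inner_sum, inner_smul_right]

theorem isClosed_finCone (a : ι → A) (S : Set ι) (w : A) (hw : ∀ i ∈ S, 0 < ⟪w, a i⟫) :
    IsClosed (finCone a S) := by
  obtain ⟨c, hc, hcS⟩ : ∃ c > 0, ∀ i ∈ S, c ≤ ⟪w, a i⟫ := by
    by_cases hS : S.Nonempty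
    · obtain ⟨i0, hi0, hmin⟩ := (Set.toFinite S).exists_minimalFor (fun i => ⟪w, a i⟫) S hS
      refine ⟨_, hw i0 hi0, fun i hi => ?_⟩
      rcases le_total ⟪w, a i0⟫ ⟪w, a i⟫ with h | h
      · exact h
      · exact hmin hi h
    · exact ⟨1, one_pos, fun i hi => (hS ⟨i, hi⟩).elim⟩
  refine IsSeqClosed.isClosed fun x p hx hp => ?_
  choose l hl hlS hlx using hx
  obtain ⟨M, hM⟩ := (Metric.isBounded_range_of_tendsto x hp).exists_norm_le
  have hb : ∀ n, l n ∈ Set.Icc (0 : ι → ℝ) (fun _ => ‖w‖ * M / c) := by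
    intro n
    refine ⟨fun i => hl n i, fun i => ?_⟩
    by_cases hi : i ∈ S
    · rw [le_div_iff₀ hc]
      calc l n i * c ≤ l n i * ⟪w, a i⟫ := by gcongr; exacts [hl n i, hcS i hi]
        _ ≤ ∑ j, l n j * ⟪w, a j⟫ := by
          refine Finset.single_le_sum (f := fun j => l n j * ⟪w, a j⟫) (fun j _ => ?_)
            (Finset.mem_univ i)
          by_cases hj : j ∈ S
          · exact mul_nonneg (hl n j) (hw j hj).le
          · simp [hlS n j hj]
        _ = ⟪w, x n⟫ := by rw [← hlx n, inner_sum_smul_right]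
        _ ≤ ‖w‖ * ‖x n‖ := real_inner_le_norm _ _
        _ ≤ ‖w‖ * M := by gcongr; exact hM _ ⟨n, rfl⟩
    · have : 0 ≤ M := (norm_nonneg _).trans (hM _ ⟨n, rfl⟩)
      simp only [hlS n i hi]
      positivity
  obtain ⟨l', hl', φ, hφ, hlim⟩ := isCompact_Icc.tendsto_subseq hb
  have hcoord := tendsto_pi_nhds.1 hlim
  refine ⟨l', fun i => hl'.1 i, fun i hi => ?_, ?_⟩
  · refine tendsto_nhds_unique (hcoord i) ?_
    simp [hlS _ i hi]
  · refine tendsto_nhds_unique ?_ (hp.comp hφ.tendsto_atTop)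
    have : x ∘ φ = fun n => ∑ i, l (φ n) i • a i := by
      ext n; simp [hlx]
    rw [this]
    exact tendsto_finsetSum _ fun i _ => (hcoord i).smul_const _

theorem norm_sum_smul_sub_eq {a : ι → A} {b : ι → B} {S : Set ι}
    (hgram : ∀ i ∈ S, ∀ k ∈ S, ⟪a i, a k⟫ = ⟪b i, b k⟫) {l m : ι → ℝ}
    (hl : ∀ i ∉ S, l i = 0) (hm : ∀ i ∉ S, m i = 0) :
    ‖∑ i, l i • b i - ∑ i, m i • b i‖ = ‖∑ i, l i • a i - ∑ i, m i • a i‖ := by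
  rw [← sq_eq_sq₀ (norm_nonneg _) (norm_nonneg _), ← Finset.sum_sub_distrib,
    ← Finset.sum_sub_distrib]
  simp only [← sub_smul, ← real_inner_self_eq_norm_sq, sum_inner, inner_sum, inner_smul_left,
    inner_smul_right]
  refine Finset.sum_congr rfl fun i _ => ?_
  by_cases hi : i ∈ S
  · congr 1
    refine Finset.sum_congr rfl fun k _ => ?_
    by_cases hk : k ∈ S
    · rw [hgram k hk i hi]
    · simp [hl k hk, hm k hk]
  · simp [hl i hi, hm i hi]

/-- A map that is isometric on each cone of a finite family of closed cones does not increase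
the length of paths running inside the union of the family. -/
theorem norm_sub_le_of_path_mem_finCone {a : ι → A} {b : ι → B} (J : Set (Set ι))
    (hclosed : ∀ S ∈ J, IsClosed (finCone a S))
    (hgram : ∀ S ∈ J, ∀ i ∈ S, ∀ k ∈ S, ⟪a i, a k⟫ = ⟪b i, b k⟫)
    (huniq : ∀ S ∈ J, ∀ T ∈ J, ∀ l m : ι → ℝ, (∀ i, 0 ≤ l i) → (∀ i ∉ S, l i = 0) →
      (∀ i, 0 ≤ m i) → (∀ i ∉ T, m i = 0) → ∑ i, l i • a i = ∑ i, m i • a i →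
      ∀ i ∉ S, m i = 0)
    (x : ℝ → A) (L : ℝ) (hx : ∀ s ∈ Icc (0 : ℝ) 1, ∀ t ∈ Icc (0 : ℝ) 1,
      ‖x s - x t‖ ≤ L * |s - t|)
    (hcov : ∀ t ∈ Icc (0 : ℝ) 1, ∃ S ∈ J, x t ∈ finCone a S)
    {S₀ S₁ : Set ι} (hS₀ : S₀ ∈ J) (hS₁ : S₁ ∈ J) {l₀ l₁ : ι → ℝ}
    (h₀ : ∀ i, 0 ≤ l₀ i) (h₀S : ∀ i ∉ S₀, l₀ i = 0) (hx₀ : ∑ i, l₀ i • a i = x 0)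
    (h₁ : ∀ i, 0 ≤ l₁ i) (h₁S : ∀ i ∉ S₁, l₁ i = 0) (hx₁ : ∑ i, l₁ i • a i = x 1) :
    ‖∑ i, l₁ i • b i - ∑ i, l₀ i • b i‖ ≤ L := by
  have hch : ∀ t : ℝ, ∃ S : Set ι, ∃ l : ι → ℝ, t ∈ Icc (0 : ℝ) 1 →
      S ∈ J ∧ (∀ i, 0 ≤ l i) ∧ (∀ i ∉ S, l i = 0) ∧ ∑ i, l i • a i = x t := by
    intro t
    by_cases ht : t ∈ Icc (0 : ℝ) 1
    · obtain ⟨S, hS, l, hl⟩ := hcov t ht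
      exact ⟨S, l, fun _ => ⟨hS, hl⟩⟩
    · exact ⟨∅, 0, fun h => (ht h).elim⟩
  choose S l hSl using hch
  set y : ℝ → B := fun t => ∑ i, l t i • b i with hy
  have hsupp : ∀ t ∈ Icc (0 : ℝ) 1, ∀ T ∈ J, x t ∈ finCone a T → ∀ i ∉ T, l t i = 0 := by
    rintro t ht T hT ⟨m, hm, hmT, hmx⟩
    obtain ⟨h1, h2, h3, h4⟩ := hSl t ht
    exact huniq T hT (S t) h1 m (l t) hm hmT h2 h3 (hmx.trans h4.symm)
  have hpair : ∀ s ∈ Icc (0 : ℝ) 1, ∀ t ∈ Icc (0 : ℝ) 1, ∀ T ∈ J, x s ∈ finCone a T →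
      x t ∈ finCone a T → ‖y s - y t‖ ≤ L * |s - t| := by
    intro s hs t ht T hT hsT htT
    have := norm_sum_smul_sub_eq (hgram T hT) (hsupp s hs T hT hsT) (hsupp t ht T hT htT)
    rw [(hSl s hs).2.2.2, (hSl t ht).2.2.2] at this
    exact this.le.trans (hx s hs t ht)
  have hxc : ContinuousOn x (Icc 0 1) := by
    have : LipschitzOnWith (Real.toNNReal L) x (Icc 0 1) :=
      LipschitzOnWith.of_dist_le_mul fun s hs t ht => by
        rw [dist_eq_norm, Real.dist_eq]
        exact (hx s hs t ht).trans (by gcongr; exact Real.le_coe_toNNReal L)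
    exact this.continuousOn
  have hloc : ∀ t ∈ Icc (0 : ℝ) 1, ∀ᶠ s in nhdsWithin t (Icc 0 1), ‖y s - y t‖ ≤ L * |s - t| := by
    intro t ht
    have hfin : ∀ᶠ s in nhdsWithin t (Icc (0 : ℝ) 1), ∀ T ∈ J, x t ∉ finCone a T →
        x s ∉ finCone a T := by
      rw [Filter.eventually_all_finite (Set.toFinite J)]
      intro T hT
      by_cases h : x t ∈ finCone a T
      · exact Filter.Eventually.of_forall fun s h' => (h' h).elim
      · filter_upwards [(hxc t ht) ((hclosed T hT).isOpen_compl.mem_nhds h)] with s hs _ using hs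
    filter_upwards [hfin, self_mem_nhdsWithin] with s hs hsI
    obtain ⟨h1, h2, h3, h4⟩ := hSl s hsI
    have hsT : x s ∈ finCone a (S s) := ⟨l s, h2, h3, h4⟩
    exact hpair s hsI t ht (S s) h1 hsT (by by_contra h; exact hs _ h1 h hsT)
  have hyc : ContinuousOn y (Icc 0 1) := by
    intro t ht
    refine tendsto_iff_norm_sub_tendsto_zero.2 ?_
    refine squeeze_zero' (Filter.Eventually.of_forall fun _ => norm_nonneg _) (hloc t ht) ?_
    have : Continuous fun s : ℝ => L * |s - t| := by fun_prop
    have h := this.tendsto t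
    simp only [sub_self, abs_zero, mul_zero] at h
    exact h.mono_left nhdsWithin_le_nhds
  have hmain : Icc (0 : ℝ) 1 ⊆ {t | ‖y t - y 0‖ ≤ L * t} := by
    refine IsClosed.Icc_subset_of_forall_mem_nhdsWithin ?_ (by simp) ?_
    · have : ContinuousOn (fun t => ‖y t - y 0‖ - L * t) (Icc 0 1) := by fun_prop
      have h := this.preimage_isClosed_of_isClosed isClosed_Icc (isClosed_Iic (a := (0 : ℝ)))
      convert h using 1
      ext t
      simp [and_comm]
    · rintro t ⟨ht, htI⟩
      have h1 := hloc t ⟨htI.1, htI.2.le⟩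
      have h2 : nhdsWithin t (Ioi t) ≤ nhdsWithin t (Icc 0 1) := by
        rw [← nhdsWithin_Ioc_eq_nhdsGT htI.2]
        exact nhdsWithin_mono _ fun s hs => ⟨htI.1.trans hs.1.le, hs.2⟩
      filter_upwards [h2 h1, self_mem_nhdsWithin] with s hs hts
      have hts : t < s := hts
      rw [abs_of_pos (sub_pos.2 hts)] at hs
      have h3 := norm_add_le (y s - y t) (y t - y 0)
      rw [sub_add_sub_cancel] at h3
      have ht : ‖y t - y 0‖ ≤ L * t := ht
      show ‖y s - y 0‖ ≤ L * s
      linarith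
  have hend : ∀ t ∈ Icc (0 : ℝ) 1, ∀ T ∈ J, ∀ m : ι → ℝ, (∀ i, 0 ≤ m i) → (∀ i ∉ T, m i = 0) →
      ∑ i, m i • a i = x t → ∑ i, m i • b i = y t := by
    intro t ht T hT m hm hmT hmx
    have := norm_sum_smul_sub_eq (hgram T hT) hmT (hsupp t ht T hT ⟨m, hm, hmT, hmx⟩)
    rw [hmx, (hSl t ht).2.2.2, sub_self, norm_zero, norm_eq_zero, sub_eq_zero] at this
    exact this
  rw [hend 0 (by simp) S₀ hS₀ l₀ h₀ h₀S hx₀, hend 1 (by simp) S₁ hS₁ l₁ h₁ h₁S hx₁]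
  simpa using hmain (show (1 : ℝ) ∈ Icc (0 : ℝ) 1 by simp)

end Cones

section Hull

variable {ι A B : Type*} [Fintype ι] [NormedAddCommGroup A] [InnerProductSpace ℝ A]
  [NormedAddCommGroup B] [InnerProductSpace ℝ B]

theorem exists_weights_of_mem_convexHull_range {a : ι → A} {x : A}
    (hx : x ∈ convexHull ℝ (range a)) :
    ∃ l : ι → ℝ, (∀ i, 0 ≤ l i) ∧ ∑ i, l i = 1 ∧ ∑ i, l i • a i = x := by
  classical
  have : convexHull ℝ (range a) ⊆ (fun l : ι → ℝ => ∑ i, l i • a i) '' stdSimplex ℝ ι := by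
    refine convexHull_min ?_ ?_
    · rintro _ ⟨i, rfl⟩
      exact ⟨Pi.single i 1, single_mem_stdSimplex ℝ i, by simp [Pi.single_apply]⟩
    · exact (convex_stdSimplex ℝ ι).is_linear_image
        ⟨fun x y => by simp [add_smul, Finset.sum_add_distrib],
          fun c x => by simp [mul_smul, Finset.smul_sum]⟩
  obtain ⟨l, ⟨h1, h2⟩, h3⟩ := this hx
  exact ⟨l, h1, h2, h3⟩

theorem exists_weights_of_isMax {a : ι → A} {x n : A} (hx : x ∈ convexHull ℝ (range a))
    (hn : ∀ i, ⟪n, a i⟫ ≤ ⟪n, x⟫) :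
    ∃ l : ι → ℝ, (∀ i, 0 ≤ l i) ∧ ∑ i, l i = 1 ∧ ∑ i, l i • a i = x ∧
      ∀ i, ⟪n, a i⟫ ≠ ⟪n, x⟫ → l i = 0 := by
  obtain ⟨l, h0, h1, h2⟩ := exists_weights_of_mem_convexHull_range hx
  refine ⟨l, h0, h1, h2, fun i hi => ?_⟩
  refine eq_zero_of_sum_mul_nonpos (g := fun i => ⟪n, x⟫ - ⟪n, a i⟫) h0
    (fun i => sub_nonneg.2 (hn i)) (le_of_eq ?_) (sub_ne_zero.2 (Ne.symm hi))
  have := inner_sum_smul_right n l a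
  rw [h2] at this
  simp only [mul_sub, Finset.sum_sub_distrib, ← Finset.sum_mul, h1, one_mul, ← this, sub_self]

theorem exists_forall_abs_sub_lt_of_smul_mem_interior {K : Set A} {y : A} {t : ℝ}
    (ht : t • y ∈ interior K) (P : ℝ → Prop) (hP : ∀ s, 0 ≤ s → s • y ∈ K → P s) :
    ∃ δ > 0, ∀ s, 0 ≤ s → |s - t| < δ → P s := by
  have hc : Continuous fun s : ℝ => s • y := by fun_prop
  obtain ⟨δ, hδ, h⟩ := Metric.isOpen_iff.1 (isOpen_interior.preimage hc) t ht
  exact ⟨δ, hδ, fun s hs hst => hP s hs (interior_subset (h (by simpa [Real.dist_eq] using hst)))⟩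

variable [FiniteDimensional ℝ A]

theorem exists_support_of_notMem_interior {K : Set A} (hK : Convex ℝ K)
    (hint : (interior K).Nonempty) {x : A} (hx : x ∉ interior K) :
    ∃ n : A, n ≠ 0 ∧ (∀ y ∈ K, ⟪n, y⟫ ≤ ⟪n, x⟫) ∧ ∀ y ∈ interior K, ⟪n, y⟫ < ⟪n, x⟫ := by
  have : CompleteSpace A := FiniteDimensional.complete ℝ A
  obtain ⟨f, hf⟩ := geometric_hahn_banach_open_point hK.interior isOpen_interior hx
  have hfn : ∀ y, ⟪(InnerProductSpace.toDual ℝ A).symm f, y⟫ = f y := fun y =>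
    InnerProductSpace.toDual_symm_apply
  refine ⟨(InnerProductSpace.toDual ℝ A).symm f, ?_, ?_, ?_⟩
  · rintro h0
    obtain ⟨y, hy⟩ := hint
    have := hf y hy
    rw [← hfn, ← hfn, h0] at this
    simp at this
  · intro y hy
    rw [hfn, hfn]
    have hy' : y ∈ closure (interior K) := by
      rw [hK.closure_interior_eq_closure_of_nonempty_interior hint]
      exact subset_closure hy
    have hcl : IsClosed {z | f z ≤ f x} := isClosed_le f.continuous continuous_const
    exact closure_minimal (fun z hz => (hf z hz).le) hcl hy'
  · intro y hy
    rw [hfn, hfn]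
    exact hf y hy

/-- A ray through an interior point of a compact convex set leaves the set through a point at
which some supporting functional is positive. -/
theorem exists_exit_point {K : Set A} (hK : Convex ℝ K) (hKc : IsCompact K) {y : A}
    (hy : y ∈ interior K) (hy0 : y ≠ 0) :
    ∃ t : ℝ, 1 < t ∧ t • y ∈ K ∧
      ∃ n, n ≠ 0 ∧ (∀ z ∈ K, ⟪n, z⟫ ≤ ⟪n, t • y⟫) ∧ 0 < ⟪n, t • y⟫ := by
  have hc : Continuous fun s : ℝ => s • y := by fun_prop
  have hT : IsCompact {s : ℝ | s • y ∈ K} := by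
    refine Metric.isCompact_of_isClosed_isBounded (hKc.isClosed.preimage hc) ?_
    obtain ⟨M, hM⟩ := hKc.isBounded.exists_norm_le
    refine isBounded_iff_forall_norm_le.2 ⟨M / ‖y‖, fun s hs => ?_⟩
    rw [le_div_iff₀ (norm_pos_iff.2 hy0), ← norm_smul]
    exact hM _ hs
  have h1 : (1 : ℝ) ∈ {s : ℝ | s • y ∈ K} := by simpa using interior_subset hy
  obtain ⟨t, htK, htmax⟩ := hT.exists_isGreatest ⟨1, h1⟩
  have ht1 : 1 ≤ t := htmax h1
  have hnot : t • y ∉ interior K := by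
    intro h
    obtain ⟨δ, hδ, hs⟩ := exists_forall_abs_sub_lt_of_smul_mem_interior h (fun s => s ≤ t)
      fun s _ hs => htmax hs
    have := hs (t + δ / 2) (by linarith) (by rw [abs_lt]; constructor <;> linarith)
    linarith
  have ht1' : 1 < t := lt_of_le_of_ne ht1 fun h => hnot (by rwa [← h, one_smul])
  obtain ⟨n, hn0, hn, hni⟩ := exists_support_of_notMem_interior hK ⟨y, hy⟩ hnot
  refine ⟨t, ht1', htK, n, hn0, hn, ?_⟩
  have := hni y hy
  rw [inner_smul_right] at this ⊢
  have : 0 < ⟪n, y⟫ := by nlinarith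
  positivity

/-- A ray from a point outside the interior of a compact convex set enters the set before it
reaches an interior point. -/
theorem exists_entry_point {K : Set A} (hK : Convex ℝ K) (hKc : IsCompact K) {y : A}
    (hy : y ∈ interior K) (h0 : (0 : A) ∉ interior K) :
    ∃ t : ℝ, 0 ≤ t ∧ t < 1 ∧ t • y ∈ K ∧ ∃ n, n ≠ 0 ∧ ∀ z ∈ K, ⟪n, z⟫ ≤ ⟪n, t • y⟫ := by
  have hc : Continuous fun s : ℝ => s • y := by fun_prop
  have hT : IsCompact {s : ℝ | s ∈ Icc (0 : ℝ) 1 ∧ s • y ∈ K} :=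
    isCompact_Icc.inter_right (hKc.isClosed.preimage hc)
  have h1 : (1 : ℝ) ∈ {s : ℝ | s ∈ Icc (0 : ℝ) 1 ∧ s • y ∈ K} := by
    simpa using interior_subset hy
  obtain ⟨t, ⟨htI, htK⟩, htmin⟩ := hT.exists_isLeast ⟨1, h1⟩
  have hnot : t • y ∉ interior K := by
    intro h
    rcases htI.1.eq_or_lt with h' | h'
    · exact h0 (by simpa [← h'] using h)
    obtain ⟨δ, hδ, hs⟩ := exists_forall_abs_sub_lt_of_smul_mem_interior h (fun s => s ≤ 1 → t ≤ s)
      fun s hs0 hs hs1 => htmin ⟨⟨hs0, hs1⟩, hs⟩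
    have hm : max 0 (t - δ / 2) < t := max_lt h' (by linarith)
    have := hs (max 0 (t - δ / 2)) (le_max_left _ _)
      (by rw [abs_lt]; constructor <;> linarith [le_max_right 0 (t - δ / 2)])
      (hm.le.trans htI.2)
    linarith
  have ht1 : t < 1 := lt_of_le_of_ne htI.2 fun h => hnot (by rwa [h, one_smul])
  obtain ⟨n, hn0, hn, -⟩ := exists_support_of_notMem_interior hK ⟨y, hy⟩ hnot
  exact ⟨t, htI.1, ht1, htK, n, hn0, hn⟩

/-- If the Gram matrices of two vector systems agree on every face of the first system that
is turned away from the origin, then distances in the second system are not larger. -/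
theorem norm_sub_le_of_gram_eq {a : ι → A} {b : ι → B} {R : ℝ} (hR : 0 < R)
    (hsph : ∀ i, ‖a i‖ = R) (hint : (interior (convexHull ℝ (range a))).Nonempty)
    (hgram : ∀ n : A, ∀ i k, 0 < ⟪n, a i⟫ → (∀ l, ⟪n, a l⟫ ≤ ⟪n, a i⟫) →
      ⟪n, a k⟫ = ⟪n, a i⟫ → ⟪a i, a k⟫ = ⟪b i, b k⟫) (i k : ι) :
    ‖b k - b i‖ ≤ ‖a k - a i‖ := by
  classical
  set J : Set (Set ι) := {S | ∃ n : A, ∃ β : ℝ, 0 < β ∧ (∀ i, ⟪n, a i⟫ ≤ β) ∧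
    S = {i | ⟪n, a i⟫ = β}} with hJ
  set K := convexHull ℝ (range a) with hKdef
  have hK : Convex ℝ K := convex_convexHull ℝ _
  have hKc : IsCompact K := (finite_range a).isCompact_convexHull (𝕜 := ℝ)
  have haK : ∀ i, a i ∈ K := fun i => subset_convexHull ℝ _ (mem_range_self i)
  have hclosed : ∀ S ∈ J, IsClosed (finCone a S) := by
    rintro S ⟨n, β, hβ, hn, rfl⟩
    refine isClosed_finCone a _ n fun i hi => ?_
    rw [mem_ofPred_eq] at hi
    rwa [hi]
  have hvert : ∀ i, ∃ S ∈ J, i ∈ S := by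
    intro i
    refine ⟨_, ⟨a i, R ^ 2, by positivity, fun k => ?_, rfl⟩, ?_⟩
    · refine (real_inner_le_norm _ _).trans ?_
      rw [hsph, hsph, sq]
    · rw [mem_ofPred_eq, real_inner_self_eq_norm_sq, hsph]
  have hAcl : IsClosed (⋃ S ∈ J, finCone a S) := (Set.toFinite J).isClosed_biUnion hclosed
  obtain ⟨y₀, hy₀⟩ := hint
  have hKcov : ∀ x ∈ K, x ∈ ⋃ S ∈ J, finCone a S := by
    intro x hx
    have hopen : ∀ ε ∈ Ioi (0 : ℝ), x + ε • y₀ ∈ ⋃ S ∈ J, finCone a S := by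
      intro ε hε
      have hε : 0 < ε := hε
      have hw : (1 + ε)⁻¹ • (x + ε • y₀) ∈ interior K := by
        have := hK.combo_self_interior_mem_interior hx hy₀ (a := (1 + ε)⁻¹) (b := (1 + ε)⁻¹ * ε)
          (by positivity) (by positivity) (by field_simp)
        rwa [smul_add, smul_smul]
      by_cases hz : (1 + ε)⁻¹ • (x + ε • y₀) = 0
      · have hz' : x + ε • y₀ = 0 := (smul_eq_zero.1 hz).resolve_left (by positivity)
        obtain ⟨S, hS, -⟩ := hvert i
        refine mem_biUnion hS ⟨0, by simp, by simp, by simp [hz']⟩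
      · obtain ⟨t, ht, htK, n, -, hn, hpos⟩ := exists_exit_point hK hKc hw hz
        obtain ⟨l, hl0, hl1, hlx, hls⟩ := exists_weights_of_isMax htK fun i => hn _ (haK i)
        refine mem_biUnion (x := {i | ⟪n, a i⟫ = ⟪n, t • ((1 + ε)⁻¹ • (x + ε • y₀))⟫})
          ⟨n, _, hpos, fun i => hn _ (haK i), rfl⟩
          ⟨fun i => ((1 + ε) / t) * l i, fun i => ?_, fun i hi => ?_, ?_⟩
        · have := hl0 i
          positivity
        · simp only [hls i hi, mul_zero]
        · simp only [mul_smul, ← Finset.smul_sum]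
          rw [hlx, smul_smul, smul_smul]
          have : (1 + ε) / t * t * (1 + ε)⁻¹ = 1 := by
            have : t ≠ 0 := by linarith
            field_simp
          rw [this, one_smul]
    have hlim : Filter.Tendsto (fun ε : ℝ => x + ε • y₀) (nhdsWithin 0 (Ioi 0)) (nhds x) := by
      have : Continuous fun ε : ℝ => x + ε • y₀ := by fun_prop
      have h := this.tendsto 0
      rw [zero_smul, add_zero] at h
      exact h.mono_left nhdsWithin_le_nhds
    exact hAcl.mem_of_tendsto hlim (Filter.eventually_of_mem self_mem_nhdsWithin hopen)
  obtain ⟨S₀, hS₀, hi⟩ := hvert i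
  obtain ⟨S₁, hS₁, hk⟩ := hvert k
  have := norm_sub_le_of_path_mem_finCone (a := a) (b := b) J hclosed ?_ ?_
    (fun t => a i + t • (a k - a i)) ‖a k - a i‖ ?_ ?_ hS₀ hS₁
    (l₀ := Pi.single i 1) (l₁ := Pi.single k 1) ?_ ?_ ?_ ?_ ?_ ?_
  · simpa [Pi.single_apply] using this
  · rintro S ⟨n, β, hβ, hn, rfl⟩ i hi k hk
    rw [mem_ofPred_eq] at hi hk
    exact hgram n i k (by rwa [hi]) (by rwa [hi]) (by rw [hi, hk])
  · rintro S ⟨n, β, hβ, hn, rfl⟩ T ⟨n', β', hβ', hn', rfl⟩ l m hl hlS hm hmT hlm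
    have key : ∀ (n : A) (β : ℝ) (l : ι → ℝ), (∀ i ∉ {i | ⟪n, a i⟫ = β}, l i = 0) →
        ⟪n, ∑ i, l i • a i⟫ = β * ∑ i, l i := by
      intro n β l h
      rw [inner_sum_smul_right, Finset.mul_sum]
      refine Finset.sum_congr rfl fun i _ => ?_
      by_cases hi : ⟪n, a i⟫ = β
      · rw [hi, mul_comm]
      · simp [h i hi]
    have key2 : ∀ (n : A) (β : ℝ) (l : ι → ℝ), (∀ i, ⟪n, a i⟫ ≤ β) → (∀ i, 0 ≤ l i) →
        ⟪n, ∑ i, l i • a i⟫ ≤ β * ∑ i, l i := by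
      intro n β l h hl
      rw [inner_sum_smul_right, Finset.mul_sum]
      refine Finset.sum_le_sum fun i _ => ?_
      rw [mul_comm]
      exact mul_le_mul_of_nonneg_right (h i) (hl i)
    have e1 := key n β l hlS
    have e2 := key2 n β m hn hm
    have e3 := key n' β' m hmT
    have e4 := key2 n' β' l hn' hl
    rw [hlm] at e1 e4
    rw [e1] at e2
    rw [e3] at e4
    have h1 : ∑ i, l i ≤ ∑ i, m i := le_of_mul_le_mul_left e2 hβ
    have h2 : ∑ i, m i ≤ ∑ i, l i := le_of_mul_le_mul_left e4 hβ'
    intro i hi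
    refine eq_zero_of_sum_mul_nonpos (g := fun i => β - ⟪n, a i⟫) hm
      (fun i => sub_nonneg.2 (hn i)) (le_of_eq ?_) (sub_ne_zero.2 (Ne.symm hi))
    simp only [mul_sub, Finset.sum_sub_distrib, ← Finset.sum_mul, ← inner_sum_smul_right]
    rw [e1, le_antisymm h1 h2]
    ring
  · intro s _ t _
    rw [add_sub_add_left_eq_sub, ← sub_smul, norm_smul, Real.norm_eq_abs, mul_comm]
  · intro t ht
    have : a i + t • (a k - a i) ∈ K := hK.add_smul_sub_mem (haK i) (haK k) ht
    simpa using hKcov _ this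
  · intro j; by_cases h : j = i <;> simp [h]
  · intro j hj
    rw [Pi.single_apply, if_neg]
    rintro rfl
    exact hj hi
  · simp [Pi.single_apply]
  · intro j; by_cases h : j = k <;> simp [h]
  · intro j hj
    rw [Pi.single_apply, if_neg]
    rintro rfl
    exact hj hk
  · simp [Pi.single_apply]

end Hull

section ConeDuality

variable {ι A B : Type*} [Fintype ι] [NormedAddCommGroup A] [InnerProductSpace ℝ A]
  [NormedAddCommGroup B] [InnerProductSpace ℝ B]

theorem sum_smul_mem_finCone_univ (a : ι → A) {l : ι → ℝ} (hl : ∀ i, 0 ≤ l i) :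
    ∑ i, l i • a i ∈ finCone a univ :=
  ⟨l, hl, by simp, rfl⟩

theorem add_mem_finCone {a : ι → A} {S : Set ι} {x y : A} (hx : x ∈ finCone a S)
    (hy : y ∈ finCone a S) : x + y ∈ finCone a S := by
  obtain ⟨l, h1, h2, rfl⟩ := hx
  obtain ⟨m, h3, h4, rfl⟩ := hy
  exact ⟨l + m, fun i => add_nonneg (h1 i) (h3 i), fun i hi => by simp [h2 i hi, h4 i hi],
    by simp [add_smul, Finset.sum_add_distrib]⟩

theorem smul_mem_finCone {a : ι → A} {S : Set ι} {x : A} (hx : x ∈ finCone a S) {c : ℝ}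
    (hc : 0 ≤ c) : c • x ∈ finCone a S := by
  obtain ⟨l, h1, h2, rfl⟩ := hx
  exact ⟨c • l, fun i => mul_nonneg hc (h1 i), fun i hi => by simp [h2 i hi],
    by simp [mul_smul, Finset.smul_sum]⟩

theorem convex_finCone (a : ι → A) (S : Set ι) : Convex ℝ (finCone a S) :=
  fun _ hx _ hy _ _ ha hb _ => add_mem_finCone (smul_mem_finCone hx ha) (smul_mem_finCone hy hb)

theorem mem_finCone_univ (a : ι → A) (i : ι) : a i ∈ finCone a univ := by
  classical
  refine ⟨Pi.single i 1, fun j => ?_, by simp, by simp [Pi.single_apply]⟩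
  by_cases h : j = i
  · subst h; simp
  · simp [h]

theorem zero_mem_finCone (a : ι → A) (S : Set ι) : (0 : A) ∈ finCone a S :=
  ⟨0, by simp, by simp, by simp⟩

variable [FiniteDimensional ℝ A]

theorem exists_metric_projection_finCone (a : ι → A) (w : A) (hw : ∀ i, 0 < ⟪w, a i⟫) (y : A) :
    ∃ p ∈ finCone a univ, ⟪y - p, p⟫ = 0 ∧ ∀ x ∈ finCone a univ, ⟪y - p, x⟫ ≤ 0 := by
  have : CompleteSpace A := FiniteDimensional.complete ℝ A
  obtain ⟨p, hp, hmin⟩ := exists_norm_eq_iInf_of_complete_convex ⟨0, zero_mem_finCone a univ⟩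
    (isClosed_finCone a univ w fun i _ => hw i).isComplete (convex_finCone a univ) y
  rw [norm_eq_iInf_iff_real_inner_le_zero (convex_finCone a univ) hp] at hmin
  refine ⟨p, hp, le_antisymm ?_ ?_, fun x hx => ?_⟩
  · simpa using hmin _ (add_mem_finCone hp hp)
  · simpa using hmin _ (zero_mem_finCone a univ)
  · simpa using hmin _ (add_mem_finCone hp hx)

theorem exists_inner_sum_le_of_gram_eq (a : ι → A) (b : ι → B) (w : A) (hw : ∀ i, 0 < ⟪w, a i⟫)
    (hgram : ∀ M : A, M ≠ 0 → (∀ i, ⟪M, a i⟫ ≤ 0) → ∀ i k, ⟪M, a i⟫ = 0 → ⟪M, a k⟫ = 0 →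
      ⟪a i, a k⟫ = ⟪b i, b k⟫) (z : A) :
    ∃ z' : B, ∀ N : A, N ≠ 0 → (∀ i, ⟪N, a i⟫ ≤ 0) → 0 ≤ ⟪N, z⟫ → ∀ l : ι → ℝ, (∀ i, 0 ≤ l i) →
      ⟪N, ∑ i, l i • a i⟫ = 0 → ⟪z, ∑ i, l i • a i⟫ ≤ ⟪z', ∑ i, l i • b i⟫ := by
  classical
  set J : Set (Set ι) := {S | ∃ M : A, M ≠ 0 ∧ (∀ i, ⟪M, a i⟫ ≤ 0) ∧ S = {i | ⟪M, a i⟫ = 0}}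
    with hJ
  choose π hπC hπ0 hπ using exists_metric_projection_finCone a w hw
  have hsupp : ∀ M : A, (∀ i, ⟪M, a i⟫ ≤ 0) → ∀ l : ι → ℝ, (∀ i, 0 ≤ l i) →
      ⟪M, ∑ i, l i • a i⟫ = 0 → ∀ i ∉ {i | ⟪M, a i⟫ = 0}, l i = 0 := by
    intro M hM l hl h i hi
    refine eq_zero_of_sum_mul_nonpos (g := fun i => -⟪M, a i⟫) hl
      (fun i => neg_nonneg.2 (hM i)) (le_of_eq ?_) (neg_ne_zero.2 hi)
    rw [inner_sum_smul_right] at h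
    simp [h]
  have hvan : ∀ M : A, ∀ l : ι → ℝ, (∀ i ∉ {i | ⟪M, a i⟫ = 0}, l i = 0) →
      ⟪M, ∑ i, l i • a i⟫ = 0 := by
    intro M l h
    rw [inner_sum_smul_right]
    refine Finset.sum_eq_zero fun i _ => ?_
    by_cases hi : ⟪M, a i⟫ = 0
    · simp [hi]
    · simp [h i hi]
  have hproj : ∀ N : A, N ≠ 0 → (∀ i, ⟪N, a i⟫ ≤ 0) → ∀ y, 0 ≤ ⟪N, y⟫ →
      ∃ M : A, M ≠ 0 ∧ (∀ i, ⟪M, a i⟫ ≤ 0) ∧ ⟪M, π y⟫ = 0 := by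
    intro N hN hNa y hy
    by_cases h : y - π y = 0
    · refine ⟨N, hN, hNa, le_antisymm ?_ ?_⟩
      · obtain ⟨l, hl, -, h'⟩ := hπC y
        rw [← h', inner_sum_smul_right]
        exact Finset.sum_nonpos fun i _ => mul_nonpos_of_nonneg_of_nonpos (hl i) (hNa i)
      · rwa [← sub_eq_zero.1 h]
    · exact ⟨y - π y, h, fun i => hπ y _ (mem_finCone_univ a i), hπ0 y⟩
  have hfix : ∀ y ∈ finCone a univ, π y = y := by
    intro y hy
    have h := hπ y y hy
    have h0 := hπ0 y
    have : ⟪y - π y, y - π y⟫ ≤ 0 := by rw [inner_sub_right, h0, sub_zero]; exact h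
    exact (sub_eq_zero.1 (real_inner_self_nonpos.1 this)).symm
  have hlip : ∀ y y', ‖π y - π y'‖ ≤ ‖y - y'‖ := by
    intro y y'
    have h1 : ⟪y - π y, π y' - π y⟫ ≤ 0 := by
      rw [inner_sub_right, hπ0, sub_zero]; exact hπ _ _ (hπC y')
    have h2 : ⟪y' - π y', π y - π y'⟫ ≤ 0 := by
      rw [inner_sub_right, hπ0, sub_zero]; exact hπ _ _ (hπC y)
    have h3 : ‖π y - π y'‖ ^ 2 ≤ ⟪y - y', π y - π y'⟫ := by
      rw [← real_inner_self_eq_norm_sq]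
      simp only [inner_sub_left, inner_sub_right] at h1 h2 ⊢
      linarith
    have h4 := real_inner_le_norm (y - y') (π y - π y')
    by_contra! h
    nlinarith [norm_nonneg (y - y'), norm_nonneg (π y - π y')]
  obtain ⟨m, hm, -, hmz⟩ := hπC z
  refine ⟨∑ i, m i • b i, fun N hN hNa hNz l hl hNl => ?_⟩
  obtain ⟨M₀, hM₀, hM₀a, hM₀z⟩ := hproj N hN hNa z hNz
  have hnorm : ‖∑ i, l i • b i‖ = ‖∑ i, l i • a i‖ := by
    have := norm_sum_smul_sub_eq (S := {i | ⟪N, a i⟫ = 0}) (a := a) (b := b) (m := 0)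
      (fun i hi k hk => hgram N hN hNa i k hi hk) (hsupp N hNa l hl hNl) (by simp)
    simpa using this
  have hdist : ∀ s : ℝ, 0 ≤ s →
      ‖s • ∑ i, l i • b i - ∑ i, m i • b i‖ ≤ ‖s • ∑ i, l i • a i - z‖ := by
    intro s hs
    have hsC : s • ∑ i, l i • a i ∈ finCone a univ :=
      smul_mem_finCone (sum_smul_mem_finCone_univ a hl) hs
    have := norm_sub_le_of_path_mem_finCone (a := a) (b := b) J ?_ ?_ ?_
      (fun t => π (z + t • (s • ∑ i, l i • a i - z))) ‖s • ∑ i, l i • a i - z‖ ?_ ?_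
      (S₀ := {i | ⟪M₀, a i⟫ = 0}) (S₁ := {i | ⟪N, a i⟫ = 0}) ⟨M₀, hM₀, hM₀a, rfl⟩
      ⟨N, hN, hNa, rfl⟩ (l₀ := m) (l₁ := fun i => s * l i) hm
      (hsupp M₀ hM₀a m hm (by rw [hmz]; exact hM₀z)) ?_ (fun i => mul_nonneg hs (hl i))
      (fun i hi => by rw [hsupp N hNa l hl hNl i hi, mul_zero]) ?_
    · simpa only [mul_smul, ← Finset.smul_sum] using this
    · rintro S ⟨M, hM, hMa, rfl⟩
      exact isClosed_finCone a _ w fun i _ => hw i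
    · rintro S ⟨M, hM, hMa, rfl⟩ i hi k hk
      exact hgram M hM hMa i k hi hk
    · rintro S ⟨M, hM, hMa, rfl⟩ T ⟨M', hM', hMa', rfl⟩ l m hl hlS hm hmT hlm
      exact hsupp M hMa m hm (by rw [← hlm]; exact hvan M l hlS)
    · intro t₁ _ t₂ _
      refine (hlip _ _).trans ?_
      rw [add_sub_add_left_eq_sub, ← sub_smul, norm_smul, Real.norm_eq_abs, mul_comm]
    · intro t ht
      obtain ⟨M, hM, hMa, hMz⟩ := hproj N hN hNa (z + t • (s • ∑ i, l i • a i - z)) (by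
        rw [inner_add_right, inner_smul_right, inner_sub_right, inner_smul_right, hNl]
        nlinarith [ht.1, ht.2])
      obtain ⟨l', hl', -, hl'z⟩ := hπC (z + t • (s • ∑ i, l i • a i - z))
      exact ⟨_, ⟨M, hM, hMa, rfl⟩, l', hl', hsupp M hMa l' hl' (by rw [hl'z]; exact hMz), hl'z⟩
    · simp [hmz]
    · simp only [one_smul, add_sub_cancel]
      rw [hfix _ hsC]
      simp only [mul_smul, ← Finset.smul_sum]
  by_contra! hlt
  set D := ⟪z, ∑ i, l i • a i⟫ - ⟪∑ i, m i • b i, ∑ i, l i • b i⟫ with hD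
  have hDpos : 0 < D := sub_pos.2 hlt
  have h1 := hdist ((‖z‖ ^ 2 + 1) / (2 * D)) (by positivity)
  have h2 := pow_le_pow_left₀ (norm_nonneg _) h1 2
  rw [norm_sub_sq_real, norm_sub_sq_real, norm_smul, norm_smul, hnorm, inner_smul_left,
    inner_smul_left, real_inner_comm, real_inner_comm z] at h2
  simp only [conj_trivial] at h2
  have h3 : (‖z‖ ^ 2 + 1) / (2 * D) * (2 * D) = ‖z‖ ^ 2 + 1 := by field_simp
  have h4 := sq_nonneg ‖∑ i, m i • b i‖
  rw [hD] at h3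
  rw [← hD] at h3
  have h5 : (‖z‖ ^ 2 + 1) / (2 * D) * D * 2 ≤ ‖z‖ ^ 2 := by
    have : (‖z‖ ^ 2 + 1) / (2 * D) * D = (‖z‖ ^ 2 + 1) / (2 * D) * ⟪z, ∑ i, l i • a i⟫ -
      (‖z‖ ^ 2 + 1) / (2 * D) * ⟪∑ i, m i • b i, ∑ i, l i • b i⟫ := by
        rw [← mul_sub]
    rw [this]
    linarith
  linarith

end ConeDuality

section Rigidity

variable {ι U V V' : Type*} [Fintype ι] [NormedAddCommGroup U] [InnerProductSpace ℝ U]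
  [NormedAddCommGroup V] [InnerProductSpace ℝ V]
  [NormedAddCommGroup V'] [InnerProductSpace ℝ V'] [FiniteDimensional ℝ V']

theorem false_of_zero_notMem_interior {v' : ι → V'} {F : ι → U} {e : U} {h R' : ℝ} (hh : 0 < h)
    (he : ∀ i, ⟪e, F i⟫ = h) (hR' : 0 < R') (hv' : ∀ i, ‖v' i‖ = R') (hF : ∀ i, ‖F i‖ = R')
    (hint' : (interior (convexHull ℝ (range v'))).Nonempty)
    (h0 : (0 : V') ∉ interior (convexHull ℝ (range v')))
    (hgram : ∀ n : V', n ≠ 0 → ∀ i k, (∀ l, ⟪n, v' l⟫ ≤ ⟪n, v' i⟫) → ⟪n, v' k⟫ = ⟪n, v' i⟫ →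
      ⟪v' i, v' k⟫ = ⟪F i, F k⟫) : False := by
  set K := convexHull ℝ (range v') with hKdef
  have hK : Convex ℝ K := convex_convexHull ℝ _
  have hKc : IsCompact K := (finite_range v').isCompact_convexHull (𝕜 := ℝ)
  have hvK : ∀ i, v' i ∈ K := fun i => subset_convexHull ℝ _ (mem_range_self i)
  obtain ⟨y, hy⟩ := hint'
  have hy0 : y ≠ 0 := by rintro rfl; exact h0 hy
  obtain ⟨t₁, ht₁, ht₁1, hx₁, n₁, hn₁, hmax₁⟩ := exists_entry_point hK hKc hy h0
  obtain ⟨t₂, ht₂, hx₂, n₂, hn₂, hmax₂, -⟩ := exists_exit_point hK hKc hy hy0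
  have hle : ∀ i k, ⟪v' i, v' k⟫ ≤ ⟪F i, F k⟫ := by
    intro i k
    have := norm_sub_le_of_gram_eq hR' hv' ⟨y, hy⟩ (b := F) (fun n i k hpos hm hk =>
      hgram n (by rintro rfl; simp at hpos) i k hm hk) i k
    have := pow_le_pow_left₀ (norm_nonneg _) this 2
    rw [norm_sub_sq_real, norm_sub_sq_real, hF, hF, hv', hv', real_inner_comm,
      real_inner_comm (v' i)] at this
    linarith
  have hweights : ∀ x ∈ K, ∀ n : V', n ≠ 0 → (∀ z ∈ K, ⟪n, z⟫ ≤ ⟪n, x⟫) →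
      ∃ l : ι → ℝ, (∀ i, 0 ≤ l i) ∧ ∑ i, l i = 1 ∧ ∑ i, l i • v' i = x ∧
        ‖∑ i, l i • F i‖ = ‖x‖ := by
    intro x hx n hn hmax
    obtain ⟨l, hl0, hl1, hlx, hls⟩ := exists_weights_of_isMax hx fun i => hmax _ (hvK i)
    refine ⟨l, hl0, hl1, hlx, ?_⟩
    have := norm_sum_smul_sub_eq (S := {i | ⟪n, v' i⟫ = ⟪n, x⟫}) (a := v') (b := F) (l := l)
      (m := 0) (fun i hi k hk => hgram n hn i k (fun l => ?_) ?_) hls (by simp)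
    · simpa [hlx] using this
    · rw [mem_ofPred_eq] at hi
      rw [hi]
      exact hmax _ (hvK l)
    · rw [mem_ofPred_eq] at hi hk
      rw [hi, hk]
  obtain ⟨l, hl0, hl1, hlx, hln⟩ := hweights _ hx₁ n₁ hn₁ hmax₁
  obtain ⟨m, hm0, hm1, hmx, hmn⟩ := hweights _ hx₂ n₂ hn₂ hmax₂
  have hinner : ⟪t₁ • y, t₂ • y⟫ ≤ ⟪∑ i, l i • F i, ∑ i, m i • F i⟫ := by
    rw [← hlx, ← hmx]
    simp only [sum_inner, inner_sum, inner_smul_left, inner_smul_right, conj_trivial]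
    refine Finset.sum_le_sum fun k _ => mul_le_mul_of_nonneg_left
      (Finset.sum_le_sum fun i _ => mul_le_mul_of_nonneg_left ?_ ?_) ?_
    all_goals first | exact hle _ _ | exact hl0 _ | exact hm0 _
  have hpar : t₂ • ∑ i, l i • F i - t₁ • ∑ i, m i • F i = 0 := by
    refine norm_eq_zero.1 ((pow_eq_zero_iff two_ne_zero).1 (le_antisymm ?_ (sq_nonneg _)))
    rw [norm_sub_sq_real, norm_smul, norm_smul, hln, hmn, norm_smul, norm_smul, inner_smul_left,
      inner_smul_right]
    rw [inner_smul_left, inner_smul_right, real_inner_self_eq_norm_sq] at hinner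
    simp only [Real.norm_eq_abs, conj_trivial, abs_of_nonneg ht₁,
      abs_of_pos (one_pos.trans ht₂)] at hinner ⊢
    have h2 : 0 ≤ t₁ * t₂ := mul_nonneg ht₁ (by linarith)
    have := mul_le_mul_of_nonneg_left hinner h2
    nlinarith
  have hsum : ∀ l : ι → ℝ, ∑ i, l i = 1 → ⟪e, ∑ i, l i • F i⟫ = h := by
    intro l hl
    rw [inner_sum_smul_right]
    simp [he, ← Finset.sum_mul, hl]
  have := congrArg (fun x => ⟪e, x⟫) hpar
  simp only [inner_sub_right, inner_smul_right, hsum l hl1, hsum m hm1, inner_zero_right] at this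
  rw [← sub_mul] at this
  have := (mul_eq_zero.1 this).resolve_right hh.ne'
  linarith

theorem exists_ne_zero_inner_eq_zero [FiniteDimensional ℝ V] (hV : 2 ≤ Module.finrank ℝ V)
    (x : V) : ∃ w : V, w ≠ 0 ∧ ⟪w, x⟫ = 0 := by
  have h : (Submodule.span ℝ {x})ᗮ ≠ ⊥ := by
    rw [Ne, Submodule.orthogonal_eq_bot_iff]
    intro htop
    have h1 := finrank_span_le_card (R := ℝ) ({x} : Set V)
    rw [htop, finrank_top, Set.toFinset_singleton, Finset.card_singleton] at h1
    omega
  obtain ⟨w, hw, hw0⟩ := Submodule.exists_mem_ne_zero_of_ne_bot h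
  exact ⟨w, hw0, by
    rw [real_inner_comm]
    exact Submodule.mem_orthogonal_singleton_iff_inner_right.1 hw⟩

theorem exists_pos_smul_mem_interior {K : Set V} (h0 : (0 : V) ∈ interior K) (x : V) :
    ∃ s : ℝ, 0 < s ∧ s • x ∈ interior K := by
  have hc : Continuous fun s : ℝ => s • x := by fun_prop
  have h : ∀ᶠ s in nhdsWithin (0 : ℝ) (Ioi 0), s • x ∈ interior K := by
    refine (hc.tendsto 0).eventually ?_ |>.filter_mono nhdsWithin_le_nhds
    rw [zero_smul]
    exact isOpen_interior.mem_nhds h0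
  obtain ⟨s, hs, hs0⟩ := (h.and self_mem_nhdsWithin).exists
  exact ⟨s, hs0, hs⟩

end Rigidity

theorem pos_of_interior_convexHull_nonempty {ι V : Type*} [NormedAddCommGroup V]
    [InnerProductSpace ℝ V] [Nontrivial V] {v : ι → V} {R : ℝ}
    (hv : ∀ i, ‖v i‖ = R) (hint : (interior (convexHull ℝ (range v))).Nonempty) : 0 < R := by
  by_contra! hR
  have hsub : convexHull ℝ (range v) ⊆ {0} := by
    refine convexHull_min ?_ (convex_singleton 0)
    rintro _ ⟨i, rfl⟩
    exact norm_le_zero_iff.1 ((hv i).le.trans hR)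
  obtain ⟨x, hx⟩ := hint
  have := interior_mono hsub hx
  rw [interior_singleton] at this
  exact this

section RigidityMain

variable {ι V V' : Type*} [Fintype ι] [NormedAddCommGroup V] [InnerProductSpace ℝ V]
  [NormedAddCommGroup V'] [InnerProductSpace ℝ V']

theorem inner_toLp_prod (n x : V) (s t : ℝ) :
    ⟪WithLp.toLp 2 (n, s), WithLp.toLp 2 (x, t)⟫ = ⟪n, x⟫ + s * t := by
  rw [WithLp.prod_inner_apply]
  simp [mul_comm]

variable [FiniteDimensional ℝ V] [FiniteDimensional ℝ V']

theorem false_of_zero_mem_interior (hV : 2 ≤ Module.finrank ℝ V) {v : ι → V} {v' : ι → V'}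
    (hinj : Function.Injective v) {R R' h : ℝ} (hh : 0 < h)
    (hRR : R ^ 2 + h ^ 2 = R' ^ 2) (hR : 0 < R) (hR' : 0 < R')
    (hv : ∀ i, ‖v i‖ = R) (hv' : ∀ i, ‖v' i‖ = R')
    (h0 : (0 : V') ∈ interior (convexHull ℝ (range v'))) [Nonempty ι]
    (hgram : ∀ n : V, n ≠ 0 → ∀ i k, (∀ l, ⟪n, v l⟫ ≤ ⟪n, v i⟫) → ⟪n, v k⟫ = ⟪n, v i⟫ →
      ⟪v i, v k⟫ + h * h = ⟪v' i, v' k⟫)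
    (hface' : ∀ n' : V', n' ≠ 0 → ∀ i, (∀ l, ⟪n', v' l⟫ ≤ ⟪n', v' i⟫) →
      ∃ n : V, n ≠ 0 ∧ (∀ l, ⟪n, v l⟫ ≤ ⟪n, v i⟫) ∧
        ∀ k, ⟪n', v' k⟫ = ⟪n', v' i⟫ → ⟪n, v k⟫ = ⟪n, v i⟫) : False := by
  classical
  obtain ⟨i₀⟩ := ‹Nonempty ι›
  set F : ι → WithLp 2 (V × ℝ) := fun i => WithLp.toLp 2 (v i, h) with hFdef
  have hFF : ∀ i k, ⟪F i, F k⟫ = ⟪v i, v k⟫ + h * h := fun i k => inner_toLp_prod _ _ _ _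
  have hFn : ∀ i, ‖F i‖ ^ 2 = R' ^ 2 := fun i => by
    rw [← real_inner_self_eq_norm_sq, hFF, real_inner_self_eq_norm_sq, hv, ← hRR, sq h]
  have hlift : ∀ n : V, ∀ i k, ⟪WithLp.toLp 2 (n, -⟪n, v i⟫ / h), F k⟫ = ⟪n, v k⟫ - ⟪n, v i⟫ := by
    intro n i k
    rw [hFdef, inner_toLp_prod]
    field_simp
    ring
  have hne : ∀ n : V, n ≠ 0 → ∀ s : ℝ, (WithLp.toLp 2 (n, s) : WithLp 2 (V × ℝ)) ≠ 0 := by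
    intro n hn s h0
    exact hn (congrArg (fun x : WithLp 2 (V × ℝ) => x.fst) h0)
  have hcone := exists_inner_sum_le_of_gram_eq F v' (WithLp.toLp 2 (0, 1))
    (fun i => by rw [hFdef, inner_toLp_prod]; simpa using hh) (by
      intro M hM hMF i k hi hk
      obtain ⟨m, s⟩ := M
      have hMF' : ∀ l, ⟪(WithLp.toLp 2 (m, s) : WithLp 2 (V × ℝ)), F l⟫ = ⟪m, v l⟫ + s * h :=
        fun l => inner_toLp_prod _ _ _ _
      simp only [hMF'] at hMF hi hk
      have hm : m ≠ 0 := by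
        rintro rfl
        have : s = 0 := by simpa [hh.ne'] using hi
        subst this
        exact hM rfl
      rw [hFF]
      exact hgram m hm i k (fun l => by linarith [hMF l]) (by linarith))
  obtain ⟨s, hs, hsint⟩ := exists_pos_smul_mem_interior h0 (-v' i₀)
  have hv0 : v' i₀ ≠ 0 := norm_ne_zero_iff.1 (by rw [hv']; exact hR'.ne')
  obtain ⟨t, ht, htK, n', hn', hmax', -⟩ := exists_exit_point (convex_convexHull ℝ _)
    ((finite_range v').isCompact_convexHull (𝕜 := ℝ)) hsint
    (smul_ne_zero hs.ne' (neg_ne_zero.2 hv0))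
  obtain ⟨l, hl0, hl1, hlx, hls⟩ := exists_weights_of_isMax htK fun i =>
    hmax' _ (subset_convexHull ℝ _ (mem_range_self i))
  obtain ⟨i₁, hi₁⟩ : ∃ i, l i ≠ 0 := by
    by_contra! hall
    simp [hall] at hl1
  have hi₁' : ⟪n', v' i₁⟫ = ⟪n', t • s • -v' i₀⟫ := by
    by_contra hc
    exact hi₁ (hls i₁ hc)
  obtain ⟨n, hn, hmax, hface⟩ := hface' n' hn' i₁ fun k => by
    rw [hi₁']
    exact hmax' _ (subset_convexHull ℝ _ (mem_range_self k))
  set c₀ : ℝ := (t * s)⁻¹ with hc₀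
  have hts : 0 < t * s := mul_pos (by linarith) hs
  have hlS : ∀ k ∉ {k | ⟪n, v k⟫ = ⟪n, v i₁⟫}, c₀ * l k = 0 := by
    intro k hk
    rw [hls k fun h => hk (hface k (by rw [h, hi₁'])), mul_zero]
  have hlnn : ∀ k, 0 ≤ c₀ * l k := fun k => mul_nonneg (inv_nonneg.2 hts.le) (hl0 k)
  have hla : ∑ k, (c₀ * l k) • v' k = -v' i₀ := by
    simp only [mul_smul, ← Finset.smul_sum]
    rw [hlx, smul_smul, smul_smul, mul_assoc c₀, hc₀, inv_mul_cancel₀ hts.ne', one_smul]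
  set p := F i₀ with hp
  set q := ∑ k, (c₀ * l k) • F k with hq
  set Nq : WithLp 2 (V × ℝ) := WithLp.toLp 2 (n, -⟪n, v i₁⟫ / h) with hNq
  have hNqF : ∀ k, ⟪Nq, F k⟫ ≤ 0 := fun k => by
    rw [hNq, hlift]
    linarith [hmax k]
  have hNqq : ⟪Nq, q⟫ = 0 := by
    rw [hq, inner_sum_smul_right]
    refine Finset.sum_eq_zero fun k _ => ?_
    by_cases hk : ⟪n, v k⟫ = ⟪n, v i₁⟫
    · rw [hNq, hlift, hk, sub_self, mul_zero]
    · rw [hlS k hk, zero_mul]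
  have hqn : ‖q‖ ^ 2 = R' ^ 2 := by
    have := norm_sum_smul_sub_eq (S := {k | ⟪n, v k⟫ = ⟪n, v i₁⟫}) (a := F) (b := v')
      (l := fun k => c₀ * l k) (m := 0) (fun i hi k hk => ?_) hlS (by simp)
    · simp only [Pi.zero_apply, zero_smul, Finset.sum_const_zero, sub_zero] at this
      rw [hq, ← this, hla, norm_neg, hv']
    · rw [mem_ofPred_eq] at hi hk
      rw [hFF]
      exact hgram n hn i k (fun l => by rw [hi]; exact hmax l) (by rw [hi, hk])
  set c := p + q with hc
  have hcpos : 0 < ‖c‖ := by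
    rw [norm_pos_iff]
    intro hc0
    have := congrArg (fun x => ⟪(WithLp.toLp 2 (0, 1) : WithLp 2 (V × ℝ)), x⟫) hc0
    simp only [hc, hp, hq, inner_add_right, inner_sum_smul_right, inner_zero_right] at this
    simp only [hFdef, inner_toLp_prod, inner_zero_left, zero_add, one_mul] at this
    have h2 : 0 ≤ ∑ k, c₀ * l k * h :=
      Finset.sum_nonneg fun k _ => mul_nonneg (hlnn k) hh.le
    linarith
  have hcp : 0 < ⟪c, p⟫ := by
    have h1 : ‖c‖ ^ 2 = ‖p‖ ^ 2 + 2 * ⟪p, q⟫ + ‖q‖ ^ 2 := norm_add_sq_real p q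
    rw [hc, inner_add_left, real_inner_self_eq_norm_sq, real_inner_comm]
    rw [hqn, hFn] at h1
    rw [hFn]
    nlinarith [sq_pos_of_pos hcpos]
  have hcq : 0 < ⟪c, q⟫ := by
    have h1 : ‖c‖ ^ 2 = ‖p‖ ^ 2 + 2 * ⟪p, q⟫ + ‖q‖ ^ 2 := norm_add_sq_real p q
    rw [hc, inner_add_left, real_inner_self_eq_norm_sq]
    rw [hqn, hFn] at h1
    rw [hqn]
    nlinarith [sq_pos_of_pos hcpos]
  have hspan : ∀ m : V, m ≠ 0 → (∀ k, ⟪m, v k⟫ ≤ ⟪m, v i₀⟫) → ∃ α β : ℝ,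
      α • (WithLp.toLp 2 (m, -⟪m, v i₀⟫ / h) : WithLp 2 (V × ℝ)) + β • Nq = c := by
    intro m hm hmmax
    set N : WithLp 2 (V × ℝ) := WithLp.toLp 2 (m, -⟪m, v i₀⟫ / h) with hN
    have hNF : ∀ k, ⟪N, F k⟫ ≤ 0 := fun k => by
      rw [hN, hlift]
      linarith [hmmax k]
    have hNp : ⟪N, p⟫ = 0 := by rw [hN, hp, hlift, sub_self]
    have hhalf : ∀ z, ⟪N, z⟫ = 0 → ⟪Nq, z⟫ = 0 → ⟪z, c⟫ ≤ 0 := by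
      intro z hzN hzq
      obtain ⟨z', hz'⟩ := hcone z
      have h1 := hz' N (hne m hm _) hNF hzN.ge (Pi.single i₀ 1)
        (fun j => by by_cases h : j = i₀ <;> [(subst h; simp); simp [h]])
        (by simpa [Pi.single_apply] using hNp)
      have h2 := hz' Nq (hne n hn _) hNqF hzq.ge (fun k => c₀ * l k) hlnn hNqq
      rw [hla, inner_neg_right] at h2
      simp only [Pi.single_apply, ite_smul, one_smul, zero_smul, Finset.sum_ite_eq',
        Finset.mem_univ, if_true] at h1
      rw [hc, inner_add_right]
      linarith
    rw [← Submodule.mem_span_pair, ← Submodule.orthogonal_orthogonal (Submodule.span ℝ {N, Nq}),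
      Submodule.mem_orthogonal]
    intro z hz
    rw [Submodule.mem_orthogonal] at hz
    have hz1 : ⟪N, z⟫ = 0 := hz N (Submodule.subset_span (by simp))
    have hz2 : ⟪Nq, z⟫ = 0 := hz Nq (Submodule.subset_span (by simp))
    refine le_antisymm (hhalf z hz1 hz2) ?_
    have := hhalf (-z) (by simp [hz1]) (by simp [hz2])
    rw [inner_neg_left] at this
    linarith
  obtain ⟨w, hw0, hwv⟩ := exists_ne_zero_inner_eq_zero hV (v i₀)
  have hvv : ∀ k, ⟪v i₀, v k⟫ ≤ ⟪v i₀, v i₀⟫ := fun k => by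
    rw [real_inner_self_eq_norm_sq, hv, sq]
    exact (real_inner_le_norm _ _).trans (by rw [hv, hv])
  have hvlt : ∀ k, k ≠ i₀ → ⟪v i₀, v k⟫ < ⟪v i₀, v i₀⟫ := by
    intro k hk
    refine (hvv k).lt_of_ne fun heq => hk ?_
    have h1 := norm_sub_sq_real (v i₀) (v k)
    rw [heq, real_inner_self_eq_norm_sq, hv, hv] at h1
    have h2 : ‖v i₀ - v k‖ ^ 2 = 0 := by linarith
    exact (hinj (sub_eq_zero.1 (norm_eq_zero.1 ((pow_eq_zero_iff two_ne_zero).1 h2)))).symm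
  obtain ⟨ε, hε, hεk⟩ : ∃ ε : ℝ, 0 < ε ∧ ∀ k, ⟪v i₀ + ε • w, v k⟫ ≤ ⟪v i₀ + ε • w, v i₀⟫ := by
    have : ∀ᶠ ε in nhdsWithin (0 : ℝ) (Ioi 0),
        ∀ k, ⟪v i₀ + ε • w, v k⟫ ≤ ⟪v i₀ + ε • w, v i₀⟫ := by
      refine Filter.eventually_all.2 fun k => ?_
      by_cases hk : k = i₀
      · subst hk
        exact Filter.Eventually.of_forall fun _ => le_rfl
      · have hcl : Continuous fun ε : ℝ => ⟪v i₀ + ε • w, v k⟫ := by fun_prop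
        have hcr : Continuous fun ε : ℝ => ⟪v i₀ + ε • w, v i₀⟫ := by fun_prop
        have := (isOpen_lt hcl hcr).mem_nhds (x := (0 : ℝ)) (by simpa using hvlt k hk)
        filter_upwards [nhdsWithin_le_nhds this] with ε hε using le_of_lt hε
    obtain ⟨ε, h1, h2⟩ := (this.and self_mem_nhdsWithin).exists
    exact ⟨ε, h2, h1⟩
  have hv₀ : v i₀ ≠ 0 := norm_ne_zero_iff.1 (by rw [hv]; exact hR.ne')
  have hw₀ : v i₀ + ε • w ≠ 0 := by
    intro h0
    have := congrArg (fun x => ⟪x, v i₀⟫) h0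
    simp only [inner_add_left, inner_smul_left, hwv, mul_zero, add_zero, inner_zero_left] at this
    exact hv₀ (inner_self_eq_zero.1 this)
  obtain ⟨α₁, β₁, h₁⟩ := hspan _ hv₀ hvv
  obtain ⟨α₂, β₂, h₂⟩ := hspan _ hw₀ hεk
  have hβ : ∀ α β : ℝ, ∀ m : V, α • (WithLp.toLp 2 (m, -⟪m, v i₀⟫ / h) : WithLp 2 (V × ℝ)) +
      β • Nq = c → β * ⟪Nq, p⟫ = ⟪c, p⟫ := by
    intro α β m hm
    have := congrArg (fun x => ⟪x, p⟫) hm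
    simp only [inner_add_left, inner_smul_left, conj_trivial] at this
    rw [hp, hlift, sub_self, mul_zero, zero_add] at this
    exact this
  have hNqp : ⟪Nq, p⟫ ≠ 0 := by
    intro h0
    have := hβ _ _ _ h₁
    rw [h0, mul_zero] at this
    exact hcp.ne this
  have hββ : β₁ = β₂ := mul_right_cancel₀ hNqp ((hβ _ _ _ h₁).trans (hβ _ _ _ h₂).symm)
  rw [← h₂, hββ] at h₁
  have h₃ : α₁ • v i₀ = α₂ • (v i₀ + ε • w) :=
    congrArg (fun x : WithLp 2 (V × ℝ) => x.fst) (add_right_cancel h₁)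
  have hα₂ : α₂ = 0 := by
    have := congrArg (fun x => ⟪w, x⟫) h₃
    simp only [inner_smul_right, inner_add_right, hwv, mul_zero, zero_add] at this
    have hww : ⟪w, w⟫ ≠ 0 := fun h => hw0 (inner_self_eq_zero.1 h)
    by_contra hα
    exact (mul_ne_zero hα (mul_ne_zero hε.ne' hww)) this.symm
  rw [hα₂, zero_smul, zero_add] at h₂
  rw [← h₂, inner_smul_left, hNqq, mul_zero] at hcq
  exact hcq.false

theorem radius_le_of_dist_eq (hV : 2 ≤ Module.finrank ℝ V)
    {v : ι → V} {v' : ι → V'} (hinj : Function.Injective v) {R R' : ℝ}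
    (hR : 0 < R) (hv : ∀ i, ‖v i‖ = R) (hv' : ∀ i, ‖v' i‖ = R')
    (hint' : (interior (convexHull ℝ (range v'))).Nonempty)
    (hdist : ∀ n : V, n ≠ 0 → ∀ i k, (∀ l, ⟪n, v l⟫ ≤ ⟪n, v i⟫) → ⟪n, v k⟫ = ⟪n, v i⟫ →
      dist (v i) (v k) = dist (v' i) (v' k))
    (hface' : ∀ n' : V', n' ≠ 0 → ∀ i, (∀ l, ⟪n', v' l⟫ ≤ ⟪n', v' i⟫) →
      ∃ n : V, n ≠ 0 ∧ (∀ l, ⟪n, v l⟫ ≤ ⟪n, v i⟫) ∧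
        ∀ k, ⟪n', v' k⟫ = ⟪n', v' i⟫ → ⟪n, v k⟫ = ⟪n, v i⟫) : R' ≤ R := by
  by_contra! hlt
  have hR' : 0 < R' := hR.trans hlt
  have hne : Nonempty ι := by
    obtain ⟨x, hx⟩ := hint'
    obtain ⟨_, i, -⟩ := (convexHull_nonempty_iff (𝕜 := ℝ)).1 ⟨x, interior_subset hx⟩
    exact ⟨i⟩
  have hpos : 0 < R' ^ 2 - R ^ 2 := by nlinarith
  set h := √(R' ^ 2 - R ^ 2) with hh
  have hhpos : 0 < h := Real.sqrt_pos.2 hpos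
  have hhsq : h ^ 2 = R' ^ 2 - R ^ 2 := Real.sq_sqrt hpos.le
  have hgram : ∀ n : V, n ≠ 0 → ∀ i k, (∀ l, ⟪n, v l⟫ ≤ ⟪n, v i⟫) → ⟪n, v k⟫ = ⟪n, v i⟫ →
      ⟪v i, v k⟫ + h * h = ⟪v' i, v' k⟫ := by
    intro n hn i k hi hk
    have h1 := hdist n hn i k hi hk
    rw [dist_eq_norm, dist_eq_norm] at h1
    have h2 := norm_sub_sq_real (v i) (v k)
    have h3 := norm_sub_sq_real (v' i) (v' k)
    rw [hv, hv, h1] at h2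
    rw [hv', hv'] at h3
    linarith
  by_cases h0 : (0 : V') ∈ interior (convexHull ℝ (range v'))
  · exact false_of_zero_mem_interior hV hinj hhpos (by linarith) hR hR' hv hv' h0 hgram hface'
  · refine false_of_zero_notMem_interior (v' := v') (R' := R')
      (F := fun i => (WithLp.toLp 2 (v i, h) : WithLp 2 (V × ℝ)))
      (e := WithLp.toLp 2 (0, 1)) hhpos (fun i => by rw [inner_toLp_prod]; simp) hR' hv'
      (fun i => ?_) hint' h0 ?_
    · rw [← sq_eq_sq₀ (norm_nonneg _) hR'.le, ← real_inner_self_eq_norm_sq, inner_toLp_prod,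
        real_inner_self_eq_norm_sq, hv]
      linarith
    · intro n' hn' i k hi hk
      obtain ⟨n, hn, hmax, hn2⟩ := hface' n' hn' i hi
      rw [inner_toLp_prod]
      exact (hgram n hn i k hmax (hn2 k hk)).symm

/-- Two inscribed polytopes with corresponding vertices, whose proper faces correspond to each
other and are congruent, have equal distances between corresponding vertices. -/
theorem dist_eq_of_inscribed (hV : 2 ≤ Module.finrank ℝ V) (hV' : 2 ≤ Module.finrank ℝ V')
    {v : ι → V} {v' : ι → V'} (hinj : Function.Injective v) (hinj' : Function.Injective v')
    {R R' : ℝ} (hv : ∀ i, ‖v i‖ = R) (hv' : ∀ i, ‖v' i‖ = R')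
    (hint : (interior (convexHull ℝ (range v))).Nonempty)
    (hint' : (interior (convexHull ℝ (range v'))).Nonempty)
    (hdist : ∀ n : V, n ≠ 0 → ∀ i k, (∀ l, ⟪n, v l⟫ ≤ ⟪n, v i⟫) → ⟪n, v k⟫ = ⟪n, v i⟫ →
      dist (v i) (v k) = dist (v' i) (v' k))
    (hface : ∀ n : V, n ≠ 0 → ∀ i, (∀ l, ⟪n, v l⟫ ≤ ⟪n, v i⟫) →
      ∃ n' : V', n' ≠ 0 ∧ (∀ l, ⟪n', v' l⟫ ≤ ⟪n', v' i⟫) ∧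
        ∀ k, ⟪n, v k⟫ = ⟪n, v i⟫ → ⟪n', v' k⟫ = ⟪n', v' i⟫)
    (hface' : ∀ n' : V', n' ≠ 0 → ∀ i, (∀ l, ⟪n', v' l⟫ ≤ ⟪n', v' i⟫) →
      ∃ n : V, n ≠ 0 ∧ (∀ l, ⟪n, v l⟫ ≤ ⟪n, v i⟫) ∧
        ∀ k, ⟪n', v' k⟫ = ⟪n', v' i⟫ → ⟪n, v k⟫ = ⟪n, v i⟫) (i k : ι) :
    dist (v i) (v k) = dist (v' i) (v' k) := by
  have : Nontrivial V := Module.nontrivial_of_finrank_pos (R := ℝ) (by omega)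
  have : Nontrivial V' := Module.nontrivial_of_finrank_pos (R := ℝ) (by omega)
  have hR := pos_of_interior_convexHull_nonempty hv hint
  have hR' := pos_of_interior_convexHull_nonempty hv' hint'
  have hdist' : ∀ n' : V', n' ≠ 0 → ∀ i k, (∀ l, ⟪n', v' l⟫ ≤ ⟪n', v' i⟫) →
      ⟪n', v' k⟫ = ⟪n', v' i⟫ → dist (v' i) (v' k) = dist (v i) (v k) := by
    intro n' hn' i k hi hk
    obtain ⟨n, hn, hmax, hn2⟩ := hface' n' hn' i hi
    exact (hdist n hn i k hmax (hn2 k hk)).symm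
  have hRR : R = R' := le_antisymm (radius_le_of_dist_eq hV' hinj' hR' hv' hv hint hdist' hface)
    (radius_le_of_dist_eq hV hinj hR hv hv' hint' hdist hface')
  have hgram : ∀ i k, dist (v i) (v k) = dist (v' i) (v' k) → ⟪v i, v k⟫ = ⟪v' i, v' k⟫ := by
    intro i k h1
    rw [dist_eq_norm, dist_eq_norm] at h1
    have h2 := norm_sub_sq_real (v i) (v k)
    have h3 := norm_sub_sq_real (v' i) (v' k)
    rw [hv, hv, h1] at h2
    rw [hv', hv', ← hRR] at h3
    linarith
  rw [dist_eq_norm, dist_eq_norm]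
  refine le_antisymm ?_ ?_
  · refine norm_sub_le_of_gram_eq hR' hv' hint' (fun n i k hpos hi hk => ?_) k i
    exact (hgram i k (hdist' n (by rintro rfl; simp at hpos) i k hi hk).symm).symm
  · refine norm_sub_le_of_gram_eq hR hv hint (fun n i k hpos hi hk => ?_) k i
    exact hgram i k (hdist n (by rintro rfl; simp at hpos) i k hi hk)

end RigidityMain

section Affine

variable {ι E : Type*} [NormedAddCommGroup E] [InnerProductSpace ℝ E] [FiniteDimensional ℝ E]

theorem exists_center_sub_mem_vectorSpan [Nonempty ι] {a : ι → E} {z : E} {ρ : ℝ}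
    (ha : ∀ i, dist (a i) z = ρ) :
    ∃ c : E, ∃ R : ℝ, ∀ i, a i - c ∈ vectorSpan ℝ (range a) ∧ ‖a i - c‖ = R := by
  have hne : Nonempty (affineSpan ℝ (range a)) :=
    ((affineSpan_nonempty ℝ).2 (range_nonempty a)).to_subtype
  obtain ⟨R, hR⟩ := (EuclideanGeometry.exists_dist_eq_iff_exists_dist_orthogonalProjection_eq
    (subset_affineSpan ℝ (range a)) z).1 ⟨ρ, by rintro _ ⟨i, rfl⟩; exact ha i⟩
  refine ⟨EuclideanGeometry.orthogonalProjection (affineSpan ℝ (range a)) z, R, fun i => ⟨?_, ?_⟩⟩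
  · rw [← direction_affineSpan]
    exact AffineSubspace.vsub_mem_direction (subset_affineSpan ℝ _ (mem_range_self i))
      (EuclideanGeometry.orthogonalProjection_mem z)
  · rw [← dist_eq_norm]
    exact hR _ (mem_range_self i)

theorem interior_convexHull_range_nonempty [Nonempty ι] {a : ι → E} {c : E}
    {v : ι → vectorSpan ℝ (range a)} (hv : ∀ i, (v i : E) = a i - c) :
    (interior (convexHull ℝ (range v))).Nonempty := by
  rw [interior_convexHull_nonempty_iff_affineSpan_eq_top,
    AffineSubspace.affineSpan_eq_top_iff_vectorSpan_eq_top_of_nonempty ℝ _ _ (range_nonempty v)]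
  refine Submodule.map_injective_of_injective (Submodule.injective_subtype _) ?_
  rw [Submodule.map_top, Submodule.range_subtype]
  let f : vectorSpan ℝ (range a) →ᵃ[ℝ] E :=
    (Submodule.subtype _).toAffineMap + AffineMap.const ℝ _ c
  have hf : f '' range v = range a := by
    rw [← range_comp]
    congr 1
    funext i
    simp [f, hv]
  have hlin : f.linear = Submodule.subtype _ := by simp [f]
  rw [← hlin, f.map_vectorSpan, hf]

/-- Version of `dist_eq_of_inscribed` for polytopes of lower dimension than the ambient space. -/
theorem dist_eq_of_inscribed_affine [Fintype ι] [Nonempty ι] {a b : ι → E}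
    (h2 : 2 ≤ Module.finrank ℝ (vectorSpan ℝ (range a)))
    (h2' : 2 ≤ Module.finrank ℝ (vectorSpan ℝ (range b)))
    (hinj : Function.Injective a) (hinj' : Function.Injective b)
    {z z' : E} {ρ ρ' : ℝ} (ha : ∀ i, dist (a i) z = ρ) (hb : ∀ i, dist (b i) z' = ρ')
    (hdist : ∀ n ∈ vectorSpan ℝ (range a), n ≠ 0 → ∀ i k, (∀ l, ⟪n, a l⟫ ≤ ⟪n, a i⟫) →
      ⟪n, a k⟫ = ⟪n, a i⟫ → dist (a i) (a k) = dist (b i) (b k))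
    (hface : ∀ n ∈ vectorSpan ℝ (range a), n ≠ 0 → ∀ i, (∀ l, ⟪n, a l⟫ ≤ ⟪n, a i⟫) →
      ∃ n' ∈ vectorSpan ℝ (range b), n' ≠ 0 ∧ (∀ l, ⟪n', b l⟫ ≤ ⟪n', b i⟫) ∧
        ∀ k, ⟪n, a k⟫ = ⟪n, a i⟫ → ⟪n', b k⟫ = ⟪n', b i⟫)
    (hface' : ∀ n' ∈ vectorSpan ℝ (range b), n' ≠ 0 → ∀ i, (∀ l, ⟪n', b l⟫ ≤ ⟪n', b i⟫) →
      ∃ n ∈ vectorSpan ℝ (range a), n ≠ 0 ∧ (∀ l, ⟪n, a l⟫ ≤ ⟪n, a i⟫) ∧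
        ∀ k, ⟪n', b k⟫ = ⟪n', b i⟫ → ⟪n, a k⟫ = ⟪n, a i⟫) (i k : ι) :
    dist (a i) (a k) = dist (b i) (b k) := by
  obtain ⟨c, R, hc⟩ := exists_center_sub_mem_vectorSpan ha
  obtain ⟨c', R', hc'⟩ := exists_center_sub_mem_vectorSpan hb
  have hdv : ∀ i k, dist (⟨a i - c, (hc i).1⟩ : vectorSpan ℝ (range a)) ⟨a k - c, (hc k).1⟩ =
      dist (a i) (a k) := fun i k => by simp [Subtype.dist_eq]
  have hdv' : ∀ i k, dist (⟨b i - c', (hc' i).1⟩ : vectorSpan ℝ (range b)) ⟨b k - c', (hc' k).1⟩ =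
      dist (b i) (b k) := fun i k => by simp [Subtype.dist_eq]
  have := dist_eq_of_inscribed h2 h2' (v := fun i => ⟨a i - c, (hc i).1⟩)
    (v' := fun i => ⟨b i - c', (hc' i).1⟩)
    (fun i k h => hinj (sub_left_injective (congrArg Subtype.val h)))
    (fun i k h => hinj' (sub_left_injective (congrArg Subtype.val h)))
    (fun i => (hc i).2) (fun i => (hc' i).2)
    (interior_convexHull_range_nonempty (c := c) fun i => rfl)
    (interior_convexHull_range_nonempty (c := c') fun i => rfl) ?_ ?_ ?_ i k
  · rwa [hdv, hdv'] at this
  · rintro ⟨n, hn⟩ hn0 i k hi hk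
    rw [hdv, hdv']
    simp only [Submodule.coe_inner, inner_sub_right, sub_le_sub_iff_right, sub_left_inj] at hi hk
    exact hdist n hn (fun h => hn0 (Subtype.ext h)) i k hi hk
  · rintro ⟨n, hn⟩ hn0 i hi
    simp only [Submodule.coe_inner, inner_sub_right, sub_le_sub_iff_right] at hi
    obtain ⟨n', hn', h0, h1, h2⟩ := hface n hn (fun h => hn0 (Subtype.ext h)) i hi
    refine ⟨⟨n', hn'⟩, fun h => h0 (congrArg Subtype.val h), ?_, ?_⟩
    · simpa only [Submodule.coe_inner, inner_sub_right, sub_le_sub_iff_right] using h1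
    · simpa only [Submodule.coe_inner, inner_sub_right, sub_left_inj] using h2
  · rintro ⟨n, hn⟩ hn0 i hi
    simp only [Submodule.coe_inner, inner_sub_right, sub_le_sub_iff_right] at hi
    obtain ⟨n', hn', h0, h1, h2⟩ := hface' n hn (fun h => hn0 (Subtype.ext h)) i hi
    refine ⟨⟨n', hn'⟩, fun h => h0 (congrArg Subtype.val h), ?_, ?_⟩
    · simpa only [Submodule.coe_inner, inner_sub_right, sub_le_sub_iff_right] using h1
    · simpa only [Submodule.coe_inner, inner_sub_right, sub_left_inj] using h2

/-- A distance-preserving correspondence between the vertices of a full-dimensional polytope and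
the vertices of another polytope is induced by a congruence. -/
theorem exists_isometryEquiv_image_convexHull_range [Fintype ι] {a b : ι → E}
    (hint : (interior (convexHull ℝ (range a))).Nonempty)
    (hdist : ∀ i k, dist (a i) (a k) = dist (b i) (b k)) :
    ∃ g : E ≃ᵢ E, g '' convexHull ℝ (range a) = convexHull ℝ (range b) := by
  have hne : (range a).Nonempty := by
    obtain ⟨x, hx⟩ := hint
    exact (convexHull_nonempty_iff (𝕜 := ℝ)).1 ⟨x, interior_subset hx⟩
  obtain ⟨_, i₀, rfl⟩ := id hne
  rw [interior_convexHull_nonempty_iff_affineSpan_eq_top,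
    AffineSubspace.affineSpan_eq_top_iff_vectorSpan_eq_top_of_nonempty ℝ _ _ hne,
    vectorSpan_range_eq_span_range_vsub_right ℝ a i₀] at hint
  have hgram : ∀ i k, ⟪a i - a i₀, a k - a i₀⟫ = ⟪b i - b i₀, b k - b i₀⟫ := by
    intro i k
    have h1 := norm_sub_sq_real (a i - a i₀) (a k - a i₀)
    have h2 := norm_sub_sq_real (b i - b i₀) (b k - b i₀)
    rw [sub_sub_sub_cancel_right] at h1 h2
    simp only [← dist_eq_norm, hdist] at h1 h2
    linarith
  set L : (ι → ℝ) →ₗ[ℝ] E := Fintype.linearCombination ℝ (fun i => a i - a i₀) with hL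
  set L' : (ι → ℝ) →ₗ[ℝ] E := Fintype.linearCombination ℝ (fun i => b i - b i₀) with hL'
  have hLrange : L.range = ⊤ := by
    rw [hL, Fintype.range_linearCombination]
    exact hint
  have hnorm : ∀ u, ‖L' u‖ = ‖L u‖ := by
    intro u
    have := norm_sum_smul_sub_eq (S := univ) (a := fun i => a i - a i₀) (b := fun i => b i - b i₀)
      (l := u) (m := 0) (fun i _ k _ => hgram i k) (by simp) (by simp)
    simpa [hL, hL', Fintype.linearCombination_apply] using this
  obtain ⟨r, hr⟩ := L.exists_rightInverse_of_surjective hLrange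
  have hr' : ∀ y, L (r y) = y := fun y => LinearMap.congr_fun hr y
  let T : E →ₗᵢ[ℝ] E := ⟨L' ∘ₗ r, fun y => by
    rw [LinearMap.comp_apply, hnorm, hr']⟩
  have hTL : ∀ u, T (L u) = L' u := by
    intro u
    have : ‖L' (r (L u) - u)‖ = 0 := by rw [hnorm, map_sub, hr', sub_self, norm_zero]
    rw [norm_eq_zero, map_sub, sub_eq_zero] at this
    exact this
  have hT : ∀ i, T (a i - a i₀) = b i - b i₀ := by
    classical
    intro i
    have := hTL (Pi.single i 1)
    simpa [hL, hL', Fintype.linearCombination_apply_single] using this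
  let Te : E ≃ₗᵢ[ℝ] E := T.toLinearIsometryEquiv rfl
  refine ⟨Te.toIsometryEquiv.trans (IsometryEquiv.addRight (b i₀ - T (a i₀))), ?_⟩
  let f : E →ᵃ[ℝ] E := T.toLinearMap.toAffineMap + AffineMap.const ℝ E (b i₀ - T (a i₀))
  have hf : ⇑(Te.toIsometryEquiv.trans (IsometryEquiv.addRight (b i₀ - T (a i₀)))) = f := by
    funext x
    simp [f, Te]
  rw [hf, AffineMap.image_convexHull, ← range_comp]
  congr 2
  funext i
  have := hT i
  rw [map_sub] at this
  simp only [f, Function.comp_apply, AffineMap.coe_add, Pi.add_apply, AffineMap.const_apply,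
    LinearMap.coe_toAffineMap, LinearIsometry.coe_toLinearMap]
  rw [add_sub_left_comm, this, add_sub_cancel]

end Affine

section Faces

variable {d : ℕ} {Q F G : Set (EuclideanSpace ℝ (Fin d))}

theorem finite_extremePoints_convexHull {E : Type*} [AddCommGroup E] [Module ℝ E] {W : Set E}
    (hW : W.Finite) : (extremePoints ℝ (convexHull ℝ W)).Finite :=
  hW.subset extremePoints_convexHull_subset

theorem convexHull_extremePoints_eq (hQc : IsCompact Q) (hQ : Convex ℝ Q)
    (hfin : (extremePoints ℝ Q).Finite) : convexHull ℝ (extremePoints ℝ Q) = Q := by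
  rw [← (hfin.isClosed_convexHull (𝕜 := ℝ)).closure_eq, closure_convexHull_extremePoints hQc hQ]

theorem exists_inner_of_mem_exposedFaces (hF : F ∈ exposedFaces Q) :
    ∃ n : EuclideanSpace ℝ (Fin d), ∀ x, x ∈ F ↔ x ∈ Q ∧ ∀ y ∈ Q, ⟪n, y⟫ ≤ ⟪n, x⟫ := by
  obtain ⟨l, hl⟩ := hF.2 hF.1
  refine ⟨(InnerProductSpace.toDual ℝ _).symm l, fun x => ?_⟩
  simp only [InnerProductSpace.toDual_symm_apply]
  rw [hl]
  rfl

theorem setOf_inner_max_mem_exposedFaces {n x : EuclideanSpace ℝ (Fin d)} (hx : x ∈ Q)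
    (hmax : ∀ y ∈ Q, ⟪n, y⟫ ≤ ⟪n, x⟫) :
    {x ∈ Q | ∀ y ∈ Q, ⟪n, y⟫ ≤ ⟪n, x⟫} ∈ exposedFaces Q :=
  ⟨⟨x, hx, hmax⟩, fun _ => ⟨InnerProductSpace.toDual ℝ _ n, rfl⟩⟩

theorem convexHull_extremePoints_of_mem_exposedFaces (hfin : (extremePoints ℝ Q).Finite)
    (hhull : convexHull ℝ (extremePoints ℝ Q) = Q) (hF : F ∈ exposedFaces Q) :
    convexHull ℝ (F ∩ extremePoints ℝ Q) = F := by
  have hQ : Convex ℝ Q := hhull ▸ convex_convexHull ℝ _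
  have hQc : IsCompact Q := by
    have := hfin.isCompact_convexHull (𝕜 := ℝ)
    rwa [hhull] at this
  rw [← hF.2.isExtreme.extremePoints_eq]
  exact convexHull_extremePoints_eq (hF.2.isCompact hQc) (hF.2.convex hQ)
    (hfin.subset hF.2.isExtreme.extremePoints_subset_extremePoints)

/-- An exposed face of an exposed face of a polytope is an exposed face of the polytope. -/
theorem exposedFaces_trans (hfin : (extremePoints ℝ Q).Finite)
    (hhull : convexHull ℝ (extremePoints ℝ Q) = Q) (hF : F ∈ exposedFaces Q)
    (hG : G ∈ exposedFaces F) : G ∈ exposedFaces Q := by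
  obtain ⟨n, hn⟩ := exists_inner_of_mem_exposedFaces hF
  obtain ⟨m, hm⟩ := exists_inner_of_mem_exposedFaces hG
  obtain ⟨g, hg⟩ := hG.1
  have hgF := (hm g).1 hg
  have hgQ := (hn g).1 hgF.1
  have hev : ∀ᶠ M : ℝ in Filter.atTop, ∀ w ∈ extremePoints ℝ Q,
      ⟪M • n + m, w⟫ ≤ ⟪M • n + m, g⟫ := by
    rw [Filter.eventually_all_finite hfin]
    intro w hw
    have hwQ : w ∈ Q := hw.1
    rcases (hgQ.2 w hwQ).eq_or_lt with h | h
    · have hwF : w ∈ F := (hn w).2 ⟨hwQ, fun y hy => by rw [h]; exact hgQ.2 y hy⟩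
      refine Filter.Eventually.of_forall fun M => ?_
      simp only [inner_add_left, inner_smul_left, h]
      linarith [hgF.2 w hwF]
    · filter_upwards [Filter.eventually_ge_atTop ((⟪m, w⟫ - ⟪m, g⟫) / (⟪n, g⟫ - ⟪n, w⟫))]
        with M hM
      rw [div_le_iff₀ (sub_pos.2 h)] at hM
      simp only [inner_add_left, inner_smul_left, conj_trivial]
      linarith
  obtain ⟨M, hM⟩ := hev.exists
  have hMQ : ∀ y ∈ Q, ⟪M • n + m, y⟫ ≤ ⟪M • n + m, g⟫ := by
    intro y hy
    rw [← hhull] at hy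
    exact convexHull_min hM (convex_halfSpace_le (innerₛₗ ℝ (M • n + m)).isLinear _) hy
  have hsplit : ∀ y, ⟪(M + 1) • n + m, y⟫ = ⟪M • n + m, y⟫ + ⟪n, y⟫ := fun y => by
    simp only [inner_add_left, inner_smul_left, conj_trivial]
    ring
  have heq : G = {x ∈ Q | ∀ y ∈ Q, ⟪(M + 1) • n + m, y⟫ ≤ ⟪(M + 1) • n + m, x⟫} := by
    ext x
    simp only [mem_ofPred_eq, hsplit]
    constructor
    · intro hx
      have hxF := (hm x).1 hx
      have hxQ := (hn x).1 hxF.1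
      refine ⟨hxQ.1, fun y hy => ?_⟩
      have h1 : ⟪n, x⟫ = ⟪n, g⟫ := le_antisymm (hgQ.2 x hxQ.1) (hxQ.2 g hgQ.1)
      have h2 : ⟪m, x⟫ = ⟪m, g⟫ := le_antisymm (hgF.2 x hxF.1) (hxF.2 g hgF.1)
      have h3 := hMQ y hy
      simp only [inner_add_left, inner_smul_left, h1, h2] at h3 ⊢
      linarith [hgQ.2 y hy]
    · rintro ⟨hxQ, hx⟩
      have h1 := hx g hgQ.1
      have h2 := hMQ x hxQ
      have h3 := hgQ.2 x hxQ
      have h4 : ⟪n, x⟫ = ⟪n, g⟫ := by linarith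
      have h5 : ⟪M • n + m, x⟫ = ⟪M • n + m, g⟫ := by linarith
      have hxF : x ∈ F := (hn x).2 ⟨hxQ, by rw [h4]; exact hgQ.2⟩
      simp only [inner_add_left, inner_smul_left, h4, add_right_inj] at h5
      exact (hm x).2 ⟨hxF, by rw [h5]; exact hgF.2⟩
  rw [heq]
  exact setOf_inner_max_mem_exposedFaces hgQ.1 fun y hy => by
    rw [hsplit, hsplit]
    exact add_le_add (hMQ y hy) (hgQ.2 y hy)

/-- A supporting functional that is not orthogonal to a face cuts out a face of smaller
dimension. -/
theorem exists_face_of_inner_max (hfin : (extremePoints ℝ Q).Finite)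
    (hhull : convexHull ℝ (extremePoints ℝ Q) = Q) (hF : F ∈ exposedFaces Q)
    {n x₀ : EuclideanSpace ℝ (Fin d)} (hn : n ∈ (affineSpan ℝ F).direction) (hn0 : n ≠ 0)
    (hx₀ : x₀ ∈ F) (hmax : ∀ y ∈ F, ⟪n, y⟫ ≤ ⟪n, x₀⟫) :
    ∃ G ∈ exposedFaces Q, G ⊆ F ∧ setDim G < setDim F ∧
      ∀ x ∈ F, x ∈ G ↔ ⟪n, x⟫ = ⟪n, x₀⟫ := by
  have hmem : ∀ x ∈ F, x ∈ {x ∈ F | ∀ y ∈ F, ⟪n, y⟫ ≤ ⟪n, x⟫} ↔ ⟪n, x⟫ = ⟪n, x₀⟫ := by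
    intro x hx
    constructor
    · rintro ⟨-, h⟩
      exact le_antisymm (hmax x hx) (h x₀ hx₀)
    · intro h
      exact ⟨hx, fun y hy => by rw [h]; exact hmax y hy⟩
  refine ⟨_, exposedFaces_trans hfin hhull hF (setOf_inner_max_mem_exposedFaces hx₀ hmax),
    sep_subset _ _, ?_, hmem⟩
  refine Submodule.finrank_lt_finrank_of_lt (lt_of_le_of_ne
    (AffineSubspace.direction_le (affineSpan_mono ℝ (sep_subset _ _))) fun h => ?_)
  rw [← h, direction_affineSpan] at hn
  have hle : vectorSpan ℝ {x ∈ F | ∀ y ∈ F, ⟪n, y⟫ ≤ ⟪n, x⟫} ≤ (ℝ ∙ n)ᗮ := by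
    rw [vectorSpan, Submodule.span_le]
    rintro _ ⟨x, hx, y, hy, rfl⟩
    change x - y ∈ (ℝ ∙ n)ᗮ
    rw [Submodule.mem_orthogonal_singleton_iff_inner_right, inner_sub_right,
      (hmem x hx.1).1 hx, (hmem y hy.1).1 hy, sub_self]
  exact hn0 (inner_self_eq_zero.1 (Submodule.mem_orthogonal_singleton_iff_inner_right.1 (hle hn)))

/-- A proper face of a face is cut out by a functional that is not orthogonal to it. -/
theorem exists_inner_max_of_face (hF : F ∈ exposedFaces Q) (hG : G ∈ exposedFaces Q)
    (hGF : G ⊂ F) : ∃ n ∈ (affineSpan ℝ F).direction, n ≠ 0 ∧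
      ∀ x ∈ G, ∀ y ∈ F, ⟪n, y⟫ ≤ ⟪n, x⟫ := by
  obtain ⟨m, hm⟩ := exists_inner_of_mem_exposedFaces hG
  have hFQ : F ⊆ Q := hF.2.subset
  set D := (affineSpan ℝ F).direction with hD
  have hproj : ∀ x ∈ F, ∀ y ∈ F, ⟪(D.orthogonalProjectionOnto m : EuclideanSpace ℝ (Fin d)), y⟫ -
      ⟪(D.orthogonalProjectionOnto m : EuclideanSpace ℝ (Fin d)), x⟫ = ⟪m, y⟫ - ⟪m, x⟫ := by
    intro x hx y hy
    rw [← inner_sub_right, ← inner_sub_right]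
    have : y - x ∈ D := AffineSubspace.vsub_mem_direction (subset_affineSpan ℝ F hy)
      (subset_affineSpan ℝ F hx)
    exact Submodule.inner_orthogonalProjectionOnto_eq_of_mem_right ⟨y - x, this⟩ m
  refine ⟨D.orthogonalProjectionOnto m, Subtype.coe_prop _, fun h0 => ?_, fun x hx y hy => ?_⟩
  · obtain ⟨y, hy, hyG⟩ := exists_of_ssubset hGF
    obtain ⟨x, hx⟩ := hG.1
    have := hproj x (hGF.1 hx) y hy
    rw [h0, inner_zero_left, inner_zero_left, sub_self] at this
    refine hyG ((hm y).2 ⟨hFQ hy, ?_⟩)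
    rw [sub_eq_zero.1 this.symm]
    exact ((hm x).1 hx).2
  · have h1 := hproj x (hGF.1 hx) y hy
    have h2 := ((hm x).1 hx).2 y (hFQ hy)
    linarith

theorem singleton_mem_exposedFaces (hhull : convexHull ℝ (extremePoints ℝ Q) = Q)
    {z : EuclideanSpace ℝ (Fin d)} {ρ : ℝ} (hz : ∀ x ∈ extremePoints ℝ Q, dist x z = ρ)
    {v : EuclideanSpace ℝ (Fin d)} (hv : v ∈ extremePoints ℝ Q) : {v} ∈ exposedFaces Q := by
  have hball : Q ⊆ closedBall z ρ := by
    rw [← hhull]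
    exact convexHull_min (fun x hx => (hz x hx).le) (convex_closedBall z ρ)
  have hvz := hz v hv
  have hmax : ∀ y ∈ Q, ⟪v - z, y - z⟫ ≤ ⟪v - z, v - z⟫ := by
    intro y hy
    have := hball hy
    rw [mem_closedBall, dist_eq_norm] at this
    rw [dist_eq_norm] at hvz
    rw [real_inner_self_eq_norm_sq, sq]
    refine (real_inner_le_norm _ _).trans ?_
    rw [hvz]
    exact mul_le_mul_of_nonneg_left this (hvz ▸ norm_nonneg _)
  have heq : {v} = {x ∈ Q | ∀ y ∈ Q, ⟪v - z, y⟫ ≤ ⟪v - z, x⟫} := by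
    ext x
    constructor
    · rintro rfl
      refine ⟨hv.1, fun y hy => ?_⟩
      have := hmax y hy
      simpa only [inner_sub_right, sub_le_sub_iff_right] using this
    · rintro ⟨hxQ, hx⟩
      have h1 := hx v hv.1
      have h2 := norm_sub_sq_real (v - z) (x - z)
      have h3 := hball hxQ
      rw [mem_closedBall, dist_eq_norm] at h3
      have h4 := pow_le_pow_left₀ (norm_nonneg _) h3 2
      have h5 : ⟪v - z, v - z⟫ ≤ ⟪v - z, x - z⟫ := by
        rw [inner_sub_right (v - z) v, inner_sub_right (v - z) x]
        linarith
      rw [real_inner_self_eq_norm_sq] at h5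
      rw [dist_eq_norm] at hvz
      rw [hvz, sub_sub_sub_cancel_right] at h2
      rw [hvz] at h5
      have h6 : ‖v - x‖ ^ 2 = 0 := le_antisymm (by linarith) (sq_nonneg _)
      exact (sub_eq_zero.1 (norm_eq_zero.1 ((pow_eq_zero_iff two_ne_zero).1 h6))).symm
  rw [heq]
  exact setOf_inner_max_mem_exposedFaces hv.1 fun y hy => by
    have := hmax y hy
    simpa only [inner_sub_right, sub_le_sub_iff_right] using this

theorem setDim_singleton (v : EuclideanSpace ℝ (Fin d)) : setDim {v} = 0 := by
  simp [setDim, direction_affineSpan]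

theorem subsingleton_of_setDim_eq_zero (h : setDim F = 0) : F.Subsingleton := by
  rw [setDim, Submodule.finrank_eq_zero, direction_affineSpan,
    vectorSpan_eq_bot_iff_subsingleton] at h
  exact h

theorem diam_eq_dist_of_setDim_eq_one (h : setDim F = 1) {v w : EuclideanSpace ℝ (Fin d)}
    (hv : v ∈ extremePoints ℝ F) (hw : w ∈ extremePoints ℝ F) (hvw : v ≠ w) :
    diam F = dist v w := by
  have hseg : F ⊆ convexHull ℝ {v, w} := by
    intro x hx
    have hmem : ∀ y ∈ F, y - v ∈ (affineSpan ℝ F).direction := fun y hy =>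
      AffineSubspace.vsub_mem_direction (subset_affineSpan ℝ F hy) (subset_affineSpan ℝ F hv.1)
    have hne : (⟨w - v, hmem w hw.1⟩ : (affineSpan ℝ F).direction) ≠ 0 := fun h0 =>
      hvw (sub_eq_zero.1 (congrArg Subtype.val h0)).symm
    obtain ⟨t, ht⟩ := (finrank_eq_one_iff_of_nonzero' _ hne).1 h ⟨x - v, hmem x hx⟩
    have ht : x = v + t • (w - v) := by
      have : t • (w - v) = x - v := congrArg Subtype.val ht
      rw [this, add_sub_cancel]
    rw [convexHull_pair, segment_eq_image']
    refine ⟨t, ⟨?_, ?_⟩, ht.symm⟩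
    · by_contra! h0
      refine hvw ((mem_extremePoints.1 hv).2 x hx w hw.1 ?_).2.symm
      refine ⟨1 / (1 - t), -t / (1 - t), div_pos one_pos (by linarith),
        div_pos (by linarith) (by linarith), ?_, ?_⟩
      · field_simp [show 1 - t ≠ 0 by linarith]
        ring
      · rw [ht]
        have : 1 - t ≠ 0 := by linarith
        match_scalars <;> field_simp <;> ring
    · by_contra! h1
      refine hvw ((mem_extremePoints.1 hw).2 v hv.1 x hx ?_).1
      refine ⟨(t - 1) / t, 1 / t, div_pos (by linarith) (by linarith),
        div_pos one_pos (by linarith), ?_, ?_⟩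
      · field_simp [show t ≠ 0 by linarith]
        ring
      · rw [ht]
        have : t ≠ 0 := by linarith
        match_scalars <;> field_simp
        ring
  refine le_antisymm ?_ ?_
  · have hb : Bornology.IsBounded (convexHull ℝ {v, w}) :=
      ((Set.toFinite _).isCompact_convexHull (𝕜 := ℝ)).isBounded
    have := diam_mono hseg hb
    rwa [convexHull_diam, diam_pair] at this
  · exact dist_le_diam_of_mem
      (((Set.toFinite _).isCompact_convexHull (𝕜 := ℝ)).isBounded.subset hseg)
      hv.1 hw.1

end Faces

section Correspondence

variable {d : ℕ} {Q Q' : Set (EuclideanSpace ℝ (Fin d))} {ι : Type*}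
  {a b : ι → EuclideanSpace ℝ (Fin d)}

theorem vectorSpan_range_of_mem_exposedFaces {F : Set (EuclideanSpace ℝ (Fin d))}
    (hfin : (extremePoints ℝ Q).Finite) (hhull : convexHull ℝ (extremePoints ℝ Q) = Q)
    (ha : range a = extremePoints ℝ Q) (hF : F ∈ exposedFaces Q) {p : ι → Prop}
    (hp : ∀ i, a i ∈ F ↔ p i) :
    vectorSpan ℝ (range fun i : {i // p i} => a i) = (affineSpan ℝ F).direction := by
  have hr : (range fun i : {i // p i} => a i) = F ∩ extremePoints ℝ Q := by
    rw [← ha]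
    ext x
    constructor
    · rintro ⟨i, rfl⟩
      exact ⟨(hp i).2 i.2, mem_range_self _⟩
    · rintro ⟨hx, i, rfl⟩
      exact ⟨⟨i, (hp i).1 hx⟩, rfl⟩
  rw [hr, ← direction_affineSpan, ← affineSpan_convexHull,
    convexHull_extremePoints_of_mem_exposedFaces hfin hhull hF]

/-- An order isomorphism of face lattices carries supporting functionals of a face to supporting
functionals of its image. -/
theorem exists_inner_max_map_face (hfin : (extremePoints ℝ Q).Finite)
    (hhull : convexHull ℝ (extremePoints ℝ Q) = Q) (ha : range a = extremePoints ℝ Q)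
    (φ : {F // F ∈ exposedFaces Q} ≃o {F // F ∈ exposedFaces Q'})
    (hab : ∀ F i, a i ∈ F.1 ↔ b i ∈ (φ F).1) (F : {F // F ∈ exposedFaces Q})
    {n : EuclideanSpace ℝ (Fin d)} (hn : n ∈ (affineSpan ℝ F.1).direction) (hn0 : n ≠ 0)
    {i : ι} (hi : a i ∈ F.1) (hmax : ∀ l, a l ∈ F.1 → ⟪n, a l⟫ ≤ ⟪n, a i⟫) :
    ∃ G : {F // F ∈ exposedFaces Q}, setDim G.1 < setDim F.1 ∧
      (∀ k, a k ∈ F.1 → (a k ∈ G.1 ↔ ⟪n, a k⟫ = ⟪n, a i⟫)) ∧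
      ∃ n' ∈ (affineSpan ℝ (φ F).1).direction, n' ≠ 0 ∧
        (∀ l, b l ∈ (φ F).1 → ⟪n', b l⟫ ≤ ⟪n', b i⟫) ∧
        ∀ k, a k ∈ F.1 → ⟪n, a k⟫ = ⟪n, a i⟫ → ⟪n', b k⟫ = ⟪n', b i⟫ := by
  have hmaxF : ∀ y ∈ F.1, ⟪n, y⟫ ≤ ⟪n, a i⟫ := by
    intro y hy
    rw [← convexHull_extremePoints_of_mem_exposedFaces hfin hhull F.2, ← ha] at hy
    refine convexHull_min ?_ (convex_halfSpace_le (innerₛₗ ℝ n).isLinear _) hy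
    rintro _ ⟨hx, l, rfl⟩
    exact hmax l hx
  obtain ⟨G, hG, hGF, hdim, hmem⟩ := exists_face_of_inner_max hfin hhull F.2 hn hn0 hi hmaxF
  have hlt : (⟨G, hG⟩ : {F // F ∈ exposedFaces Q}) < F := by
    refine lt_of_le_of_ne hGF ?_
    rintro rfl
    exact hdim.ne rfl
  obtain ⟨n', hn', hn'0, hmax'⟩ := exists_inner_max_of_face (φ F).2 (φ ⟨G, hG⟩).2
    (φ.lt_iff_lt.2 hlt)
  have hGb : ∀ k, a k ∈ F.1 → ⟪n, a k⟫ = ⟪n, a i⟫ → b k ∈ (φ ⟨G, hG⟩).1 := fun k hk h =>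
    (hab ⟨G, hG⟩ k).1 ((hmem _ hk).2 h)
  refine ⟨⟨G, hG⟩, hdim, fun k hk => hmem _ hk, n', hn', hn'0,
    fun l hl => hmax' _ (hGb i hi rfl) _ hl, fun k hk h => ?_⟩
  exact le_antisymm (hmax' _ (hGb i hi rfl) _ ((hab F k).1 hk))
    (hmax' _ (hGb k hk h) _ ((hab F i).1 hi))

theorem extremePoints_of_mem_exposedFaces {F : Set (EuclideanSpace ℝ (Fin d))}
    (ha : range a = extremePoints ℝ Q) (hF : F ∈ exposedFaces Q) {i : ι} (hi : a i ∈ F) :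
    a i ∈ extremePoints ℝ F := by
  rw [hF.2.isExtreme.extremePoints_eq, ← ha]
  exact ⟨hi, mem_range_self i⟩

/-- Corresponding vertices of corresponding faces have equal distances when edges correspond
isometrically and all faces of dimension at least two are inscribed in spheres. -/
theorem dist_eq_of_mem_face [Finite ι] (hfin : (extremePoints ℝ Q).Finite)
    (hhull : convexHull ℝ (extremePoints ℝ Q) = Q)
    (hfin' : (extremePoints ℝ Q').Finite) (hhull' : convexHull ℝ (extremePoints ℝ Q') = Q')
    (ha : range a = extremePoints ℝ Q) (hb : range b = extremePoints ℝ Q')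
    (hinj : Function.Injective a) (hinj' : Function.Injective b)
    (φ : {F // F ∈ exposedFaces Q} ≃o {F // F ∈ exposedFaces Q'})
    (hab : ∀ F i, a i ∈ F.1 ↔ b i ∈ (φ F).1)
    (hdimeq : ∀ F, setDim (φ F).1 = setDim F.1)
    (hedge : ∀ F, setDim F.1 = 1 → diam (φ F).1 = diam F.1)
    (hins : ∀ F ∈ exposedFaces Q, 2 ≤ setDim F → ∃ z ρ, ∀ x ∈ extremePoints ℝ F, dist x z = ρ)
    (hins' : ∀ F ∈ exposedFaces Q', 2 ≤ setDim F → ∃ z ρ, ∀ x ∈ extremePoints ℝ F, dist x z = ρ)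
    (F : {F // F ∈ exposedFaces Q}) {i k : ι} (hi : a i ∈ F.1) (hk : a k ∈ F.1) :
    dist (a i) (a k) = dist (b i) (b k) := by
  induction hm : setDim F.1 using Nat.strong_induction_on generalizing F i k with
  | _ m ih =>
  rcases eq_or_ne i k with rfl | hik
  · simp
  obtain hm0 | hm1 | hm2 : m = 0 ∨ m = 1 ∨ 2 ≤ m := by omega
  · exact absurd (hinj (subsingleton_of_setDim_eq_zero (hm.trans hm0) hi hk)) hik
  · have h1 := hm.trans hm1
    rw [← diam_eq_dist_of_setDim_eq_one h1 (extremePoints_of_mem_exposedFaces ha F.2 hi)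
      (extremePoints_of_mem_exposedFaces ha F.2 hk) (hinj.ne hik),
      ← diam_eq_dist_of_setDim_eq_one ((hdimeq F).trans h1)
      (extremePoints_of_mem_exposedFaces hb (φ F).2 ((hab F i).1 hi))
      (extremePoints_of_mem_exposedFaces hb (φ F).2 ((hab F k).1 hk)) (hinj'.ne hik), hedge F h1]
  · have h2 : 2 ≤ setDim F.1 := hm ▸ hm2
    have h2' : 2 ≤ setDim (φ F).1 := (hdimeq F).symm ▸ h2
    have hab' : ∀ F' i, b i ∈ F'.1 ↔ a i ∈ (φ.symm F').1 := fun F' i => by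
      rw [hab, φ.apply_symm_apply]
    have hs := vectorSpan_range_of_mem_exposedFaces (p := fun i => a i ∈ F.1) hfin hhull ha F.2
      fun i => Iff.rfl
    have hs' := vectorSpan_range_of_mem_exposedFaces (p := fun i => a i ∈ F.1) hfin' hhull' hb
      (φ F).2 fun i => (hab F i).symm
    obtain ⟨z, ρ, hz⟩ := hins F.1 F.2 h2
    obtain ⟨z', ρ', hz'⟩ := hins' _ (φ F).2 h2'
    have : Nonempty {i // a i ∈ F.1} := ⟨⟨i, hi⟩⟩
    have := Fintype.ofFinite {i // a i ∈ F.1}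
    refine dist_eq_of_inscribed_affine (a := fun i : {i // a i ∈ F.1} => a i)
      (b := fun i : {i // a i ∈ F.1} => b i) (by rwa [hs]) (by rwa [hs'])
      (hinj.comp Subtype.val_injective) (hinj'.comp Subtype.val_injective) (z := z) (z' := z')
      (fun i => hz _ (extremePoints_of_mem_exposedFaces ha F.2 i.2))
      (fun i => hz' _ (extremePoints_of_mem_exposedFaces hb (φ F).2 ((hab F i).1 i.2)))
      ?_ ?_ ?_ ⟨i, hi⟩ ⟨k, hk⟩
    · rw [hs]
      intro n hn hn0 i k hmax hik
      obtain ⟨G, hG, hGF, -⟩ := exists_inner_max_map_face hfin hhull ha φ hab F hn hn0 i.2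
        fun l hl => hmax ⟨l, hl⟩
      exact ih _ (hm ▸ hG) G ((hGF i i.2).2 rfl) ((hGF k k.2).2 hik) rfl
    · rw [hs, hs']
      intro n hn hn0 i hmax
      obtain ⟨-, -, -, n', hn', hn'0, hmax', heq⟩ := exists_inner_max_map_face hfin hhull ha φ hab
        F hn hn0 i.2 fun l hl => hmax ⟨l, hl⟩
      exact ⟨n', hn', hn'0, fun l => hmax' l ((hab F l).1 l.2), fun k => heq k k.2⟩
    · rw [hs, hs']
      intro n hn hn0 i hmax
      obtain ⟨-, -, -, n', hn', hn'0, hmax', heq⟩ := exists_inner_max_map_face hfin' hhull' hb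
        φ.symm hab' (φ F) hn hn0 ((hab F i).1 i.2) fun l hl => hmax ⟨l, (hab F l).2 hl⟩
      rw [φ.symm_apply_apply] at hn' hmax'
      exact ⟨n', hn', hn'0, fun l => hmax' l l.2, fun k => heq k ((hab F k).1 k.2)⟩

theorem exists_singleton_eq_map (hhull : convexHull ℝ (extremePoints ℝ Q) = Q)
    (φ : {F // F ∈ exposedFaces Q} ≃o {F // F ∈ exposedFaces Q'})
    (hdimeq : ∀ F, setDim (φ F).1 = setDim F.1)
    {z : EuclideanSpace ℝ (Fin d)} {ρ : ℝ} (hz : ∀ x ∈ extremePoints ℝ Q, dist x z = ρ)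
    {v : EuclideanSpace ℝ (Fin d)} (hv : v ∈ extremePoints ℝ Q) :
    ∃ w ∈ extremePoints ℝ Q', ∀ F, v ∈ F.1 ↔ w ∈ (φ F).1 := by
  obtain ⟨V, hV⟩ : ∃ V : {F // F ∈ exposedFaces Q}, V.1 = {v} :=
    ⟨⟨_, singleton_mem_exposedFaces hhull hz hv⟩, rfl⟩
  obtain ⟨w, hw⟩ := (φ V).2.1
  have h0 : setDim (φ V).1 = 0 := by rw [hdimeq, hV, setDim_singleton]
  have hW : (φ V).1 = {w} := (subsingleton_of_setDim_eq_zero h0).eq_singleton_of_mem hw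
  refine ⟨w, isExtreme_singleton.1 (hW ▸ (φ V).2.2.isExtreme), fun F => ?_⟩
  rw [← singleton_subset_iff, ← singleton_subset_iff, ← hW, ← hV]
  exact φ.le_iff_le.symm

theorem setDim_eq_of_interior_nonempty (h : (interior Q).Nonempty) : setDim Q = d := by
  have : affineSpan ℝ Q = ⊤ := top_unique
    ((isOpen_interior.affineSpan_eq_top h).ge.trans (affineSpan_mono ℝ interior_subset))
  rw [setDim, this, AffineSubspace.direction_top, finrank_top, finrank_euclideanSpace_fin]

end Correspondence

/-- two combinatorially equivalent polytopes all of whose faces of dimension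
at least 2 are inscribed in spheres, with equal corresponding edge lengths, are congruent. -/
theorem stmt10 {d : ℕ} (hd : 2 ≤ d)
    (Q Q' : Set (EuclideanSpace ℝ (Fin d)))
    (hQ : ∃ V : Finset (EuclideanSpace ℝ (Fin d)), Q = convexHull ℝ (V : Set (EuclideanSpace ℝ (Fin d))))
    (hQ' : ∃ V : Finset (EuclideanSpace ℝ (Fin d)), Q' = convexHull ℝ (V : Set (EuclideanSpace ℝ (Fin d))))
    (hQint : (interior Q).Nonempty) (hQ'int : (interior Q').Nonempty)
    (φ : {F // F ∈ exposedFaces Q} ≃o {F // F ∈ exposedFaces Q'})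
    (hdimeq : ∀ F : {F // F ∈ exposedFaces Q},
      setDim ((φ F : Set (EuclideanSpace ℝ (Fin d)))) = setDim (F : Set (EuclideanSpace ℝ (Fin d))))
    (hedge : ∀ F : {F // F ∈ exposedFaces Q},
      setDim (F : Set (EuclideanSpace ℝ (Fin d))) = 1 →
      Metric.diam ((φ F : Set (EuclideanSpace ℝ (Fin d)))) =
        Metric.diam ((F : Set (EuclideanSpace ℝ (Fin d)))))
    (hinscribed : ∀ F ∈ exposedFaces Q, 2 ≤ setDim F → setDim F ≤ d →
      ∃ (z : EuclideanSpace ℝ (Fin d)) (ρ : ℝ), 0 ≤ ρ ∧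
        ∀ x ∈ Set.extremePoints ℝ F, dist x z = ρ)
    (hinscribed' : ∀ F ∈ exposedFaces Q', 2 ≤ setDim F → setDim F ≤ d →
      ∃ (z : EuclideanSpace ℝ (Fin d)) (ρ : ℝ), 0 ≤ ρ ∧
        ∀ x ∈ Set.extremePoints ℝ F, dist x z = ρ) :
    ∃ g : EuclideanSpace ℝ (Fin d) ≃ᵢ EuclideanSpace ℝ (Fin d), g '' Q = Q' := by
  have hpoly : ∀ P : Set (EuclideanSpace ℝ (Fin d)),
      (∃ V : Finset (EuclideanSpace ℝ (Fin d)), P = convexHull ℝ (V : Set _)) →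
      (extremePoints ℝ P).Finite ∧ convexHull ℝ (extremePoints ℝ P) = P := by
    rintro _ ⟨V, rfl⟩
    have h := finite_extremePoints_convexHull V.finite_toSet
    exact ⟨h, convexHull_extremePoints_eq (V.finite_toSet.isCompact_convexHull (𝕜 := ℝ))
      (convex_convexHull ℝ _) h⟩
  obtain ⟨hfin, hhull⟩ := hpoly Q hQ
  obtain ⟨hfin', hhull'⟩ := hpoly Q' hQ'
  have hself : Q ∈ exposedFaces Q := ⟨hQint.mono interior_subset, IsExposed.refl Q⟩
  have hself' : Q' ∈ exposedFaces Q' := ⟨hQ'int.mono interior_subset, IsExposed.refl Q'⟩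
  have hle : ∀ F : Set (EuclideanSpace ℝ (Fin d)), setDim F ≤ d := fun F =>
    (Submodule.finrank_le _).trans_eq finrank_euclideanSpace_fin
  have hins : ∀ F ∈ exposedFaces Q, 2 ≤ setDim F →
      ∃ z ρ, ∀ x ∈ extremePoints ℝ F, dist x z = ρ := fun F hF h2 =>
    let ⟨z, ρ, _, h⟩ := hinscribed F hF h2 (hle F)
    ⟨z, ρ, h⟩
  have hins' : ∀ F ∈ exposedFaces Q', 2 ≤ setDim F →
      ∃ z ρ, ∀ x ∈ extremePoints ℝ F, dist x z = ρ := fun F hF h2 =>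
    let ⟨z, ρ, _, h⟩ := hinscribed' F hF h2 (hle F)
    ⟨z, ρ, h⟩
  obtain ⟨z, ρ, hz⟩ := hins Q hself (hd.trans (setDim_eq_of_interior_nonempty hQint).ge)
  obtain ⟨z', ρ', hz'⟩ := hins' Q' hself' (hd.trans (setDim_eq_of_interior_nonempty hQ'int).ge)
  choose! f hf hfφ using fun v (hv : v ∈ extremePoints ℝ Q) =>
    exists_singleton_eq_map hhull φ hdimeq hz hv
  have hab : ∀ F (i : extremePoints ℝ Q), (i : EuclideanSpace ℝ (Fin d)) ∈ F.1 ↔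
      f i ∈ (φ F).1 := fun F i => hfφ i i.2 F
  have hdimeq' : ∀ F, setDim (φ.symm F).1 = setDim F.1 := fun F => by
    rw [← hdimeq, φ.apply_symm_apply]
  have hb : range (fun i : extremePoints ℝ Q => f i) = extremePoints ℝ Q' := by
    refine subset_antisymm (range_subset_iff.2 fun i => hf i i.2) fun w hw => ?_
    obtain ⟨v, hv, hvw⟩ := exists_singleton_eq_map hhull' φ.symm hdimeq' hz' hw
    have hW := singleton_mem_exposedFaces hhull' hz' hw
    have h := (hvw ⟨{w}, hW⟩).1 rfl
    rw [hfφ v hv, φ.apply_symm_apply] at h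
    exact ⟨⟨v, hv⟩, h⟩
  have hinj' : Function.Injective fun i : extremePoints ℝ Q => f i := by
    intro i k hik
    have hV := singleton_mem_exposedFaces hhull hz k.2
    have h := (hab ⟨_, hV⟩ k).1 rfl
    rw [← show f i = f k from hik, ← hab ⟨_, hV⟩ i] at h
    exact Subtype.ext h
  have ha : range ((↑) : extremePoints ℝ Q → EuclideanSpace ℝ (Fin d)) = extremePoints ℝ Q :=
    Subtype.range_coe
  have := hfin.fintype
  have hdist : ∀ i k : extremePoints ℝ Q, dist (i : EuclideanSpace ℝ (Fin d)) k =
      dist (f i) (f k) := fun i k =>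
    dist_eq_of_mem_face hfin hhull hfin' hhull' ha hb Subtype.val_injective hinj' φ hab hdimeq
      hedge hins hins' ⟨Q, hself⟩ i.2.1 k.2.1
  obtain ⟨g, hg⟩ := exists_isometryEquiv_image_convexHull_range
    (a := ((↑) : extremePoints ℝ Q → EuclideanSpace ℝ (Fin d))) (b := fun i => f i)
    (by rwa [ha, hhull]) hdist
  rw [ha, hb, hhull, hhull'] at hg
  exact ⟨g, hg⟩
end

section
/- Let n ≥ 3 and let p, q : ℤ/nℤ → E² be injective maps such that: all points p(i) lie on a common circle, each p(i) is an extreme point of conv(p(ℤ/nℤ)), and the segments [p(i), p(i+1)], i ∈ ℤ/nℤ, are exactly the 1-dimensional exposed faces (edges) of conv(p(ℤ/nℤ)); and the same holds for q. If dist(p(i), p(i+1)) = dist(q(i), q(i+1)) for all i ∈ ℤ/nℤ, then there exists an isometry g of E² with g(p(i)) = q(i) for all i ∈ ℤ/nℤ. (A convex polygon inscribed in a circle is determined, up to congruence, by the lengths and cyclic order of its sides.) -/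
open Metric Set
open scoped RealInnerProductSpace

/-- If `x + y` is split compatibly with `x' + y'`, a chord comparison for the summands gives one
for the sum; it is strict as soon as `x' < x`. -/
lemma mul_sin_add_le_mul_sin_add {R R' x y x' y' : ℝ} (hR : 0 < R) (hx' : 0 ≤ x')
    (hy' : 0 ≤ y') (hxx : x' ≤ x) (hyy : y' ≤ y) (hxy : x + y ≤ Real.pi)
    (hxy' : x' + y' ≤ Real.pi / 2)
    (hx : R * Real.sin x ≤ R' * Real.sin x') (hy : R * Real.sin y ≤ R' * Real.sin y') :
    R * Real.sin (x + y) ≤ R' * Real.sin (x' + y') ∧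
      (x' < x → 0 < y → R * Real.sin (x + y) < R' * Real.sin (x' + y')) := by
  have hpi := Real.pi_pos
  have hcx' : 0 ≤ Real.cos x' := Real.cos_nonneg_of_mem_Icc ⟨by linarith, by linarith⟩
  have hcy' : 0 ≤ Real.cos y' := Real.cos_nonneg_of_mem_Icc ⟨by linarith, by linarith⟩
  have hcx : Real.cos x ≤ Real.cos x' :=
    Real.cos_le_cos_of_nonneg_of_le_pi hx' (by linarith) hxx
  have hcy : Real.cos y ≤ Real.cos y' :=
    Real.cos_le_cos_of_nonneg_of_le_pi hy' (by linarith) hyy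
  have hsx : 0 ≤ R * Real.sin x :=
    mul_nonneg hR.le (Real.sin_nonneg_of_nonneg_of_le_pi (by linarith) (by linarith))
  have hsy : 0 ≤ R * Real.sin y :=
    mul_nonneg hR.le (Real.sin_nonneg_of_nonneg_of_le_pi (by linarith) (by linarith))
  have h1 := mul_le_mul_of_nonneg_right hx hcy'
  have h2 := mul_le_mul_of_nonneg_right hy hcx'
  have h3 := mul_le_mul_of_nonneg_left hcy hsx
  have h4 := mul_le_mul_of_nonneg_left hcx hsy
  rw [Real.sin_add, Real.sin_add]
  refine ⟨by linarith, fun hlt hy0 => ?_⟩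
  have hcx : Real.cos x < Real.cos x' :=
    Real.cos_lt_cos_of_nonneg_of_le_pi hx' (by linarith) hlt
  have hsy : 0 < R * Real.sin y :=
    mul_pos hR (Real.sin_pos_of_pos_of_lt_pi hy0 (by linarith))
  have h4 := mul_lt_mul_of_pos_left hcx hsy
  linarith

lemma mul_sin_sum_le_mul_sin_sum {ι : Type*} {R R' : ℝ} (hR : 0 < R) {a b : ι → ℝ}
    (s : Finset ι) (hb : ∀ i ∈ s, 0 < b i) (hab : ∀ i ∈ s, b i ≤ a i)
    (hsa : ∑ i ∈ s, a i ≤ Real.pi) (hsb : ∑ i ∈ s, b i ≤ Real.pi / 2)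
    (h : ∀ i ∈ s, R * Real.sin (a i) = R' * Real.sin (b i)) :
    R * Real.sin (∑ i ∈ s, a i) ≤ R' * Real.sin (∑ i ∈ s, b i) := by
  classical
  induction s using Finset.induction_on with
  | empty => simp
  | insert j s hj ih =>
    rw [Finset.sum_insert hj] at hsa hsb ⊢
    rw [Finset.sum_insert hj]
    simp only [Finset.mem_insert, forall_eq_or_imp] at hb hab h
    have hs0 : 0 ≤ ∑ i ∈ s, b i := Finset.sum_nonneg fun i hi => (hb.2 i hi).le
    have hss : ∑ i ∈ s, b i ≤ ∑ i ∈ s, a i := Finset.sum_le_sum hab.2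
    exact (mul_sin_add_le_mul_sin_add hR hb.1.le hs0 hab.1 hss hsa hsb h.1.le
      (ih hb.2 hab.2 (by linarith [hab.1, hb.1]) (by linarith [hb.1]) h.2)).1

lemma eqOn_of_mul_sin_eq_of_le {ι : Type*} {R R' : ℝ} (hR : 0 < R) (hRR : R ≤ R')
    {a b : ι → ℝ} (s : Finset ι) (hs : 3 ≤ s.card) (ha : ∀ i ∈ s, 0 < a i)
    (hb : ∀ i ∈ s, 0 < b i) (hsa : ∑ i ∈ s, a i = Real.pi) (hsb : ∑ i ∈ s, b i = Real.pi)
    (h : ∀ i ∈ s, R * Real.sin (a i) = R' * Real.sin (b i)) :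
    ∀ i ∈ s, a i = b i := by
  classical
  have hpi := Real.pi_pos
  have hale : ∀ i ∈ s, a i ≤ Real.pi := fun i hi =>
    hsa ▸ Finset.single_le_sum (fun j hj => (ha j hj).le) hi
  have key : ∀ i ∈ s, b i ≤ Real.pi / 2 → b i ≤ a i := by
    intro i hi hbi
    by_contra! hlt
    have h1 : Real.sin (a i) < Real.sin (b i) :=
      Real.sin_lt_sin_of_lt_of_le_pi_div_two (by linarith [ha i hi]) hbi hlt
    have h2 : 0 ≤ Real.sin (a i) :=
      Real.sin_nonneg_of_nonneg_of_le_pi (ha i hi).le (hale i hi)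
    nlinarith [h i hi]
  by_cases hbig : ∀ i ∈ s, b i ≤ Real.pi / 2
  · intro i hi
    exact ((Finset.sum_eq_sum_iff_of_le fun i hi => key i hi (hbig i hi)).1
      (hsb.trans hsa.symm) i hi).symm
  push Not at hbig
  obtain ⟨m, hm, hbm⟩ := hbig
  have hea := Finset.add_sum_erase s a hm
  have heb := Finset.add_sum_erase s b hm
  have hbe : ∀ i ∈ s.erase m, 0 < b i := fun i hi => hb i (Finset.mem_of_mem_erase hi)
  have hle : ∀ i ∈ s.erase m, b i ≤ a i := by
    intro i hi
    refine key i (Finset.mem_of_mem_erase hi) ?_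
    have := Finset.single_le_sum (fun j hj => (hbe j hj).le) hi
    linarith
  have hsame : ∀ i ∈ s.erase m, b i = a i := by
    by_contra! hne
    obtain ⟨j, hj, hjne⟩ := hne
    have hlt : b j < a j := lt_of_le_of_ne (hle j hj) hjne
    have hea' := Finset.add_sum_erase (s.erase m) a hj
    have heb' := Finset.add_sum_erase (s.erase m) b hj
    set T := (s.erase m).erase j with hT
    have hTs : ∀ i ∈ T, i ∈ s.erase m := fun i hi => Finset.mem_of_mem_erase hi
    have hTss : ∀ i ∈ T, i ∈ s := fun i hi => Finset.mem_of_mem_erase (hTs i hi)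
    have hTne : T.Nonempty := by
      rw [← Finset.card_pos, hT, Finset.card_erase_of_mem hj, Finset.card_erase_of_mem hm]
      omega
    have hTa : 0 < ∑ i ∈ T, a i := Finset.sum_pos (fun i hi => ha i (hTss i hi)) hTne
    have hTb : 0 < ∑ i ∈ T, b i := Finset.sum_pos (fun i hi => hb i (hTss i hi)) hTne
    have hTle : ∑ i ∈ T, b i ≤ ∑ i ∈ T, a i := Finset.sum_le_sum fun i hi => hle i (hTs i hi)
    have ham := ha m hm
    have hbj := hbe j hj
    have hTsin := mul_sin_sum_le_mul_sin_sum hR T (fun i hi => hb i (hTss i hi))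
      (fun i hi => hle i (hTs i hi)) (by linarith) (by linarith) (fun i hi => h i (hTss i hi))
    have hstrict := (mul_sin_add_le_mul_sin_add hR hbj.le hTb.le hlt.le hTle (by linarith)
      (by linarith) (h j (Finset.mem_of_mem_erase hj)).le hTsin).2 hlt hTa
    have e1 : a j + ∑ i ∈ T, a i = Real.pi - a m := by linarith
    have e2 : b j + ∑ i ∈ T, b i = Real.pi - b m := by linarith
    rw [e1, e2, Real.sin_pi_sub, Real.sin_pi_sub, h m hm] at hstrict
    exact lt_irrefl _ hstrict
  intro i hi
  by_cases him : i = m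
  · subst him
    have := Finset.sum_congr rfl hsame
    linarith
  · exact (hsame i (Finset.mem_erase.2 ⟨him, hi⟩)).symm

/-- The half-arcs of a convex cyclic polygon are determined by its side lengths. -/
lemma eqOn_of_mul_sin_eq {ι : Type*} {R R' : ℝ} (hR : 0 < R) (hR' : 0 < R')
    {a b : ι → ℝ} (s : Finset ι) (hs : 3 ≤ s.card) (ha : ∀ i ∈ s, 0 < a i)
    (hb : ∀ i ∈ s, 0 < b i) (hsa : ∑ i ∈ s, a i = Real.pi) (hsb : ∑ i ∈ s, b i = Real.pi)
    (h : ∀ i ∈ s, R * Real.sin (a i) = R' * Real.sin (b i)) :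
    ∀ i ∈ s, a i = b i := by
  rcases le_total R R' with hRR | hRR
  · exact eqOn_of_mul_sin_eq_of_le hR hRR s hs ha hb hsa hsb h
  · exact fun i hi => (eqOn_of_mul_sin_eq_of_le hR' hRR s hs hb ha hsb hsa
      (fun i hi => (h i hi).symm) i hi).symm

lemma exists_support_of_edge {n : ℕ} {p : ZMod n → EuclideanSpace ℝ (Fin 2)}
    (hp : Function.Injective p)
    (hext : ∀ i, p i ∈ Set.extremePoints ℝ (convexHull ℝ (Set.range p))) (i : ZMod n)
    (hexp : IsExposed ℝ (convexHull ℝ (Set.range p)) (segment ℝ (p i) (p (i + 1)))) :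
    ∃ l : EuclideanSpace ℝ (Fin 2) →ₗ[ℝ] ℝ, l (p i) = l (p (i + 1)) ∧
      ∀ k, k ≠ i → k ≠ i + 1 → l (p k) < l (p i) := by
  obtain ⟨l, hl⟩ := hexp ⟨p i, left_mem_segment ℝ _ _⟩
  have hmem : ∀ k, p k ∈ convexHull ℝ (Set.range p) := fun k =>
    subset_convexHull ℝ _ (Set.mem_range_self k)
  have hi : p i ∈ segment ℝ (p i) (p (i + 1)) := left_mem_segment ℝ _ _
  have hi1 : p (i + 1) ∈ segment ℝ (p i) (p (i + 1)) := right_mem_segment ℝ _ _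
  rw [hl] at hi hi1
  refine ⟨l.toLinearMap, le_antisymm (hi1.2 _ (hmem _)) (hi.2 _ (hmem _)), fun k hki hki1 => ?_⟩
  refine lt_of_le_of_ne (hi.2 _ (hmem k)) fun heq => ?_
  have hk : p k ∈ segment ℝ (p i) (p (i + 1)) := by
    rw [hl]
    exact ⟨hmem k, fun y hy => (hi.2 y hy).trans heq.ge⟩
  rcases (mem_extremePoints_iff_forall_segment.1 (hext k)).2 _ (hmem i) _ (hmem (i + 1)) hk
    with h | h
  · exact hki (hp h).symm
  · exact hki1 (hp h).symm

/-- Twice the signed area of the triangle `a b c`. -/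
def signedArea (a b c : ℂ) : ℝ :=
  (b.re - a.re) * (c.im - a.im) - (b.im - a.im) * (c.re - a.re)

lemma signedArea_rotate (a b c : ℂ) : signedArea a b c = signedArea b c a := by
  simp only [signedArea]; ring

lemma signedArea_conj (a b c : ℂ) :
    signedArea (starRingEnd ℂ a) (starRingEnd ℂ b) (starRingEnd ℂ c) = -signedArea a b c := by
  simp only [signedArea, Complex.conj_re, Complex.conj_im]; ring

lemma signedArea_mul_pos_of_support (l : ℂ →ₗ[ℝ] ℝ) {a b c d : ℂ} (hab : a ≠ b)
    (hl : l a = l b) (hc : l c < l a) (hd : l d < l a) :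
    0 < signedArea a b c * signedArea a b d := by
  have hform : ∀ w : ℂ, l w = w.re * l 1 + w.im * l Complex.I := by
    intro w
    conv_lhs => rw [← Complex.re_add_im w]
    have : (w.re : ℂ) + w.im * Complex.I = w.re • (1 : ℂ) + w.im • Complex.I := by simp
    rw [this, map_add, map_smul, map_smul, smul_eq_mul, smul_eq_mul]
  set α := l 1
  set β := l Complex.I
  have hv : 0 < (b.re - a.re) ^ 2 + (b.im - a.im) ^ 2 := by
    by_contra! h
    refine hab (Complex.ext ?_ ?_) <;>
      nlinarith [sq_nonneg (b.re - a.re), sq_nonneg (b.im - a.im)]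
  rw [hform a, hform b] at hl
  have hx := sub_neg.2 hc
  have hy := sub_neg.2 hd
  rw [hform a, hform c] at hx
  rw [hform a, hform d] at hy
  have hid : ∀ w : ℂ,
      (b.re - a.re) * (w.re * α + w.im * β - (a.re * α + a.im * β)) = β * signedArea a b w ∧
      (b.im - a.im) * (w.re * α + w.im * β - (a.re * α + a.im * β)) =
        -α * signedArea a b w := by
    intro w
    simp only [signedArea]
    constructor
    · linear_combination (a.re - w.re) * hl
    · linear_combination (a.im - w.im) * hl
  obtain ⟨c1, c2⟩ := hid c
  obtain ⟨d1, d2⟩ := hid d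
  set A := c.re * α + c.im * β - (a.re * α + a.im * β)
  set B := d.re * α + d.im * β - (a.re * α + a.im * β)
  have hsum : ((b.re - a.re) ^ 2 + (b.im - a.im) ^ 2) * (A * B) =
      (α ^ 2 + β ^ 2) * (signedArea a b c * signedArea a b d) := by
    calc _ = ((b.re - a.re) * A) * ((b.re - a.re) * B) +
          ((b.im - a.im) * A) * ((b.im - a.im) * B) := by ring
      _ = _ := by rw [c1, c2, d1, d2]; ring
  have hpos := mul_pos hv (mul_pos_of_neg_of_neg hx hy)
  rw [hsum] at hpos
  exact pos_of_mul_pos_right hpos (by positivity)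

lemma signedArea_zero_mul_pos {n : ℕ} (hn : 3 ≤ n) {P : ZMod n → ℂ}
    (hP : Function.Injective P)
    (hl : ∀ i, ∃ l : ℂ →ₗ[ℝ] ℝ, l (P i) = l (P (i + 1)) ∧
      ∀ k, k ≠ i → k ≠ i + 1 → l (P k) < l (P i)) (j : ℕ) (hj : 0 < j) (hjn : j + 1 < n) :
    0 < signedArea (P 0) (P 1) (P 2) * signedArea (P 0) (P j) (P (j + 1)) := by
  have hcast : ∀ m : ℕ, 0 < m → m < n → (m : ZMod n) ≠ 0 := by
    intro m hm hmn h0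
    rw [ZMod.natCast_eq_zero_iff] at h0
    exact absurd (Nat.le_of_dvd hm h0) (by omega)
  have h1 : (1 : ZMod n) ≠ 0 := by simpa using hcast 1 (by omega) (by omega)
  have h2 : (2 : ZMod n) ≠ 0 := by simpa using hcast 2 (by omega) (by omega)
  have hside : ∀ i k k' : ZMod n, k ≠ i → k ≠ i + 1 → k' ≠ i → k' ≠ i + 1 →
      0 < signedArea (P i) (P (i + 1)) (P k) * signedArea (P i) (P (i + 1)) (P k') := by
    intro i k k' hk hk1 hk' hk1'
    obtain ⟨l, hl1, hl2⟩ := hl i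
    refine signedArea_mul_pos_of_support l (fun h => h1 ?_) hl1 (hl2 k hk hk1) (hl2 k' hk' hk1')
    simpa using hP h
  have hchain : ∀ m : ℕ, 0 < signedArea (P 0) (P 1) (P 2) *
      signedArea (P m) (P (m + 1)) (P (m + 2)) := by
    intro m
    induction m with
    | zero =>
      have := hside 0 2 2 h2 (fun h => h1 (by linear_combination h)) h2
        (fun h => h1 (by linear_combination h))
      simpa using this
    | succ m ih =>
      have h := hside (m + 1) m (m + 1 + 2) (fun h => h1 (by linear_combination -h))
        (fun h => h2 (by linear_combination -h)) (fun h => h2 (by linear_combination h))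
        (fun h => h1 (by linear_combination h))
      rw [← signedArea_rotate, show (m : ZMod n) + 1 + 1 = m + 2 by ring] at h
      push_cast
      rw [show (m : ZMod n) + 1 + 1 = m + 2 by ring]
      have h3 := mul_pos ih h
      refine pos_of_mul_pos_right (a := signedArea (P m) (P (m + 1)) (P (m + 2)) ^ 2) ?_
        (sq_nonneg _)
      linarith
  have hc := hchain j
  have hj0 := hcast j hj (by omega)
  have hj1 : (j : ZMod n) + 1 ≠ 0 := by exact_mod_cast hcast (j + 1) (by omega) hjn
  have h := hside j (j + 2) 0 (fun h => h2 (by linear_combination h))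
    (fun h => h1 (by linear_combination h)) hj0.symm hj1.symm
  rw [← signedArea_rotate (P 0)] at h
  have h3 := mul_pos hc h
  refine pos_of_mul_pos_right (a := signedArea (P j) (P (j + 1)) (P (j + 2)) ^ 2) ?_
    (sq_nonneg _)
  linarith

lemma exists_half_angle {w : ℂ} {R : ℝ} (hw : ‖w‖ = R) :
    ∃ t : ℝ, 0 ≤ t ∧ t < Real.pi ∧ w = R * Complex.exp (2 * t * Complex.I) := by
  have hpi := Real.pi_pos
  have hform := Complex.norm_mul_exp_arg_mul_I w
  rw [hw] at hform
  rcases le_or_gt 0 w.arg with h | h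
  · refine ⟨w.arg / 2, by linarith, by linarith [Complex.arg_le_pi w], ?_⟩
    rw [show 2 * ((w.arg / 2 : ℝ) : ℂ) * Complex.I = w.arg * Complex.I by push_cast; ring, hform]
  · refine ⟨w.arg / 2 + Real.pi, by linarith [Complex.neg_pi_lt_arg w], by linarith, ?_⟩
    rw [show 2 * ((w.arg / 2 + Real.pi : ℝ) : ℂ) * Complex.I =
      w.arg * Complex.I + 2 * Real.pi * Complex.I by push_cast; ring, Complex.exp_add,
      Complex.exp_two_pi_mul_I, mul_one, hform]

lemma exp_two_mul_I_re_im (R t : ℝ) :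
    ((R : ℂ) * Complex.exp (2 * t * Complex.I)).re = R * (1 - 2 * Real.sin t ^ 2) ∧
      ((R : ℂ) * Complex.exp (2 * t * Complex.I)).im = R * (2 * Real.sin t * Real.cos t) := by
  have : (2 * (t : ℂ) * Complex.I) = ((2 * t : ℝ) : ℂ) * Complex.I := by push_cast; ring
  rw [this, Complex.re_ofReal_mul, Complex.im_ofReal_mul, Complex.exp_ofReal_mul_I_re,
    Complex.exp_ofReal_mul_I_im, Real.cos_two_mul, Real.sin_two_mul]
  refine ⟨?_, rfl⟩
  linear_combination 2 * R * Real.sin_sq_add_cos_sq t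

lemma signedArea_circle (R s t : ℝ) :
    signedArea R (R * Complex.exp (2 * s * Complex.I)) (R * Complex.exp (2 * t * Complex.I)) =
      4 * R ^ 2 * (Real.sin s * Real.sin t * Real.sin (t - s)) := by
  obtain ⟨h1, h2⟩ := exp_two_mul_I_re_im R s
  obtain ⟨h3, h4⟩ := exp_two_mul_I_re_im R t
  rw [signedArea, h1, h2, h3, h4, Complex.ofReal_re, Complex.ofReal_im, Real.sin_sub]
  ring

lemma dist_circle {R s t : ℝ} (hR : 0 ≤ R) (hst : s ≤ t) (hts : t - s ≤ Real.pi) :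
    dist ((R : ℂ) * Complex.exp (2 * s * Complex.I)) (R * Complex.exp (2 * t * Complex.I)) =
      2 * R * Real.sin (t - s) := by
  obtain ⟨h1, h2⟩ := exp_two_mul_I_re_im R s
  obtain ⟨h3, h4⟩ := exp_two_mul_I_re_im R t
  have hs : 0 ≤ Real.sin (t - s) :=
    Real.sin_nonneg_of_nonneg_of_le_pi (by linarith) hts
  rw [Complex.dist_eq_re_im, h1, h2, h3, h4,
    ← Real.sqrt_sq (by positivity : 0 ≤ 2 * R * Real.sin (t - s)), Real.sin_sub]
  congr 1
  linear_combination 4 * R ^ 2 * (Real.sin s ^ 2 - Real.sin t ^ 2) *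
    (Real.sin_sq_add_cos_sq s - Real.sin_sq_add_cos_sq t)

/-- A convex polygon inscribed in a circle can be moved by an isometry to the circle
`‖w‖ = R` of `ℂ`, starting at `R` and going around once counterclockwise. -/
lemma exists_isometry_normal_form {n : ℕ} (hn : 3 ≤ n)
    {p : ZMod n → EuclideanSpace ℝ (Fin 2)} (hp : Function.Injective p)
    (hcirc : ∃ (z : EuclideanSpace ℝ (Fin 2)) (ρ : ℝ), ∀ i, dist (p i) z = ρ)
    (hext : ∀ i, p i ∈ Set.extremePoints ℝ (convexHull ℝ (Set.range p)))
    (hedge : {F : Set (EuclideanSpace ℝ (Fin 2)) |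
        IsExposed ℝ (convexHull ℝ (Set.range p)) F ∧ setDim F = 1}
      = {F | ∃ i : ZMod n, F = segment ℝ (p i) (p (i + 1))}) :
    ∃ (g : EuclideanSpace ℝ (Fin 2) ≃ᵢ ℂ) (R : ℝ) (t : ℕ → ℝ), 0 < R ∧ t 0 = 0 ∧
      t n = Real.pi ∧ StrictMonoOn t (Set.Iic n) ∧
      ∀ j ≤ n, g (p j) = R * Complex.exp (2 * t j * Complex.I) := by
  obtain ⟨z, R, hz⟩ := hcirc
  have hne : ∀ m : ℕ, 0 < m → m < n → (m : ZMod n) ≠ 0 := by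
    intro m hm hmn h0
    rw [ZMod.natCast_eq_zero_iff] at h0
    exact absurd (Nat.le_of_dvd hm h0) (by omega)
  have hR : 0 < R := by
    refine lt_of_le_of_ne (hz 0 ▸ dist_nonneg) fun h => ?_
    have h0 := hz 0
    have h1 := hz 1
    rw [← h, dist_eq_zero] at h0 h1
    have := hp (h1.trans h0.symm)
    exact hne 1 one_pos (by omega) (by simpa using this)
  -- A linear isometry moves `p 0 - z` to the positive real axis.
  obtain ⟨A, hA⟩ : ∃ A : EuclideanSpace ℝ (Fin 2) ≃ₗᵢ[ℝ] ℂ, A (p 0 - z) = R := by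
    set e := Complex.orthonormalBasisOneI.repr.symm
    have hnorm : ‖e (p 0 - z)‖ = R := by
      rw [LinearIsometryEquiv.norm_map, ← dist_eq_norm, hz]
    refine ⟨e.trans (rotation (Circle.exp (-(e (p 0 - z)).arg))), ?_⟩
    rw [LinearIsometryEquiv.trans_apply, rotation_apply, Circle.coe_exp]
    have hpolar := Complex.norm_mul_exp_arg_mul_I (e (p 0 - z))
    rw [hnorm] at hpolar
    generalize (e (p 0 - z)).arg = φ at hpolar ⊢
    rw [← hpolar, mul_left_comm, ← Complex.exp_add]
    simp
  have hfun : ∀ (B : EuclideanSpace ℝ (Fin 2) ≃ₗᵢ[ℝ] ℂ) (i : ZMod n), ∃ l : ℂ →ₗ[ℝ] ℝ,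
      l (B (p i - z)) = l (B (p (i + 1) - z)) ∧
      ∀ k, k ≠ i → k ≠ i + 1 → l (B (p k - z)) < l (B (p i - z)) := by
    intro B i
    have hexp : segment ℝ (p i) (p (i + 1)) ∈ {F : Set (EuclideanSpace ℝ (Fin 2)) |
        IsExposed ℝ (convexHull ℝ (Set.range p)) F ∧ setDim F = 1} := by
      rw [hedge]; exact ⟨i, rfl⟩
    obtain ⟨l, hl1, hl2⟩ := exists_support_of_edge hp hext i hexp.1
    refine ⟨l ∘ₗ B.symm.toLinearEquiv.toLinearMap, ?_, fun k hk hk1 => ?_⟩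
    · simp [hl1]
    · simpa using hl2 k hk hk1
  have hinj : ∀ B : EuclideanSpace ℝ (Fin 2) ≃ₗᵢ[ℝ] ℂ,
      Function.Injective fun i => B (p i - z) := by
    intro B i j hij
    exact hp (sub_left_injective (B.injective hij))
  obtain ⟨B, hB0, hBpos⟩ : ∃ B : EuclideanSpace ℝ (Fin 2) ≃ₗᵢ[ℝ] ℂ, B (p 0 - z) = R ∧
      0 ≤ signedArea (B (p 0 - z)) (B (p 1 - z)) (B (p 2 - z)) := by
    rcases le_total 0 (signedArea (A (p 0 - z)) (A (p 1 - z)) (A (p 2 - z))) with h | h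
    · exact ⟨A, hA, h⟩
    · refine ⟨A.trans Complex.conjLIE, by simp [hA], ?_⟩
      simp only [LinearIsometryEquiv.trans_apply, Complex.conjLIE_apply, signedArea_conj]
      linarith
  have hor : ∀ j : ℕ, 0 < j → j + 1 < n →
      0 < signedArea R (B (p j - z)) (B (p (j + 1) - z)) := by
    intro j hj hjn
    have := signedArea_zero_mul_pos hn (hinj B) (hfun B) j hj hjn
    simp only [hB0] at this hBpos
    exact pos_of_mul_pos_right this hBpos
  have hnorm : ∀ i, ‖B (p i - z)‖ = R := by
    intro i
    rw [LinearIsometryEquiv.norm_map, ← dist_eq_norm, hz]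
  choose θ hθ0 hθpi hθ using fun i => exists_half_angle (hnorm i)
  have hθpos : ∀ i, i ≠ 0 → 0 < θ i := by
    intro i hi
    refine lt_of_le_of_ne (hθ0 i) fun h => hi (hinj B ?_)
    have := hθ i
    rw [← h] at this
    simpa [hB0] using this
  refine ⟨(IsometryEquiv.subRight z).trans B.toIsometryEquiv, R,
    fun j => if j = 0 then 0 else if j = n then Real.pi else θ j, hR, by simp,
    by simp; omega, strictMonoOn_Iic_of_lt_succ ?_, ?_⟩
  · intro j hj
    rw [Nat.succ_eq_succ, Nat.succ_eq_add_one]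
    rcases Nat.eq_zero_or_pos j with rfl | hj0
    · simp only [if_true, zero_add, one_ne_zero, if_false]
      rw [if_neg (by omega)]
      exact hθpos _ (hne 1 one_pos (by omega))
    · simp only [hj0.ne', hj.ne, if_false, Nat.succ_ne_zero]
      split_ifs with hjn
      · exact hθpi _
      have h := hor j hj0 (by omega)
      have hs1 := Real.sin_pos_of_pos_of_lt_pi (hθpos j (hne j hj0 hj)) (hθpi j)
      have hs2 := Real.sin_pos_of_pos_of_lt_pi
        (hθpos (j + 1 : ℕ) (hne (j + 1) (by omega) (by omega))) (hθpi (j + 1 : ℕ))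
      have hcast : (j : ZMod n) + 1 = (j + 1 : ℕ) := by push_cast; rfl
      rw [hcast, hθ, hθ (j + 1 : ℕ), signedArea_circle] at h
      by_contra! hle
      have hs3 : Real.sin (θ (j + 1 : ℕ) - θ j) ≤ 0 :=
        Real.sin_nonpos_of_nonpos_of_neg_pi_le (by linarith)
          (by linarith [hθ0 (j + 1 : ℕ), hθpi j])
      have := mul_nonpos_of_nonneg_of_nonpos (mul_pos hs1 hs2).le hs3
      nlinarith [sq_nonneg R]
  · intro j hj
    simp only [IsometryEquiv.trans_apply, IsometryEquiv.subRight_apply,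
      LinearIsometryEquiv.coe_toIsometryEquiv]
    split_ifs with h0 hjn
    · subst h0; simp [hB0]
    · subst hjn; simp [hB0, Complex.exp_two_pi_mul_I]
    · exact hθ j

/-- a convex polygon inscribed in a circle is determined up to congruence by
the lengths and cyclic order of its sides. -/
theorem stmt11 (n : ℕ) (hn : 3 ≤ n)
    (p q : ZMod n → EuclideanSpace ℝ (Fin 2))
    (hp : Function.Injective p) (hq : Function.Injective q)
    (hpcirc : ∃ (z : EuclideanSpace ℝ (Fin 2)) (ρ : ℝ), ∀ i, dist (p i) z = ρ)
    (hqcirc : ∃ (z : EuclideanSpace ℝ (Fin 2)) (ρ : ℝ), ∀ i, dist (q i) z = ρ)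
    (hpext : ∀ i, p i ∈ Set.extremePoints ℝ (convexHull ℝ (Set.range p)))
    (hqext : ∀ i, q i ∈ Set.extremePoints ℝ (convexHull ℝ (Set.range q)))
    (hpedge : {F : Set (EuclideanSpace ℝ (Fin 2)) |
        IsExposed ℝ (convexHull ℝ (Set.range p)) F ∧ setDim F = 1}
      = {F | ∃ i : ZMod n, F = segment ℝ (p i) (p (i + 1))})
    (hqedge : {F : Set (EuclideanSpace ℝ (Fin 2)) |
        IsExposed ℝ (convexHull ℝ (Set.range q)) F ∧ setDim F = 1}
      = {F | ∃ i : ZMod n, F = segment ℝ (q i) (q (i + 1))})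
    (hlen : ∀ i : ZMod n, dist (p i) (p (i + 1)) = dist (q i) (q (i + 1))) :
    ∃ g : EuclideanSpace ℝ (Fin 2) ≃ᵢ EuclideanSpace ℝ (Fin 2), ∀ i, g (p i) = q i := by
  obtain ⟨g, R, t, hR, ht0, htn, hmono, hg⟩ := exists_isometry_normal_form hn hp hpcirc hpext hpedge
  obtain ⟨g', R', t', hR', ht0', htn', hmono', hg'⟩ :=
    exists_isometry_normal_form hn hq hqcirc hqext hqedge
  have hstep : ∀ {u : ℕ → ℝ}, u 0 = 0 → u n = Real.pi → StrictMonoOn u (Set.Iic n) →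
      ∀ j < n, 0 < u (j + 1) - u j ∧ u (j + 1) - u j ≤ Real.pi ∧
        (j = 0 → u (j + 1) - u j < Real.pi) := by
    intro u h0 hpi hu j hj
    have h1 := hu (Set.mem_Iic.2 hj.le) (Set.mem_Iic.2 hj) j.lt_succ_self
    have h2 := hu.monotoneOn (Set.mem_Iic.2 hj) (Set.mem_Iic.2 le_rfl) hj
    have h3 := hu.monotoneOn (Set.mem_Iic.2 n.zero_le) (Set.mem_Iic.2 hj.le) j.zero_le
    rw [Nat.succ_eq_add_one] at h1 h2
    refine ⟨by linarith, by linarith, ?_⟩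
    rintro rfl
    have h4 := hu (Set.mem_Iic.2 hj) (Set.mem_Iic.2 le_rfl) (show 0 + 1 < n by omega)
    linarith
  have hstp := hstep ht0 htn hmono
  have hstp' := hstep ht0' htn' hmono'
  have hside : ∀ j ∈ Finset.range n, R * Real.sin (t (j + 1) - t j) =
      R' * Real.sin (t' (j + 1) - t' j) := by
    intro j hj
    rw [Finset.mem_range] at hj
    have h := hlen j
    have hcast : (j : ZMod n) + 1 = (j + 1 : ℕ) := by push_cast; rfl
    rw [hcast, ← g.dist_eq, ← g'.dist_eq, hg j hj.le, hg (j + 1) hj, hg' j hj.le,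
      hg' (j + 1) hj, dist_circle hR.le (sub_pos.1 (hstp j hj).1).le (hstp j hj).2.1,
      dist_circle hR'.le (sub_pos.1 (hstp' j hj).1).le (hstp' j hj).2.1] at h
    linarith
  have hdiff := eqOn_of_mul_sin_eq hR hR' (Finset.range n) (by simpa using hn)
    (fun j hj => (hstp j (Finset.mem_range.1 hj)).1)
    (fun j hj => (hstp' j (Finset.mem_range.1 hj)).1)
    (by rw [Finset.sum_range_sub, ht0, htn, sub_zero])
    (by rw [Finset.sum_range_sub, ht0', htn', sub_zero]) hside
  have ht : ∀ j ≤ n, t j = t' j := by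
    intro j
    induction j with
    | zero => simp [ht0, ht0']
    | succ j ih =>
      intro hj
      have := hdiff j (Finset.mem_range.2 hj)
      linarith [ih (by omega)]
  have hRR : R = R' := by
    have h0 : 0 ∈ Finset.range n := Finset.mem_range.2 (by omega)
    have h := hside 0 h0
    rw [hdiff 0 h0] at h
    obtain ⟨hpos, -, hlt⟩ := hstp' 0 (by omega)
    exact mul_right_cancel₀ (Real.sin_pos_of_pos_of_lt_pi hpos (hlt rfl)).ne' h
  have : NeZero n := ⟨by omega⟩
  refine ⟨g.trans g'.symm, fun i => ?_⟩
  rw [IsometryEquiv.trans_apply, IsometryEquiv.symm_apply_eq]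
  have hv := (ZMod.val_lt i).le
  have h1 := hg i.val hv
  have h2 := hg' i.val hv
  rw [ZMod.natCast_zmod_val] at h1 h2
  rw [h1, h2, hRR, ht _ hv]
end
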